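/- (Parametric holonomic approximation by multi-sections, relative in the parameter; Theorem 8.5 of del Pino–Toussaint, stated over the n-torus with real parameter s.) Fix integers n ≥ 1, ℓ ≥ 1, r ≥ 1 and ε > 0. Let σ_i : ℝ × ℝⁿ → Sym^i(ℝⁿ,ℝ^ℓ), 0 ≤ i ≤ r, be jointly continuous maps with σ_i(s, p+m) = σ_i(s, p) for all m ∈ ℤⁿ, and suppose there is a smooth ℤⁿ-periodic map g : ℝⁿ → ℝ^ℓ such that the family is holonomic for s ≤ 0: σ_i(s, p) = iteratedFDeriv ℝ i g p for all s ≤ 0, all p and all i. Then there exist jointly smooth maps X : ℝ × ℝⁿ → ℝⁿ and ζ_i : ℝ × ℝⁿ → Sym^i(ℝⁿ,ℝ^ℓ), 0 ≤ i ≤ r, such that: (a) for every s ≤ 0, X(s,p) = p and ζ_i(s,p) = iteratedFDeriv ℝ i g p; (b) for every s, the tuple (X(s,·), ζ_i(s,·)) is a ℤⁿ-equivariant integral r-jet tuple; (c) for every s, the set {p : fderiv ℝ (X(s,·)) p is a linear isomorphism} is dense in ℝⁿ; (d) for every s, the front p ↦ (X(s,p), ζ_0(s,p)) is injective modulo ℤⁿ;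 (e) for all s, p and 0 ≤ i ≤ r, ‖X(s,p) − p‖ < ε and ‖ζ_i(s,p) − σ_i(s,p)‖ < ε. -/

import Mathlib

/- `ℝⁿ` in standard coordinates. -/
noncomputable section

abbrev Vec (n : ℕ) := Fin n → ℝ

/-- The ambient space of `Sym^i(ℝⁿ, ℝ^ℓ)`: continuous `i`-multilinear maps `(ℝⁿ)^i → ℝ^ℓ`. -/
abbrev SymMap (n ℓ i : ℕ) := ContinuousMultilinearMap ℝ (fun _ : Fin i => Vec n) (Vec ℓ)

/-- A multilinear map is symmetric if it is invariant under permutations of its arguments. -/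
def IsSymmMap {n ℓ i : ℕ} (A : SymMap n ℓ i) : Prop :=
  ∀ (e : Equiv.Perm (Fin i)) (v : Fin i → Vec n), A (v ∘ e) = A v

/-- The inclusion `ℤⁿ → ℝⁿ`. -/
def zcast {n : ℕ} (m : Fin n → ℤ) : Vec n := fun j => (m j : ℝ)

noncomputable section
open Set Filter Topology
open scoped ContDiff

theorem smooth_iter {E G F : Type*} [NormedAddCommGroup E] [NormedSpace ℝ E]
    [NormedAddCommGroup G] [NormedSpace ℝ G] [NormedAddCommGroup F] [NormedSpace ℝ F]
    {f : E × G → F} (hf : ContDiff ℝ ∞ f) (i : ℕ) :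
    ContDiff ℝ ∞ (fun y : E × G => iteratedFDeriv ℝ i (fun x' => f (y.1, x')) y.2) := by
  induction i with
  | zero =>
    simp only [iteratedFDeriv_zero_eq_comp]
    exact (LinearIsometryEquiv.contDiff (continuousMultilinearCurryFin0 ℝ G F).symm).comp hf
  | succ i ih =>
    simp only [iteratedFDeriv_succ_eq_comp_left]
    have := ContDiff.fderiv (𝕜 := ℝ) (m := ∞) (n := ∞)
      (f := fun (y : E × G) (x : G) => iteratedFDeriv ℝ i (fun x' => f (y.1, x')) x)
      (g := fun y : E × G => y.2)
      (by
        have : (Function.uncurry fun (y : E × G) (x : G) =>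
          iteratedFDeriv ℝ i (fun x' => f (y.1, x')) x) =
          (fun y : E × G => iteratedFDeriv ℝ i (fun x' => f (y.1, x')) y.2) ∘
            (fun q : (E × G) × G => (q.1.1, q.2)) := by
          funext q; rfl
        rw [this]
        exact ih.comp (by fun_prop))
      contDiff_snd (by simp)
    exact (LinearIsometryEquiv.contDiff (𝕜 := ℝ) (E := G →L[ℝ] (G [×i]→L[ℝ] F))
      (F := G [×(i+1)]→L[ℝ] F)
      (continuousMultilinearCurryLeftEquiv ℝ (fun _ : Fin (i + 1) => G) F).symm).comp this

theorem smooth_iter_comp {E G F Y : Type*} [NormedAddCommGroup E] [NormedSpace ℝ E]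
    [NormedAddCommGroup G] [NormedSpace ℝ G] [NormedAddCommGroup F] [NormedSpace ℝ F]
    [NormedAddCommGroup Y] [NormedSpace ℝ Y]
    {f : E × G → F} (hf : ContDiff ℝ ∞ f) (i : ℕ) {e : Y → E} {x : Y → G}
    (he : ContDiff ℝ ∞ e) (hx : ContDiff ℝ ∞ x) :
    ContDiff ℝ ∞ (fun y => iteratedFDeriv ℝ i (fun x' => f (e y, x')) (x y)) :=
  (smooth_iter hf i).comp (he.prodMk hx)

theorem cont_iter_comp {E G F Y : Type*} [NormedAddCommGroup E] [NormedSpace ℝ E]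
    [NormedAddCommGroup G] [NormedSpace ℝ G] [NormedAddCommGroup F] [NormedSpace ℝ F]
    [TopologicalSpace Y]
    {f : E × G → F} (hf : ContDiff ℝ ∞ f) (i : ℕ) {e : Y → E} {x : Y → G}
    (he : Continuous e) (hx : Continuous x) :
    Continuous (fun y => iteratedFDeriv ℝ i (fun x' => f (e y, x')) (x y)) :=
  (smooth_iter hf i).continuous.comp (he.prodMk hx)

/-- choose a smooth function of a real parameter in convex sets -/
theorem smooth_choice (t : ℝ → Set ℝ) (ht : ∀ s, Convex ℝ (t s))
    (H : ∀ s, ∃ c, ∀ᶠ y in 𝓝 s, c ∈ t y) :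
    ∃ ν : ℝ → ℝ, ContDiff ℝ ∞ ν ∧ ∀ s, ν s ∈ t s := by
  obtain ⟨g, hg⟩ := exists_contMDiffMap_forall_mem_convex_of_local_const
    (n := (⊤ : ℕ∞)) (modelWithCornersSelf ℝ ℝ) (M := ℝ) (F := ℝ) (t := t) ht H
  exact ⟨g, g.contMDiff.contDiff, hg⟩

theorem tube {Y P : Type*} [TopologicalSpace Y] [SeminormedAddCommGroup P]
    {C : Set Y} (hC : IsCompact C) {O : Set (ℝ × Y × P)} (hO : IsOpen O)
    (h0 : ∀ s, ∀ y ∈ C, (s, y, (0 : P)) ∈ O) :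
    ∃ ν : ℝ → ℝ, ContDiff ℝ ∞ ν ∧ (∀ s, 0 < ν s ∧ ν s ≤ 1) ∧
      ∀ s, ∀ y ∈ C, ∀ m : P, ‖m‖ ≤ ν s → (s, y, m) ∈ O := by
  obtain ⟨ν, hν, h⟩ := smooth_choice
    (fun s => {c | (0 < c ∧ c ≤ 1) ∧ ∀ y ∈ C, ∀ m : P, ‖m‖ ≤ c → (s, y, m) ∈ O})
    (by
      intro s
      apply Set.OrdConnected.convex
      refine ⟨?_⟩
      rintro a ⟨⟨ha, _⟩, _⟩ b ⟨⟨_, hb1⟩, hb⟩ c ⟨hac, hcb⟩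
      exact ⟨⟨lt_of_lt_of_le ha hac, hcb.trans hb1⟩, fun y hy m hm => hb y hy m (hm.trans hcb)⟩)
    (by
      intro s
      have h1 : ∀ᶠ q : ℝ × P in 𝓝 (s, 0), ∀ y ∈ C, (q.1, y, q.2) ∈ O := by
        apply hC.eventually_forall_of_forall_eventually
          (P := fun (q : ℝ × P) y => (q.1, y, q.2) ∈ O)
        intro y hy
        have : Continuous (fun z : (ℝ × P) × Y => (z.1.1, z.2, z.1.2)) := by fun_prop
        exact this.continuousAt.eventually_mem (hO.mem_nhds (h0 s y hy))
      rw [nhds_prod_eq] at h1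
      obtain ⟨pa, hpa, pb, hpb, hab⟩ := Filter.eventually_prod_iff.1 h1
      obtain ⟨δ, hδ, hball⟩ := Metric.eventually_nhds_iff.1 hpb
      refine ⟨min 1 (δ / 2), ?_⟩
      filter_upwards [hpa] with y hy
      refine ⟨⟨by positivity, min_le_left _ _⟩, fun z hz m hm => hab hy (hball ?_) z hz⟩
      rw [dist_zero_right]
      have := min_le_right 1 (δ / 2)
      linarith)
  exact ⟨ν, hν, fun s => (h s).1, fun s => (h s).2⟩

/-- periodization -/
def Per {A : Type*} (f : A → ℝ → ℝ) (c : A → ℝ) (a : A) (u : ℝ) : ℝ :=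
  f a (Int.fract u) + c a * ⌊u⌋

section
variable {A : Type*} {f : A → ℝ → ℝ} {c : A → ℝ}

theorem Per_eq (h0 : ∀ a u, u ≤ 3/8 → f a u = 0) (h1 : ∀ a u, 5/8 ≤ u → f a u = c a)
    (a : A) (m : ℤ) (u : ℝ) (hu : m - 3/8 ≤ u) (hu' : u ≤ m + 1 + 3/8) :
    Per f c a u = f a (u - m) + c a * m := by
  unfold Per
  rcases lt_or_ge u m with h | h
  · have : ⌊u⌋ = m - 1 := by
      rw [Int.floor_eq_iff]; push_cast; constructor <;> linarith
    rw [Int.fract, this, h1 a _ (by push_cast; linarith), h0 a (u - m) (by linarith)]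
    push_cast; ring
  rcases lt_or_ge u (m+1) with h' | h'
  · have : ⌊u⌋ = m := by
      rw [Int.floor_eq_iff]; constructor <;> linarith
    rw [Int.fract, this]
  · have : ⌊u⌋ = m + 1 := by
      rw [Int.floor_eq_iff]; push_cast; constructor <;> linarith
    rw [Int.fract, this, h0 a _ (by push_cast; linarith), h1 a (u - m) (by linarith)]
    push_cast; ring

theorem Per_add_one (a : A) (u : ℝ) : Per f c a (u + 1) = Per f c a u + c a := by
  unfold Per
  rw [Int.fract_add_one, Int.floor_add_one]; push_cast; ring

theorem Per_eventually (h0 : ∀ a u, u ≤ 3/8 → f a u = 0) (h1 : ∀ a u, 5/8 ≤ u → f a u = c a)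
    (u : ℝ) : ∀ᶠ u' in 𝓝 u, ∀ a, Per f c a u' = f a (u' - ⌊u⌋) + c a * ⌊u⌋ := by
  have hm := Int.floor_le u
  have hm' := Int.lt_floor_add_one u
  filter_upwards [Ioo_mem_nhds (show (⌊u⌋:ℝ) - 3/8 < u by linarith)
    (show u < ⌊u⌋ + 1 + 3/8 by linarith)] with u' hu' a
  exact Per_eq h0 h1 a _ u' hu'.1.le hu'.2.le

theorem Per_hasDerivAt (h0 : ∀ a u, u ≤ 3/8 → f a u = 0) (h1 : ∀ a u, 5/8 ≤ u → f a u = c a)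
    {f' : A → ℝ → ℝ} (hf : ∀ a u, HasDerivAt (f a) (f' a u) u) (a : A) (u : ℝ) :
    HasDerivAt (Per f c a) (f' a (Int.fract u)) u := by
  have h := (Per_eventually h0 h1 u).mono (fun u' hu' => hu' a)
  refine HasDerivAt.congr_of_eventuallyEq ?_ h
  exact (HasDerivAt.comp_sub_const u (⌊u⌋:ℝ) (hf a _)).add_const _

theorem Per_smooth [NormedAddCommGroup A] [NormedSpace ℝ A]
    (h0 : ∀ a u, u ≤ 3/8 → f a u = 0) (h1 : ∀ a u, 5/8 ≤ u → f a u = c a)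
    (hf : ContDiff ℝ ∞ (fun q : A × ℝ => f q.1 q.2)) :
    ContDiff ℝ ∞ (fun q : A × ℝ => Per f c q.1 q.2) := by
  have hc : ContDiff ℝ ∞ c := by
    have : c = fun a => f a 1 := by
      funext a; rw [h1 a 1 (by norm_num)]
    rw [this]
    exact hf.comp (contDiff_id.prodMk contDiff_const)
  rw [contDiff_iff_contDiffAt]
  rintro ⟨a, u⟩
  have h := (Per_eventually h0 h1 u)
  have h2 : ∀ᶠ q : A × ℝ in 𝓝 (a, u), Per f c q.1 q.2 = f q.1 (q.2 - ⌊u⌋) + c q.1 * ⌊u⌋ := by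
    have : Tendsto (fun q : A × ℝ => q.2) (𝓝 (a,u)) (𝓝 u) := continuous_snd.tendsto _
    exact (this.eventually h).mono (fun q hq => hq q.1)
  refine ContDiffAt.congr_of_eventuallyEq ?_ h2
  apply ContDiff.contDiffAt
  have : ContDiff ℝ ∞ (fun q : A × ℝ => f q.1 (q.2 - ⌊u⌋)) :=
    hf.comp (contDiff_fst.prodMk (contDiff_snd.sub contDiff_const))
  fun_prop
end

/-- staircase -/
def stair (u : ℝ) : ℝ :=
  Per (fun (_ : ℝ) (v : ℝ) => Real.smoothTransition (4 * (v - 3/8))) (fun _ => 1) 0 u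

theorem stair_h0 (u : ℝ) (hu : u ≤ 3/8) : Real.smoothTransition (4 * (u - 3/8)) = 0 :=
  Real.smoothTransition.zero_of_nonpos (by linarith)
theorem stair_h1 (u : ℝ) (hu : 5/8 ≤ u) : Real.smoothTransition (4 * (u - 3/8)) = 1 :=
  Real.smoothTransition.one_of_one_le (by linarith)

theorem stair_smooth : ContDiff ℝ ∞ stair := by
  have := Per_smooth (A := ℝ) (f := fun (_ : ℝ) (v : ℝ) => Real.smoothTransition (4 * (v - 3/8)))
    (c := fun _ => 1) (fun _ => stair_h0) (fun _ => stair_h1) (by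
      have : ContDiff ℝ ∞ Real.smoothTransition := Real.smoothTransition.contDiff
      exact this.comp (by fun_prop))
  exact this.comp (contDiff_const.prodMk contDiff_id)

theorem stair_add_one (u : ℝ) : stair (u + 1) = stair u + 1 := Per_add_one _ _

theorem stair_int (m : ℤ) (u : ℝ) (h : |u - m| ≤ 3/8) : stair u = m := by
  rw [abs_le] at h
  unfold stair
  rw [Per_eq (fun _ => stair_h0) (fun _ => stair_h1) _ m u (by linarith) (by linarith)]
  rw [stair_h0 _ (by linarith)]; simp

theorem stair_sub_le (u : ℝ) : |stair u - u| ≤ 1 := by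
  unfold stair Per
  have h1 := Real.smoothTransition.nonneg (4 * (Int.fract u - 3/8))
  have h2 := Real.smoothTransition.le_one (4 * (Int.fract u - 3/8))
  have h3 := Int.fract_add_floor u
  have h4 := Int.fract_nonneg u
  have h5 := (Int.fract_lt_one u).le
  rw [abs_le]; constructor <;> linarith

end

noncomputable section
open Set Filter Topology
open scoped ContDiff

/-- the class of functions `q N θ u` growing like `N^d` with derivatives growing like `N^(d+i)` -/
def Bd : ℕ → ℕ → (ℕ → ℝ → ℝ → ℝ) → Prop
  | 0, d, q => ∃ C, 0 ≤ C ∧ ∀ N : ℕ, 1 ≤ N → ∀ θ ∈ Icc (0:ℝ) 1, ∀ u, |q N θ u| ≤ C * (N:ℝ) ^ d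
  | k + 1, d, q =>
    (∃ C, 0 ≤ C ∧ ∀ N : ℕ, 1 ≤ N → ∀ θ ∈ Icc (0:ℝ) 1, ∀ u, |q N θ u| ≤ C * (N:ℝ) ^ d) ∧
    ∃ q' : ℕ → ℝ → ℝ → ℝ, (∀ N θ u, HasDerivAt (q N θ) (q' N θ u) u) ∧ Bd k (d + 1) q'

theorem Bd.bound {k d : ℕ} {q} (h : Bd k d q) :
    ∃ C, 0 ≤ C ∧ ∀ N : ℕ, 1 ≤ N → ∀ θ ∈ Icc (0:ℝ) 1, ∀ u, |q N θ u| ≤ C * (N:ℝ) ^ d := by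
  cases k with
  | zero => exact h
  | succ k => exact h.1

theorem Bd.pred {k : ℕ} : ∀ {d : ℕ} {q}, Bd (k + 1) d q → Bd k d q := by
  induction k with
  | zero => intro d q h; exact h.1
  | succ k ih =>
    rintro d q ⟨h1, q', h2, h3⟩
    exact ⟨h1, q', h2, ih h3⟩

theorem Bd.mono {k : ℕ} : ∀ {d e : ℕ} {q}, d ≤ e → Bd k d q → Bd k e q := by
  have aux : ∀ {d e : ℕ} {q : ℕ → ℝ → ℝ → ℝ}, d ≤ e →
    (∃ C, 0 ≤ C ∧ ∀ N : ℕ, 1 ≤ N → ∀ θ ∈ Icc (0:ℝ) 1, ∀ u, |q N θ u| ≤ C * (N:ℝ) ^ d) →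
    (∃ C, 0 ≤ C ∧ ∀ N : ℕ, 1 ≤ N → ∀ θ ∈ Icc (0:ℝ) 1, ∀ u, |q N θ u| ≤ C * (N:ℝ) ^ e) := by
    rintro d e q hde ⟨C, hC, h⟩
    refine ⟨C, hC, fun N hN θ hθ u => (h N hN θ hθ u).trans ?_⟩
    have : (1:ℝ) ≤ N := by exact_mod_cast hN
    gcongr
  induction k with
  | zero => intro d e q hde h; exact aux hde h
  | succ k ih =>
    rintro d e q hde ⟨h1, q', h2, h3⟩
    exact ⟨aux hde h1, q', h2, ih (by omega) h3⟩

theorem Bd.add {k : ℕ} : ∀ {d : ℕ} {f g}, Bd k d f → Bd k d g →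
    Bd k d (fun N θ u => f N θ u + g N θ u) := by
  have aux : ∀ {d : ℕ} {f g : ℕ → ℝ → ℝ → ℝ},
    (∃ C, 0 ≤ C ∧ ∀ N : ℕ, 1 ≤ N → ∀ θ ∈ Icc (0:ℝ) 1, ∀ u, |f N θ u| ≤ C * (N:ℝ) ^ d) →
    (∃ C, 0 ≤ C ∧ ∀ N : ℕ, 1 ≤ N → ∀ θ ∈ Icc (0:ℝ) 1, ∀ u, |g N θ u| ≤ C * (N:ℝ) ^ d) →
    (∃ C, 0 ≤ C ∧ ∀ N : ℕ, 1 ≤ N → ∀ θ ∈ Icc (0:ℝ) 1, ∀ u,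
      |f N θ u + g N θ u| ≤ C * (N:ℝ) ^ d) := by
    rintro d f g ⟨C, hC, h⟩ ⟨C', hC', h'⟩
    refine ⟨C + C', by positivity, fun N hN θ hθ u => (abs_add_le _ _).trans ?_⟩
    rw [add_mul]
    exact add_le_add (h N hN θ hθ u) (h' N hN θ hθ u)
  induction k with
  | zero => intro d f g h h'; exact aux h h'
  | succ k ih =>
    rintro d f g ⟨h1, q', h2, h3⟩ ⟨h1', q'', h2', h3'⟩
    exact ⟨aux h1 h1', fun N θ u => q' N θ u + q'' N θ u,
      fun N θ u => (h2 N θ u).add (h2' N θ u), ih h3 h3'⟩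

theorem Bd.mul {k : ℕ} : ∀ {d e : ℕ} {f g}, Bd k d f → Bd k e g →
    Bd k (d + e) (fun N θ u => f N θ u * g N θ u) := by
  have aux : ∀ {d e : ℕ} {f g : ℕ → ℝ → ℝ → ℝ},
    (∃ C, 0 ≤ C ∧ ∀ N : ℕ, 1 ≤ N → ∀ θ ∈ Icc (0:ℝ) 1, ∀ u, |f N θ u| ≤ C * (N:ℝ) ^ d) →
    (∃ C, 0 ≤ C ∧ ∀ N : ℕ, 1 ≤ N → ∀ θ ∈ Icc (0:ℝ) 1, ∀ u, |g N θ u| ≤ C * (N:ℝ) ^ e) →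
    (∃ C, 0 ≤ C ∧ ∀ N : ℕ, 1 ≤ N → ∀ θ ∈ Icc (0:ℝ) 1, ∀ u,
      |f N θ u * g N θ u| ≤ C * (N:ℝ) ^ (d + e)) := by
    rintro d e f g ⟨C, hC, h⟩ ⟨C', hC', h'⟩
    refine ⟨C * C', by positivity, fun N hN θ hθ u => ?_⟩
    rw [abs_mul, pow_add]
    calc _ ≤ (C * (N:ℝ) ^ d) * (C' * (N:ℝ) ^ e) :=
          mul_le_mul (h N hN θ hθ u) (h' N hN θ hθ u) (abs_nonneg _) (by positivity)
      _ = _ := by ring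
  induction k with
  | zero => intro d e f g h h'; exact aux h h'
  | succ k ih =>
    intro d e f g hf hg
    have hf' := hf.pred
    have hg' := hg.pred
    obtain ⟨h1, q', h2, h3⟩ := hf
    obtain ⟨h1', q'', h2', h3'⟩ := hg
    refine ⟨aux h1 h1', fun N θ u => q' N θ u * g N θ u + f N θ u * q'' N θ u,
      fun N θ u => (h2 N θ u).mul (h2' N θ u), ?_⟩
    refine Bd.add ?_ ?_
    · exact (ih h3 hg').mono (by omega)
    · exact (ih hf' h3').mono (by omega)

theorem Bd.const (k : ℕ) (d : ℕ) (c : ℕ → ℝ → ℝ)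
    (hc : ∃ C, 0 ≤ C ∧ ∀ N : ℕ, 1 ≤ N → ∀ θ ∈ Icc (0:ℝ) 1, |c N θ| ≤ C * (N:ℝ) ^ d) :
    Bd k d (fun N θ _ => c N θ) := by
  have z : ∀ k d, Bd k d (fun _ _ _ => 0) := by
    intro k
    induction k with
    | zero => intro d; exact ⟨0, le_rfl, by simp⟩
    | succ k ih =>
      intro d
      exact ⟨⟨0, le_rfl, by simp⟩, fun _ _ _ => 0, fun _ _ u => hasDerivAt_const u 0, ih _⟩
  obtain ⟨C, hC, h⟩ := hc
  cases k with
  | zero => exact ⟨C, hC, fun N hN θ hθ u => h N hN θ hθ⟩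
  | succ k => exact ⟨⟨C, hC, fun N hN θ hθ u => h N hN θ hθ⟩, fun _ _ _ => 0,
      fun N θ u => hasDerivAt_const u _, z _ _⟩

theorem Bd.pow {k d : ℕ} {f} (hf : Bd k d f) (a : ℕ) :
    Bd k (a * d) (fun N θ u => f N θ u ^ a) := by
  induction a with
  | zero => simpa using Bd.const k 0 (fun _ _ => 1) ⟨1, by simp, by simp⟩
  | succ a ih =>
    have := ih.mul hf
    simp only [pow_succ]
    exact this.mono (by rw [add_mul, one_mul])

theorem Bd.deriv {k d : ℕ} {f} (hf : Bd (k + 1) d f) :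
    Bd k (d + 1) (fun N θ u => deriv (f N θ) u) := by
  obtain ⟨_, q', h2, h3⟩ := hf
  have : (fun N θ u => _root_.deriv (f N θ) u) = q' := by
    funext N θ u; exact (h2 N θ u).deriv
  rw [this]; exact h3

theorem Bd.trig (k : ℕ) : Bd k 0 (fun N _ u => Real.sin (2 * Real.pi * N * u)) ∧
    Bd k 0 (fun N _ u => Real.cos (2 * Real.pi * N * u)) := by
  induction k with
  | zero =>
    exact ⟨⟨1, by simp, fun N _ θ _ u => by simpa using Real.abs_sin_le_one _⟩,
      ⟨1, by simp, fun N _ θ _ u => by simpa using Real.abs_cos_le_one _⟩⟩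
  | succ k ih =>
    have hl : ∀ (N : ℕ) (u : ℝ), HasDerivAt (fun u => 2 * Real.pi * N * u) (2 * Real.pi * N) u := by
      intro N u; simpa using (hasDerivAt_id u).const_mul (2 * Real.pi * N)
    refine ⟨⟨⟨1, by simp, fun N _ θ _ u => by simpa using Real.abs_sin_le_one _⟩,
      _, fun N θ u => (hl N u).sin, ?_⟩,
      ⟨⟨1, by simp, fun N _ θ _ u => by simpa using Real.abs_cos_le_one _⟩,
      _, fun N θ u => (hl N u).cos, ?_⟩⟩
    · refine Bd.mul ih.2 (Bd.const k 1 (fun N _ => 2 * Real.pi * N)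
        ⟨2 * Real.pi, by positivity, fun N _ θ _ => ?_⟩)
      rw [abs_of_nonneg (by positivity)]; simp
    · have h1 : Bd k 0 (fun N _ u => - Real.sin (2 * Real.pi * N * u)) := by
        have := (Bd.const k 0 (fun _ _ => -1) ⟨1, by simp, by simp⟩).mul ih.1
        simpa using this
      refine Bd.mul h1 (Bd.const k 1 (fun N _ => 2 * Real.pi * N)
        ⟨2 * Real.pi, by positivity, fun N _ θ _ => ?_⟩)
      rw [abs_of_nonneg (by positivity)]; simp

theorem Bd.cpt (k : ℕ) : ∀ (f : ℝ → ℝ), ContDiff ℝ ∞ f → HasCompactSupport f →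
    Bd k 0 (fun _ _ u => f u) := by
  induction k with
  | zero =>
    intro f hf hc
    obtain ⟨C, hC⟩ := hc.exists_bound_of_continuous hf.continuous
    exact ⟨C, (norm_nonneg _).trans (hC 0), fun N _ θ _ u => by simpa using hC u⟩
  | succ k ih =>
    intro f hf hc
    obtain ⟨C, hC⟩ := hc.exists_bound_of_continuous hf.continuous
    refine ⟨⟨C, (norm_nonneg _).trans (hC 0), fun N _ θ _ u => by simpa using hC u⟩,
      fun _ _ u => _root_.deriv f u,
      fun N θ u => (hf.differentiable (by simp) u).hasDerivAt,
      (ih _ ?_ hc.deriv).mono (by omega)⟩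
    exact (contDiff_infty_iff_deriv.1 hf).2

/-! the bump -/
def eta (u : ℝ) : ℝ := expNegInvGlue (1 - u ^ 2)

theorem eta_smooth : ContDiff ℝ ∞ eta := by
  have : ContDiff ℝ ∞ expNegInvGlue := expNegInvGlue.contDiff
  exact this.comp (by fun_prop)

theorem eta_nonneg (u : ℝ) : 0 ≤ eta u := expNegInvGlue.nonneg _

theorem eta_pos {u : ℝ} (hu : |u| < 1) : 0 < eta u :=
  expNegInvGlue.pos_of_pos (by have := (sq_lt_one_iff_abs_lt_one u).2 hu; linarith)

theorem eta_zero {u : ℝ} (hu : 1 ≤ |u|) : eta u = 0 :=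
  expNegInvGlue.zero_of_nonpos (by have := (one_le_sq_iff_one_le_abs u).2 hu; linarith)

theorem eta_lt {u : ℝ} (hu : |u| < 1) : eta u < 1 - |u| := by
  have h := (sq_lt_one_iff_abs_lt_one u).2 hu
  have hx : 0 < 1 - u ^ 2 := by linarith
  unfold eta expNegInvGlue
  rw [if_neg (by linarith)]
  set y := (1 - u ^ 2)⁻¹ with hy
  have hy0 : 0 < y := by positivity
  have h1 : 1 + y + y ^ 2 / 2 ≤ Real.exp y := Real.quadratic_le_exp_of_nonneg hy0.le
  have h2 : 2 * y < Real.exp y := by nlinarith [sq_nonneg (y - 1)]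
  have h3 : Real.exp (-y) < (1 - u ^ 2) / 2 := by
    rw [Real.exp_neg, inv_lt_comm₀ (Real.exp_pos _) (by positivity), inv_div]
    rw [div_eq_mul_inv, ← hy]; exact h2
  have h4 : u ^ 2 = |u| ^ 2 := (sq_abs u).symm
  nlinarith [abs_nonneg u]

theorem eta_le_one (u : ℝ) : eta u ≤ 1 := by
  rcases lt_or_ge |u| 1 with h | h
  · have := eta_lt h; linarith [abs_nonneg u]
  · rw [eta_zero h]; norm_num

theorem eta_cpt : HasCompactSupport eta := by
  refine HasCompactSupport.intro (K := Icc (-1) 1) isCompact_Icc ?_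
  intro x hx
  refine eta_zero ?_
  by_contra hh
  exact hx (abs_le.1 (le_of_not_ge hh))

/-- oscillating bump -/
def osc (N : ℕ) (u : ℝ) : ℝ := eta u * Real.sin (2 * Real.pi * N * u)

theorem osc_smooth (N : ℕ) : ContDiff ℝ ∞ (osc N) := by
  have := eta_smooth
  unfold osc; fun_prop

theorem osc_zero {N : ℕ} {u : ℝ} (hu : 1 ≤ |u|) : osc N u = 0 := by simp [osc, eta_zero hu]

theorem osc_le (N : ℕ) (u : ℝ) : |osc N u| ≤ eta u := by
  unfold osc
  rw [abs_mul, abs_of_nonneg (eta_nonneg u)]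
  exact mul_le_of_le_one_right (eta_nonneg u) (Real.abs_sin_le_one _)

/-- derivative of the zigzag `u + θ * osc N u` -/
def wt (N : ℕ) (θ u : ℝ) : ℝ := 1 + θ * deriv (osc N) u

theorem dosc_smooth (N : ℕ) : ContDiff ℝ ∞ (deriv (osc N)) :=
  (contDiff_infty_iff_deriv.1 (osc_smooth N)).2

theorem wt_smooth (N : ℕ) : ContDiff ℝ ∞ (fun q : ℝ × ℝ => wt N q.1 q.2) := by
  have := dosc_smooth N
  unfold wt
  exact contDiff_const.add (contDiff_fst.mul (this.comp contDiff_snd))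

theorem zig_hasDerivAt (N : ℕ) (θ u : ℝ) : HasDerivAt (fun u => u + θ * osc N u) (wt N θ u) u := by
  have := ((osc_smooth N).differentiable (by simp) u).hasDerivAt
  exact (hasDerivAt_id u).add (this.const_mul θ)

theorem dosc_zero {N : ℕ} {u : ℝ} (hu : 1 < |u|) : deriv (osc N) u = 0 := by
  have : osc N =ᶠ[𝓝 u] fun _ => 0 := by
    have : {v : ℝ | 1 < |v|} ∈ 𝓝 u := (isOpen_lt continuous_const continuous_abs).mem_nhds hu
    filter_upwards [this] with v hv
    exact osc_zero (le_of_lt hv)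
  rw [this.deriv_eq]; simp

theorem wt_one_of_out {N : ℕ} {θ u : ℝ} (hu : 1 < |u|) : wt N θ u = 1 := by
  simp [wt, dosc_zero hu]

theorem wt_continuous (N : ℕ) (θ : ℝ) : Continuous (wt N θ) := by
  have := (dosc_smooth N).continuous
  unfold wt; fun_prop

theorem osc_analytic (N : ℕ) : AnalyticOnNhd ℝ (osc N) (Ioo (-1) 1) := by
  intro u hu
  have hu' : |u| < 1 := abs_lt.2 hu
  have h := (sq_lt_one_iff_abs_lt_one u).2 hu'
  have h1 : AnalyticAt ℝ (fun u => Real.exp (-(1 - u ^ 2)⁻¹) *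
      Real.sin (2 * Real.pi * N * u)) u := by
    have h2 : AnalyticAt ℝ (fun u : ℝ => 1 - u ^ 2) u := by fun_prop
    have h3 : AnalyticAt ℝ (fun u : ℝ => (1 - u ^ 2)⁻¹) u := h2.inv (by linarith)
    have h4 : AnalyticAt ℝ (fun u : ℝ => Real.exp (-(1 - u ^ 2)⁻¹)) u := h3.neg.rexp
    have h5 : AnalyticAt ℝ (fun u : ℝ => 2 * Real.pi * N * u) u := by fun_prop
    exact h4.mul (AnalyticAt.fun_comp (Real.analyticAt_sin) h5)
  refine h1.congr ?_
  filter_upwards [Ioo_mem_nhds hu.1 hu.2] with v hv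
  have h := (sq_lt_one_iff_abs_lt_one v).2 (abs_lt.2 hv)
  unfold osc eta expNegInvGlue
  rw [if_neg (by linarith)]

theorem wt_exists_ne (N : ℕ) (θ : ℝ) {a b : ℝ} (hab : a < b) :
    ∃ u ∈ Ioo a b, wt N θ u ≠ 0 := by
  by_contra! hz
  have hin : ∀ u ∈ Ioo a b, |u| ≤ 1 := by
    intro u hu
    by_contra! h
    have h1 := wt_one_of_out (N := N) (θ := θ) h
    rw [hz u hu] at h1; norm_num at h1
  obtain ⟨c, hac, hcb⟩ := exists_between hab
  obtain ⟨c1, hac1, hc1⟩ := exists_between hac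
  obtain ⟨c2, hc2, hcb2⟩ := exists_between hcb
  have hc : c ∈ Ioo (-1:ℝ) 1 := by
    have h1 := abs_le.1 (hin c1 ⟨hac1, hc1.trans hcb⟩)
    have h2 := abs_le.1 (hin c2 ⟨hac.trans hc2, hcb2⟩)
    exact ⟨by linarith, by linarith⟩
  have han : AnalyticOnNhd ℝ (wt N θ) (Ioo (-1) 1) := by
    have := (osc_analytic N).deriv
    exact analyticOnNhd_const.add (analyticOnNhd_const.mul this)
  have h0 := han.eqOn_zero_of_preconnected_of_eventuallyEq_zero isPreconnected_Ioo hc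
    (by filter_upwards [Ioo_mem_nhds hac hcb] with v hv using hz v hv)
  have hcl : EqOn (wt N θ) 0 (Icc (-1) 1) := by
    have := h0.closure (wt_continuous N θ) continuous_const
    rwa [closure_Ioo (by norm_num)] at this
  have h1 : wt N θ 1 = 0 := hcl (by norm_num)
  have h2 : EqOn (wt N θ) 1 (closure (Ioi 1)) := by
    apply EqOn.closure _ (wt_continuous N θ) continuous_const
    intro u hu
    exact wt_one_of_out (lt_of_lt_of_le hu (le_abs_self u))
  rw [closure_Ioi] at h2
  have h3 : wt N θ 1 = 1 := h2 (by simp)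
  rw [h1] at h3; norm_num at h3

/-! primitives -/
def primI (N k : ℕ) (u : ℝ) : ℝ := ∫ x in (-1)..u, eta x * deriv (osc N) x ^ k

theorem primI_hasDerivAt (N k : ℕ) (u : ℝ) :
    HasDerivAt (primI N k) (eta u * deriv (osc N) u ^ k) u := by
  have hc : Continuous (fun x => eta x * deriv (osc N) x ^ k) := by
    have := (dosc_smooth N).continuous
    have := eta_smooth.continuous
    fun_prop
  exact intervalIntegral.integral_hasDerivAt_right (hc.intervalIntegrable _ _)
    (hc.stronglyMeasurableAtFilter _ _) hc.continuousAt

theorem primI_smooth (N k : ℕ) : ContDiff ℝ ∞ (primI N k) := by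
  rw [contDiff_infty_iff_deriv]
  refine ⟨fun u => (primI_hasDerivAt N k u).differentiableAt, ?_⟩
  have : deriv (primI N k) = fun u => eta u * deriv (osc N) u ^ k :=
    funext fun u => (primI_hasDerivAt N k u).deriv
  rw [this]
  exact eta_smooth.mul ((dosc_smooth N).pow k)

/-- `∫ eta * w^M` -/
def GG (M N : ℕ) (θ u : ℝ) : ℝ :=
  ∑ k ∈ Finset.range (M + 1), (M.choose k : ℝ) * θ ^ k * primI N k u

theorem GG_smooth (M N : ℕ) : ContDiff ℝ ∞ (fun q : ℝ × ℝ => GG M N q.1 q.2) := by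
  unfold GG
  refine ContDiff.sum fun k _ => ?_
  have := (primI_smooth N k).comp (contDiff_snd (E := ℝ) (F := ℝ))
  exact (contDiff_const.mul (contDiff_fst.pow k)).mul this

theorem GG_hasDerivAt (M N : ℕ) (θ u : ℝ) :
    HasDerivAt (GG M N θ) (eta u * wt N θ u ^ M) u := by
  have h : HasDerivAt (GG M N θ) (∑ k ∈ Finset.range (M + 1),
      (M.choose k : ℝ) * θ ^ k * (eta u * deriv (osc N) u ^ k)) u := by
    unfold GG
    exact HasDerivAt.fun_sum fun k _ => (primI_hasDerivAt N k u).const_mul _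
  convert h using 1
  rw [wt, add_comm, add_pow, Finset.mul_sum]
  refine Finset.sum_congr rfl fun k _ => ?_
  rw [mul_pow, one_pow]; ring

theorem GG_neg_one (M N : ℕ) (θ : ℝ) : GG M N θ (-1) = 0 := by
  simp [GG, primI]

theorem GG_eq_integral (M N : ℕ) (θ a b : ℝ) :
    GG M N θ b - GG M N θ a = ∫ x in a..b, eta x * wt N θ x ^ M := by
  rw [intervalIntegral.integral_eq_sub_of_hasDerivAt (fun x _ => GG_hasDerivAt M N θ x)]
  have := wt_continuous N θ
  have := eta_smooth.continuous
  exact Continuous.intervalIntegrable (by fun_prop) _ _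

theorem GG_const_of {M N : ℕ} {θ a b : ℝ} (h : ∀ x ∈ uIcc a b, 1 ≤ |x|) :
    GG M N θ b = GG M N θ a := by
  rw [← sub_eq_zero, GG_eq_integral]
  rw [intervalIntegral.integral_congr (g := fun _ => 0)]
  · simp
  · intro x hx
    simp [eta_zero (h x hx)]

theorem GG_left {M N : ℕ} {θ u : ℝ} (h : u ≤ -1) : GG M N θ u = 0 := by
  rw [← GG_neg_one M N θ]
  apply GG_const_of
  intro x hx
  rw [uIcc_of_ge h] at hx
  rw [le_abs]; right; linarith [hx.2]

theorem GG_right {M N : ℕ} {θ u : ℝ} (h : 1 ≤ u) : GG M N θ u = GG M N θ 1 := by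
  apply GG_const_of
  intro x hx
  rw [uIcc_of_le h] at hx
  rw [le_abs]; left; linarith [hx.1]

theorem GG_mono {M N : ℕ} (hM : Even M) (θ : ℝ) : Monotone (GG M N θ) := by
  apply monotone_of_deriv_nonneg (fun u => (GG_hasDerivAt M N θ u).differentiableAt)
  intro u
  rw [(GG_hasDerivAt M N θ u).deriv]
  exact mul_nonneg (eta_nonneg u) (hM.pow_nonneg _)

theorem GG_strict {M N : ℕ} (hM : Even M) (θ : ℝ) : StrictMonoOn (GG M N θ) (Icc (-1) 1) := by
  intro a ha b hb hab
  refine lt_of_le_of_ne (GG_mono hM θ hab.le) fun heq => ?_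
  obtain ⟨u, hu, hne⟩ := wt_exists_ne N θ hab
  have hc : GG M N θ =ᶠ[𝓝 u] fun _ => GG M N θ a := by
    filter_upwards [Ioo_mem_nhds hu.1 hu.2] with v hv
    apply le_antisymm
    · rw [heq]; exact GG_mono hM θ hv.2.le
    · exact GG_mono hM θ hv.1.le
  have h1 := hc.deriv_eq
  rw [(GG_hasDerivAt M N θ u).deriv, deriv_const] at h1
  have hp : 0 < eta u := eta_pos (abs_lt.2 ⟨by linarith [ha.1, hu.1], by linarith [hb.2, hu.2]⟩)
  rcases mul_eq_zero.1 h1 with h2 | h2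
  · exact hp.ne' h2
  · exact pow_ne_zero M hne h2

theorem osc_Bd (k : ℕ) : Bd k 0 (fun N _ u => osc N u) :=
  ((Bd.cpt k eta eta_smooth eta_cpt).mul (Bd.trig k).1)

theorem wt_Bd (k : ℕ) : Bd k 1 (fun N θ u => wt N θ u) := by
  unfold wt
  refine Bd.add ((Bd.const k 0 (fun _ _ => 1) ⟨1, by simp, by simp⟩).mono (by omega)) ?_
  have h1 : Bd k 0 (fun _ θ _ => θ) := Bd.const k 0 (fun _ θ => θ) ⟨1, by simp, by
    intro N _ θ hθ; rw [abs_of_nonneg hθ.1]; simpa using hθ.2⟩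
  exact (h1.mul (osc_Bd (k+1)).deriv).mono (by omega)

end

noncomputable section
open Set Filter Topology
open scoped ContDiff

theorem int_cos_sq (N : ℕ) (hN : 1 ≤ N) :
    ∫ x in (-(1/2):ℝ)..(1/2), Real.cos (2 * Real.pi * N * x) ^ 2 = 1 / 2 := by
  have hN' : (N:ℝ) ≠ 0 := by positivity
  have h := intervalIntegral.integral_comp_mul_left (a := -(1/2)) (b := 1/2)
    (fun x => Real.cos x ^ 2) (c := 2 * Real.pi * N) (by positivity)
  rw [h, integral_cos_sq]
  have e1 : 2 * Real.pi * N * (1/2) = N * Real.pi := by ring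
  have e2 : 2 * Real.pi * N * (-(1/2)) = -(N * Real.pi) := by ring
  rw [e1, e2, Real.sin_neg, Real.sin_nat_mul_pi, smul_eq_mul]
  field_simp
  ring

theorem dosc_eq (N : ℕ) (u : ℝ) : deriv (osc N) u =
    deriv eta u * Real.sin (2 * Real.pi * N * u) +
      eta u * (Real.cos (2 * Real.pi * N * u) * (2 * Real.pi * N)) := by
  have hl : HasDerivAt (fun u => 2 * Real.pi * N * u) (2 * Real.pi * N) u := by
    simpa using (hasDerivAt_id u).const_mul (2 * Real.pi * N)
  exact (((eta_smooth.differentiable (by simp) u).hasDerivAt).mul hl.sin).deriv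

theorem eta_lower {u : ℝ} (hu : |u| ≤ 1/2) : eta (1/2) ≤ eta u := by
  unfold eta
  apply expNegInvGlue.monotone
  have : u ^ 2 ≤ (1/2) ^ 2 := by
    rw [← sq_abs u]; gcongr
  linarith

theorem int_wt_sq : ∃ c : ℝ, 0 < c ∧ ∃ N₀ : ℕ, 1 ≤ N₀ ∧ ∀ N : ℕ, N₀ ≤ N →
    c * (N:ℝ) ^ 2 ≤ ∫ x in (-(1/2):ℝ)..(1/2), wt N 1 x ^ 2 := by
  set c0 := eta (1/2) with hc0
  have hc0p : 0 < c0 := eta_pos (by rw [abs_of_pos] <;> norm_num)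
  obtain ⟨D, hD0, hD⟩ := (Bd.cpt 1 eta eta_smooth eta_cpt).deriv.bound
  obtain ⟨D, hD⟩ : ∃ D : ℝ, ∀ u, |deriv eta u| ≤ D := by
    refine ⟨D, fun u => by simpa using hD 1 le_rfl 0 (by simp) u⟩
  have hD0 : 0 ≤ D := (abs_nonneg _).trans (hD 0)
  have hpi : 3 < Real.pi := Real.pi_gt_three
  refine ⟨c0 ^ 2 / 2, by positivity, ⌈(1 + D) / c0⌉₊ + 1, by omega, fun N hN => ?_⟩
  have hNr : (1 + D) / c0 ≤ N := by
    have h1 : (1 + D) / c0 ≤ ⌈(1 + D) / c0⌉₊ := Nat.le_ceil _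
    have h2 : ((⌈(1 + D) / c0⌉₊ + 1 : ℕ) : ℝ) ≤ N := by exact_mod_cast hN
    push_cast at h2; linarith
  have hN1 : 1 ≤ N := by omega
  have hN1' : (1:ℝ) ≤ N := by exact_mod_cast hN1
  rw [div_le_iff₀ hc0p] at hNr
  have hwc := wt_continuous N 1
  have hle : ∀ x ∈ Icc (-(1/2):ℝ) (1/2),
      (c0 * (2 * Real.pi * N)) ^ 2 / 2 * Real.cos (2 * Real.pi * N * x) ^ 2 - (1 + D) ^ 2
        ≤ wt N 1 x ^ 2 := by
    intro x hx
    rw [wt, one_mul, dosc_eq]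
    set S := Real.sin (2 * Real.pi * N * x)
    set K := Real.cos (2 * Real.pi * N * x)
    have hS : |deriv eta x * S| ≤ D := by
      rw [abs_mul]
      calc _ ≤ D * 1 := mul_le_mul (hD x) (Real.abs_sin_le_one _) (abs_nonneg _) hD0
        _ = D := mul_one D
    have he : c0 ≤ eta x := eta_lower (abs_le.2 hx)
    have ha : (1 + deriv eta x * S) ^ 2 ≤ (1 + D) ^ 2 := by
      apply sq_le_sq'
      · linarith [(abs_le.1 hS).1]
      · linarith [(abs_le.1 hS).2]
    have hb : (c0 * (2 * Real.pi * N)) ^ 2 * K ^ 2 ≤ (eta x * (K * (2 * Real.pi * N))) ^ 2 := by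
      have : c0 ^ 2 ≤ eta x ^ 2 := by gcongr
      calc _ = c0 ^ 2 * (K * (2 * Real.pi * N)) ^ 2 := by ring
        _ ≤ eta x ^ 2 * (K * (2 * Real.pi * N)) ^ 2 := by gcongr
        _ = _ := by ring
    set p := 1 + deriv eta x * S
    set q := eta x * (K * (2 * Real.pi * N))
    have : 1 + (deriv eta x * S + q) = p + q := by ring
    rw [this]
    nlinarith [sq_nonneg (2 * p + q)]
  have hi := intervalIntegral.integral_mono_on (a := (-(1/2):ℝ)) (b := 1/2) (by norm_num)
    (Continuous.intervalIntegrable (by fun_prop) _ _)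
    (Continuous.intervalIntegrable (by fun_prop) _ _) hle (μ := MeasureTheory.volume)
  refine le_trans ?_ hi
  rw [intervalIntegral.integral_sub
    (Continuous.intervalIntegrable (by fun_prop) _ _)
    (Continuous.intervalIntegrable (by fun_prop) _ _), intervalIntegral.integral_const_mul,
    int_cos_sq N hN1, intervalIntegral.integral_const]
  have h5 : (1 + D) ^ 2 ≤ (N * c0) ^ 2 := by gcongr
  have h6 : (3:ℝ) ^ 2 ≤ Real.pi ^ 2 := by gcongr
  have h7 : 0 ≤ (c0 * N) ^ 2 := by positivity
  simp only [smul_eq_mul]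
  nlinarith [mul_le_mul_of_nonneg_left h6 h7]

theorem GG_lower (k : ℕ) : ∃ c : ℝ, 0 < c ∧ ∃ N₀ : ℕ, 1 ≤ N₀ ∧ ∀ N : ℕ, N₀ ≤ N →
    c * (N:ℝ) ^ (2 * k) ≤ GG (2 * k) N 1 1 := by
  obtain ⟨c, hc, N₀, hN₀, h⟩ := int_wt_sq
  have hc0p : 0 < eta (1/2) := eta_pos (by rw [abs_of_pos] <;> norm_num)
  refine ⟨eta (1/2) * c ^ k, by positivity, N₀, hN₀, fun N hN => ?_⟩
  have hN1 : (1:ℝ) ≤ N := by exact_mod_cast hN₀.trans hN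
  have hwc := wt_continuous N 1
  have hec := eta_smooth.continuous
  set a := c * (N:ℝ) ^ 2 with ha
  have hap : 0 < a := by positivity
  have h1 : GG (2 * k) N 1 (1/2) - GG (2 * k) N 1 (-(1/2)) ≤ GG (2 * k) N 1 1 := by
    have e1 := GG_mono (N := N) (even_two_mul k) 1 (show (1/2:ℝ) ≤ 1 by norm_num)
    have e2 := GG_mono (N := N) (even_two_mul k) 1 (show (-1:ℝ) ≤ -(1/2) by norm_num)
    rw [GG_neg_one] at e2
    linarith
  refine le_trans ?_ h1
  rw [GG_eq_integral]
  have hle : ∀ x ∈ Icc (-(1/2):ℝ) (1/2),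
      eta (1/2) * (a ^ k * (1 + k * (wt N 1 x ^ 2 / a - 1))) ≤ eta x * wt N 1 x ^ (2 * k) := by
    intro x hx
    have he : eta (1/2) ≤ eta x := eta_lower (abs_le.2 hx)
    have hb : 1 + (k:ℝ) * (wt N 1 x ^ 2 / a - 1) ≤ (1 + (wt N 1 x ^ 2 / a - 1)) ^ k := by
      apply one_add_mul_le_pow
      have : 0 ≤ wt N 1 x ^ 2 / a := by positivity
      linarith
    have hb2 : a ^ k * (1 + k * (wt N 1 x ^ 2 / a - 1)) ≤ wt N 1 x ^ (2 * k) := by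
      calc _ ≤ a ^ k * (1 + (wt N 1 x ^ 2 / a - 1)) ^ k := by gcongr
        _ = wt N 1 x ^ (2 * k) := by
          rw [← mul_pow, pow_mul]
          congr 1
          field_simp; ring
    have hp : 0 ≤ wt N 1 x ^ (2 * k) := (even_two_mul k).pow_nonneg _
    calc _ ≤ eta (1/2) * wt N 1 x ^ (2 * k) := by gcongr
      _ ≤ _ := by gcongr
  have hi := intervalIntegral.integral_mono_on (a := (-(1/2):ℝ)) (b := 1/2) (by norm_num)
    (Continuous.intervalIntegrable (by fun_prop) _ _)
    (Continuous.intervalIntegrable (by fun_prop) _ _) hle (μ := MeasureTheory.volume)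
  refine le_trans ?_ hi
  have hh := h N hN
  have e3 : (∫ x in (-(1/2):ℝ)..(1/2), (eta (1/2) * (a ^ k * (1 + k * (wt N 1 x ^ 2 / a - 1))))) =
      eta (1/2) * (a ^ k * (1 + k * ((∫ x in (-(1/2):ℝ)..(1/2), wt N 1 x ^ 2) / a - 1))) := by
    rw [intervalIntegral.integral_const_mul, intervalIntegral.integral_const_mul,
      intervalIntegral.integral_add (Continuous.intervalIntegrable (by fun_prop) _ _)
      (Continuous.intervalIntegrable (by fun_prop) _ _), intervalIntegral.integral_const_mul,
      intervalIntegral.integral_sub (Continuous.intervalIntegrable (by fun_prop) _ _)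
      (Continuous.intervalIntegrable (by fun_prop) _ _), intervalIntegral.integral_div]
    norm_num
  rw [e3]
  have h8 : 1 ≤ (∫ x in (-(1/2):ℝ)..(1/2), wt N 1 x ^ 2) / a := by
    rw [le_div_iff₀ hap, one_mul]; exact hh
  have h9 : c ^ k * (N:ℝ) ^ (2 * k) = a ^ k := by rw [ha, mul_pow, ← pow_mul]
  calc eta (1/2) * c ^ k * (N:ℝ) ^ (2 * k) = eta (1/2) * (a ^ k * 1) := by
        rw [mul_assoc, h9, mul_one]
    _ ≤ _ := by
      gcongr
      have : 0 ≤ (k:ℝ) * ((∫ x in (-(1/2):ℝ)..(1/2), wt N 1 x ^ 2) / a - 1) :=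
        mul_nonneg (by positivity) (by linarith)
      linarith

/-- numerators; `qq r 0` is the first one -/
def qq (r : ℕ) : ℕ → ℕ → ℝ → ℝ → ℝ
  | 0 => fun _ _ u => eta u
  | j + 1 => fun N θ u => ((2 * r + 1 - 2 * j : ℕ) : ℝ) * deriv (wt N θ) u * qq r j N θ u
      + wt N θ u * deriv (qq r j N θ) u

theorem deriv_smooth_param {f : ℝ → ℝ → ℝ} (hf : ContDiff ℝ ∞ (fun q : ℝ × ℝ => f q.1 q.2)) :
    ContDiff ℝ ∞ (fun q : ℝ × ℝ => deriv (f q.1) q.2) := by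
  have := ContDiff.fderiv_apply (𝕜 := ℝ) (m := ∞) (n := ∞) (f := fun (y : ℝ × ℝ) (x : ℝ) => f y.1 x)
    (g := fun y : ℝ × ℝ => y.2) (k := fun _ => 1)
    (hf.comp (f := fun q : (ℝ × ℝ) × ℝ => (q.1.1, q.2)) (by fun_prop)) contDiff_snd contDiff_const
    (by simp)
  exact this

theorem section_smooth {f : ℝ → ℝ → ℝ} (hf : ContDiff ℝ ∞ (fun q : ℝ × ℝ => f q.1 q.2)) (θ : ℝ) :
    ContDiff ℝ ∞ (f θ) := hf.comp (contDiff_const.prodMk contDiff_id)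

theorem qq_smooth (r j N : ℕ) : ContDiff ℝ ∞ (fun q : ℝ × ℝ => qq r j N q.1 q.2) := by
  induction j with
  | zero => exact eta_smooth.comp contDiff_snd
  | succ j ih =>
    have h1 := deriv_smooth_param (wt_smooth N)
    have h2 := deriv_smooth_param ih
    have h3 := wt_smooth N
    simp only [qq]
    exact ((contDiff_const.mul h1).mul ih).add (h3.mul h2)

theorem qq_out {r j N : ℕ} {θ : ℝ} : ∀ {u : ℝ}, 1 < |u| → qq r j N θ u = 0 := by
  induction j with
  | zero => intro u hu; exact eta_zero hu.le
  | succ j ih =>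
    intro u hu
    have : qq r j N θ =ᶠ[𝓝 u] fun _ => 0 := by
      have : {v : ℝ | 1 < |v|} ∈ 𝓝 u := (isOpen_lt continuous_const continuous_abs).mem_nhds hu
      filter_upwards [this] with v hv using ih hv
    simp only [qq]
    rw [this.deriv_eq, ih hu]; simp

theorem qq_Bd (r j : ℕ) : ∀ k, Bd k (2 * j) (fun N θ u => qq r j N θ u) := by
  induction j with
  | zero => intro k; exact Bd.cpt k eta eta_smooth eta_cpt
  | succ j ih =>
    intro k
    have h1 : Bd k 0 (fun _ _ _ => ((2 * r + 1 - 2 * j : ℕ) : ℝ)) :=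
      Bd.const k 0 (fun _ _ => _) ⟨((2 * r + 1 - 2 * j : ℕ) : ℝ), by positivity, by simp⟩
    have h2 : Bd k 2 (fun N θ u => deriv (wt N θ) u) := (wt_Bd (k + 1)).deriv
    have h3 := (h1.mul h2).mul (ih k)
    have h4 := (wt_Bd k).mul (ih (k + 1)).deriv
    exact (h3.mono (by omega)).add (h4.mono (by omega))

/-- the model functions -/
def hh (r : ℕ) : ℕ → ℕ → ℝ → ℝ → ℝ
  | 0 => fun N θ u => GG (2 * (r + 1)) N θ u / GG (2 * (r + 1)) N 1 1
  | j + 1 => fun N θ u => wt N θ u ^ (2 * r + 1 - 2 * j) * qq r j N θ u / GG (2 * (r + 1)) N 1 1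

theorem m1_pos (r N : ℕ) : 0 < GG (2 * (r + 1)) N 1 1 := by
  have := GG_strict (N := N) (even_two_mul (r + 1)) 1 (show (-1:ℝ) ∈ Icc (-1:ℝ) 1 by norm_num)
    (show (1:ℝ) ∈ Icc (-1:ℝ) 1 by norm_num) (by norm_num)
  rwa [GG_neg_one] at this

theorem hh_smooth (r j N : ℕ) : ContDiff ℝ ∞ (fun q : ℝ × ℝ => hh r j N q.1 q.2) := by
  cases j with
  | zero => exact (GG_smooth _ N).div_const _
  | succ j => exact (((wt_smooth N).pow _).mul (qq_smooth r j N)).div_const _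

theorem hh_hasDerivAt (r j N : ℕ) (hj : j < r) (θ u : ℝ) :
    HasDerivAt (hh r j N θ) (hh r (j + 1) N θ u * wt N θ u) u := by
  cases j with
  | zero =>
    have := (GG_hasDerivAt (2 * (r + 1)) N θ u).div_const (GG (2 * (r + 1)) N 1 1)
    refine HasDerivAt.congr_deriv this ?_
    simp only [hh, qq]
    have h2 : wt N θ u ^ (2 * (r + 1)) = wt N θ u ^ (2 * r + 1 - 2 * 0) * wt N θ u := by
      rw [← pow_succ]; rfl
    rw [h2]; ring
  | succ j =>
    have h1 : HasDerivAt (wt N θ) (deriv (wt N θ) u) u :=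
      ((section_smooth (wt_smooth N) θ).differentiable (by simp) u).hasDerivAt
    have h2 : HasDerivAt (qq r j N θ) (deriv (qq r j N θ) u) u :=
      ((section_smooth (qq_smooth r j N) θ).differentiable (by simp) u).hasDerivAt
    have := ((h1.pow (2 * r + 1 - 2 * j)).mul h2).div_const (GG (2 * (r + 1)) N 1 1)
    refine HasDerivAt.congr_deriv this ?_
    simp only [hh, qq]
    obtain ⟨a, ha⟩ : ∃ a, 2 * r + 1 - 2 * j = a + 2 := ⟨2 * r - 2 * j - 1, by omega⟩
    have ha' : 2 * r + 1 - 2 * (j + 1) = a := by omega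
    rw [ha, ha']
    simp only [Pi.pow_apply, Nat.add_succ_sub_one]
    ring

theorem hh_out {r j N : ℕ} {θ u : ℝ} (hu : 1 < |u|) : hh r (j + 1) N θ u = 0 := by
  simp [hh, qq_out hu]

theorem hh_zero_left {r N : ℕ} {θ u : ℝ} (hu : u ≤ -1) : hh r 0 N θ u = 0 := by
  simp [hh, GG_left hu]

theorem hh_zero_right {r N : ℕ} {θ u : ℝ} (hu : 1 ≤ u) : hh r 0 N θ u = hh r 0 N θ 1 := by
  simp [hh, GG_right hu]

theorem hh_one (r N : ℕ) : hh r 0 N 1 1 = 1 := by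
  simp only [hh]; exact div_self (m1_pos r N).ne'

theorem hh_strict (r N : ℕ) (θ : ℝ) : StrictMonoOn (hh r 0 N θ) (Icc (-1) 1) := by
  intro a ha b hb hab
  exact div_lt_div_of_pos_right (GG_strict (even_two_mul (r + 1)) θ ha hb hab) (m1_pos r N)

theorem hh_bound (r : ℕ) : ∃ C : ℝ, 0 < C ∧ ∃ N₀ : ℕ, 1 ≤ N₀ ∧ ∀ N : ℕ, N₀ ≤ N →
    ∀ θ ∈ Icc (0:ℝ) 1, ∀ u : ℝ, |hh r 0 N θ u| ≤ C ∧
      ∀ j, 1 ≤ j → j ≤ r → |hh r j N θ u| ≤ C / N := by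
  obtain ⟨c, hc, N₀, hN₀, hlow⟩ := GG_lower (r + 1)
  -- uniform bound of numerators
  have hnum : ∀ j, j + 1 ≤ r → ∃ C, 0 ≤ C ∧ ∀ N : ℕ, 1 ≤ N → ∀ θ ∈ Icc (0:ℝ) 1, ∀ u,
      |wt N θ u ^ (2 * r + 1 - 2 * j) * qq r j N θ u| ≤ C * (N:ℝ) ^ (2 * r + 1) := by
    intro j hj
    have := ((wt_Bd 0).pow (2 * r + 1 - 2 * j)).mul (qq_Bd r j 0)
    exact (this.mono (e := 2 * r + 1) (by omega)).bound
  choose! Cj hCj0 hCj using hnum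
  obtain ⟨CE, hCE0, hCE⟩ := ((Bd.cpt 0 eta eta_smooth eta_cpt).mul
    ((wt_Bd 0).pow (2 * (r + 1)))).bound
  set A := ∑ j ∈ Finset.range r, Cj j with hA
  have hA0 : 0 ≤ A := Finset.sum_nonneg fun j hj => hCj0 j (by simpa using hj)
  refine ⟨(2 * CE + A + 1) / c, by positivity, N₀, hN₀, fun N hN θ hθ u => ?_⟩
  have hN1 : 1 ≤ N := hN₀.trans hN
  have hNp : (0:ℝ) < N := by exact_mod_cast hN1
  have hm := hlow N hN
  have hmp := m1_pos r N
  constructor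
  · -- reduce to u ∈ [-1,1]
    have key : ∀ u, 0 ≤ GG (2 * (r + 1)) N θ u ∧
        GG (2 * (r + 1)) N θ u ≤ 2 * CE * (N:ℝ) ^ (2 * (r + 1)) := by
      intro u
      have hmono := GG_mono (N := N) (even_two_mul (r + 1)) θ
      constructor
      · rcases le_total u (-1) with h | h
        · rw [GG_left h]
        · rw [← GG_neg_one (2 * (r + 1)) N θ]; exact hmono h
      · have h1 : GG (2 * (r + 1)) N θ u ≤ GG (2 * (r + 1)) N θ 1 := by
          rcases le_total u 1 with h | h
          · exact hmono h
          · rw [GG_right h]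
        refine h1.trans ?_
        have h2 := GG_eq_integral (2 * (r + 1)) N θ (-1) 1
        rw [GG_neg_one, sub_zero] at h2
        rw [h2]
        have h3 := intervalIntegral.norm_integral_le_of_norm_le_const (a := (-1:ℝ)) (b := 1)
          (f := fun x => eta x * wt N θ x ^ (2 * (r + 1))) (C := CE * (N:ℝ) ^ (2 * (r + 1)))
          (by
            intro x _
            have := hCE N hN1 θ hθ x
            simpa using this)
        have h4 := (le_abs_self _).trans h3
        have : |(1:ℝ) - -1| = 2 := by norm_num
        rw [this] at h4
        linarith
    simp only [hh]
    rw [abs_div, abs_of_pos hmp, abs_of_nonneg (key u).1, div_le_div_iff₀ hmp hc]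
    calc _ ≤ 2 * CE * (N:ℝ) ^ (2 * (r + 1)) * c := by gcongr; exact (key u).2
      _ = 2 * CE * (c * (N:ℝ) ^ (2 * (r + 1))) := by ring
      _ ≤ (2 * CE + A + 1) * GG (2 * (r + 1)) N 1 1 := by
        apply mul_le_mul _ hm (by positivity) (by positivity)
        linarith
  · intro j hj1 hjr
    obtain ⟨j, rfl⟩ : ∃ i, j = i + 1 := ⟨j - 1, by omega⟩
    have h1 := hCj j hjr N hN1 θ hθ u
    have hle : Cj j ≤ A := Finset.single_le_sum (f := Cj)
      (fun i hi => hCj0 i (by simpa using hi)) (by simpa using hjr)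
    simp only [hh]
    rw [abs_div, abs_of_pos hmp, div_div, div_le_div_iff₀ hmp (by positivity)]
    calc _ ≤ (Cj j * (N:ℝ) ^ (2 * r + 1)) * (c * N) := by gcongr
      _ = Cj j * (c * (N:ℝ) ^ (2 * (r + 1))) := by ring
      _ ≤ (2 * CE + A + 1) * GG (2 * (r + 1)) N 1 1 := by
        apply mul_le_mul _ hm (by positivity) (by positivity)
        linarith

end

noncomputable section
open Set Filter Topology
open scoped ContDiff

def Sst (x : ℝ) : ℝ := Real.smoothTransition (2 * (x - 1/4))
theorem Sst_smooth : ContDiff ℝ ∞ Sst := by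
  have : ContDiff ℝ ∞ Real.smoothTransition := Real.smoothTransition.contDiff
  exact this.comp (by fun_prop)
theorem Sst_zero {x : ℝ} (h : x ≤ 1/4) : Sst x = 0 :=
  Real.smoothTransition.zero_of_nonpos (by linarith)
theorem Sst_one {x : ℝ} (h : 3/4 ≤ x) : Sst x = 1 :=
  Real.smoothTransition.one_of_one_le (by linarith)
theorem Sst_nonneg (x : ℝ) : 0 ≤ Sst x := Real.smoothTransition.nonneg _
theorem Sst_le_one (x : ℝ) : Sst x ≤ 1 := Real.smoothTransition.le_one _

def btb (x : ℝ) : ℝ := Sst (x + 1) - Sst x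
def thb (x : ℝ) : ℝ :=
  Real.smoothTransition (8 * (x + 7/8)) * Real.smoothTransition (8 * (7/8 - x))
theorem btb_smooth : ContDiff ℝ ∞ btb := by
  have := Sst_smooth
  unfold btb; fun_prop
theorem thb_smooth : ContDiff ℝ ∞ thb := by
  have : ContDiff ℝ ∞ Real.smoothTransition := Real.smoothTransition.contDiff
  unfold thb; fun_prop
theorem thb_zero {x : ℝ} (h : 1 ≤ |x|) : thb x = 0 := by
  unfold thb
  rcases le_abs.1 h with h | h
  · rw [Real.smoothTransition.zero_of_nonpos (x := 8 * (7/8 - x)) (by linarith)]; simp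
  · rw [Real.smoothTransition.zero_of_nonpos (x := 8 * (x + 7/8)) (by linarith)]; simp
theorem thb_one {x : ℝ} (h : |x| ≤ 3/4) : thb x = 1 := by
  unfold thb
  rw [abs_le] at h
  rw [Real.smoothTransition.one_of_one_le (by linarith),
    Real.smoothTransition.one_of_one_le (by linarith)]; simp
theorem thb_nonneg (x : ℝ) : 0 ≤ thb x :=
  mul_nonneg (Real.smoothTransition.nonneg _) (Real.smoothTransition.nonneg _)
theorem thb_le_one (x : ℝ) : thb x ≤ 1 :=
  mul_le_one₀ (Real.smoothTransition.le_one _) (Real.smoothTransition.nonneg _)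
    (Real.smoothTransition.le_one _)
theorem thb_act {x : ℝ} (h : thb x ≠ 0) : |x| < 1 := by
  by_contra! h'; exact h (thb_zero h')
theorem btb_nonneg (x : ℝ) : 0 ≤ btb x := by
  unfold btb
  rcases le_total x (1/4) with h | h
  · rw [Sst_zero h]; linarith [Sst_nonneg (x + 1)]
  · rw [Sst_one (x := x + 1) (by linarith)]; linarith [Sst_le_one x]
theorem btb_le_one (x : ℝ) : btb x ≤ 1 := by
  unfold btb; linarith [Sst_nonneg x, Sst_le_one (x + 1)]
theorem btb_zero {x : ℝ} (h : 3/4 ≤ |x|) : btb x = 0 := by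
  unfold btb
  rcases le_abs.1 h with h | h
  · rw [Sst_one h, Sst_one (by linarith)]; simp
  · rw [Sst_zero (by linarith), Sst_zero (by linarith)]; simp
theorem btb_act {x : ℝ} (h : btb x ≠ 0) : thb x = 1 := by
  by_cases h' : 3/4 ≤ |x|
  · exact absurd (btb_zero h') h
  · exact thb_one (le_of_not_ge h')
theorem btb_le_thb (x : ℝ) : btb x ≤ thb x := by
  by_cases h : btb x = 0
  · rw [h]; exact thb_nonneg x
  · rw [btb_act h]; exact btb_le_one x

/-- level sums -/
def LS (F : ℕ → ℝ → ℝ → ℝ → ℝ) (θ l t : ℝ) : ℝ := ∑ k ∈ Finset.range (⌊l⌋₊ + 2), F k θ l t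

theorem LS_eq {F : ℕ → ℝ → ℝ → ℝ → ℝ} (h0 : ∀ (k : ℕ) (θ l t : ℝ), 1 ≤ |l - (k:ℝ)| → F k θ l t = 0)
    {θ l t : ℝ} {K : ℕ} (hK : l + 1 ≤ K) : LS F θ l t = ∑ k ∈ Finset.range K, F k θ l t := by
  have hz : ∀ k, k ≥ ⌈l + 1⌉₊ → F k θ l t = 0 := by
    intro k hk
    have : l + 1 ≤ k := (Nat.le_ceil _).trans (by exact_mod_cast hk)
    apply h0
    rw [le_abs]; right; linarith
  have h1 := Finset.eventually_constant_sum hz (n := K) (Nat.ceil_le.2 hK)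
  have h2 := Finset.eventually_constant_sum hz (n := ⌊l⌋₊ + 2) (Nat.ceil_le.2 (by
    have := Nat.lt_floor_add_one l
    push_cast; linarith))
  rw [LS, h2, h1]

theorem LS_two {F : ℕ → ℝ → ℝ → ℝ → ℝ} (h0 : ∀ (k : ℕ) (θ l t : ℝ), 1 ≤ |l - (k:ℝ)| → F k θ l t = 0)
    {θ l t : ℝ} (hl : 0 ≤ l) : LS F θ l t = F ⌊l⌋₊ θ l t + F (⌊l⌋₊ + 1) θ l t := by
  rw [LS, Finset.sum_range_succ, Finset.sum_range_succ, Finset.sum_eq_zero]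
  · ring
  · intro k hk
    apply h0
    have : (k:ℝ) + 1 ≤ ⌊l⌋₊ := by exact_mod_cast (Finset.mem_range.1 hk)
    have := Nat.floor_le hl
    rw [le_abs]; left; linarith

theorem LS_smooth {F : ℕ → ℝ → ℝ → ℝ → ℝ} (h0 : ∀ (k : ℕ) (θ l t : ℝ), 1 ≤ |l - (k:ℝ)| → F k θ l t = 0)
    (hF : ∀ k, ContDiff ℝ ∞ (fun q : ℝ × ℝ × ℝ => F k q.1 q.2.1 q.2.2)) :
    ContDiff ℝ ∞ (fun q : ℝ × ℝ × ℝ => LS F q.1 q.2.1 q.2.2) := by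
  rw [contDiff_iff_contDiffAt]
  intro q0
  obtain ⟨K, hK⟩ := exists_nat_gt (q0.2.1 + 1)
  have : (fun q : ℝ × ℝ × ℝ => LS F q.1 q.2.1 q.2.2) =ᶠ[𝓝 q0]
      fun q => ∑ k ∈ Finset.range K, F k q.1 q.2.1 q.2.2 := by
    have hc : ContinuousAt (fun q : ℝ × ℝ × ℝ => q.2.1 + 1) q0 := by fun_prop
    filter_upwards [hc.eventually_lt_const hK] with q hq
    exact LS_eq h0 hq.le
  refine ContDiffAt.congr_of_eventuallyEq ?_ this
  exact (ContDiff.sum fun k _ => hF k).contDiffAt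

theorem LS_bound {F : ℕ → ℝ → ℝ → ℝ → ℝ} (h0 : ∀ (k : ℕ) (θ l t : ℝ), 1 ≤ |l - (k:ℝ)| → F k θ l t = 0)
    {θ l t D : ℝ} (hl : 0 ≤ l) (hD : ∀ k, |F k θ l t| ≤ D) : |LS F θ l t| ≤ 2 * D := by
  rw [LS_two h0 hl]
  have := abs_add_le (F ⌊l⌋₊ θ l t) (F (⌊l⌋₊ + 1) θ l t)
  linarith [hD ⌊l⌋₊, hD (⌊l⌋₊ + 1)]

theorem LS_sum_btb {l : ℝ} (hl : 0 ≤ l) : ∑ k ∈ Finset.range (⌊l⌋₊ + 2), btb (l - k) = 1 := by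
  have := Finset.sum_range_sub' (fun k : ℕ => Sst (l + 1 - k)) (⌊l⌋₊ + 2)
  have h2 : ∑ k ∈ Finset.range (⌊l⌋₊ + 2), btb (l - k) =
      ∑ k ∈ Finset.range (⌊l⌋₊ + 2), (Sst (l + 1 - k) - Sst (l + 1 - ((k + 1 : ℕ) : ℝ))) := by
    refine Finset.sum_congr rfl fun k _ => ?_
    unfold btb; push_cast; ring_nf
  rw [h2, this, Sst_one (by push_cast; linarith), Sst_zero]
  · simp
  · have := Nat.lt_floor_add_one l
    push_cast; linarith

/-- separation of zones of consecutive levels -/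
theorem sep (k k' : ℕ) (m : ℤ) (hne : k ≠ k') (h1 : k ≤ k' + 1) (h2 : k' ≤ k + 1) :
    ∃ m' : ℤ, ∀ t : ℝ, |2 ^ k * t - m - 1/2| ≤ 1/8 → |2 ^ k' * t - m'| ≤ 3/8 := by
  obtain h | h : k' = k + 1 ∨ k = k' + 1 := by omega
  · subst h
    refine ⟨2 * m + 1, fun t ht => ?_⟩
    rw [abs_le] at ht ⊢
    push_cast
    rw [pow_succ]
    constructor <;> nlinarith
  · subst h
    rcases Int.even_or_odd' m with ⟨m', hm | hm⟩
    · refine ⟨m', fun t ht => ?_⟩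
      rw [abs_le, hm] at ht
      push_cast [pow_succ] at ht
      rw [abs_le]; constructor <;> linarith
    · refine ⟨m' + 1, fun t ht => ?_⟩
      rw [abs_le, hm] at ht
      push_cast [pow_succ] at ht
      rw [abs_le]; push_cast; constructor <;> linarith

theorem thb_near {l : ℝ} {k k' : ℕ} (h : thb (l - k) ≠ 0) (h' : thb (l - k') ≠ 0) :
    k ≤ k' + 1 ∧ k' ≤ k + 1 := by
  have h1 := abs_lt.1 (thb_act h)
  have h2 := abs_lt.1 (thb_act h')
  constructor
  · have : (k:ℝ) < k' + 2 := by linarith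
    have : k < k' + 2 := by exact_mod_cast this
    omega
  · have : (k':ℝ) < k + 2 := by linarith
    have : k' < k + 2 := by exact_mod_cast this
    omega

theorem fract_gap {u : ℝ} {m : ℤ} (h : |u - m| ≤ 3/8) : Int.fract u ≤ 3/8 ∨ 5/8 ≤ Int.fract u := by
  rw [abs_le] at h
  rcases le_or_gt (m:ℝ) u with h' | h'
  · left
    have : ⌊u⌋ = m := by rw [Int.floor_eq_iff]; constructor <;> linarith
    rw [Int.fract, this]; linarith
  · right
    have : ⌊u⌋ = m - 1 := by rw [Int.floor_eq_iff]; push_cast; constructor <;> linarith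
    rw [Int.fract, this]; push_cast; linarith

theorem hh_left {r j N : ℕ} {θ v : ℝ} (h : v < -1) : hh r j N θ v = 0 := by
  cases j with
  | zero => exact hh_zero_left h.le
  | succ j => exact hh_out (by rw [lt_abs]; right; linarith)

theorem hh_right {r j N : ℕ} {θ v : ℝ} (h : 1 < v) : hh r j N θ v = hh r j N θ 2 := by
  cases j with
  | zero => rw [hh_zero_right h.le, hh_zero_right (u := 2) (by norm_num)]
  | succ j => rw [hh_out (by rw [lt_abs]; left; linarith), hh_out (by norm_num)]

def fz (N : ℕ) (θ u : ℝ) : ℝ := θ / 32 * (osc N (32 * (u - 7/16)) + osc N (32 * (u - 9/16)))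
def fh (r j N : ℕ) (a θ u : ℝ) : ℝ := 32 ^ j * hh r j N θ (32 * (u - a))
def PZ (N : ℕ) (θ u : ℝ) : ℝ := Per (fz N) (fun _ => 0) θ u
def cH (r j N : ℕ) (θ : ℝ) : ℝ := 32 ^ j * hh r j N θ 2
def PH (r j N : ℕ) (a θ u : ℝ) : ℝ := Per (fh r j N a) (cH r j N) θ u

theorem fz_left (N : ℕ) (θ u : ℝ) (h : u ≤ 3/8) : fz N θ u = 0 := by
  rw [fz, osc_zero (by rw [le_abs]; right; linarith), osc_zero (by rw [le_abs]; right; linarith)]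
  simp
theorem fz_right (N : ℕ) (θ u : ℝ) (h : 5/8 ≤ u) : fz N θ u = 0 := by
  rw [fz, osc_zero (by rw [le_abs]; left; linarith), osc_zero (by rw [le_abs]; left; linarith)]
  simp
theorem fh_left {a : ℝ} (ha : a ∈ Icc (7/16:ℝ) (9/16)) (r j N : ℕ) (θ u : ℝ) (h : u ≤ 3/8) :
    fh r j N a θ u = 0 := by
  rw [fh, hh_left (by linarith [ha.1])]; simp
theorem fh_right {a : ℝ} (ha : a ∈ Icc (7/16:ℝ) (9/16)) (r j N : ℕ) (θ u : ℝ) (h : 5/8 ≤ u) :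
    fh r j N a θ u = cH r j N θ := by
  rw [fh, cH, hh_right (by linarith [ha.2])]

theorem cH_succ (r j N : ℕ) (θ : ℝ) : cH r (j + 1) N θ = 0 := by
  rw [cH, hh_out (by norm_num)]; simp
theorem cH_zero_one (r N : ℕ) : cH r 0 N 1 = 1 := by
  rw [cH, hh_zero_right (by norm_num), hh_one]; simp

theorem PZ_smooth (N : ℕ) : ContDiff ℝ ∞ (fun q : ℝ × ℝ => PZ N q.1 q.2) := by
  refine Per_smooth (fz_left N) (fz_right N) ?_
  have := osc_smooth N
  unfold fz; fun_prop

theorem PH_smooth {a : ℝ} (ha : a ∈ Icc (7/16:ℝ) (9/16)) (r j N : ℕ) :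
    ContDiff ℝ ∞ (fun q : ℝ × ℝ => PH r j N a q.1 q.2) := by
  refine Per_smooth (fh_left ha r j N) (fh_right ha r j N) ?_
  unfold fh
  refine contDiff_const.mul ((hh_smooth r j N).comp (f := fun q : ℝ × ℝ => (q.1, 32 * (q.2 - a))) ?_)
  fun_prop

def PZ' (N : ℕ) (θ u : ℝ) : ℝ := θ * (deriv (osc N) (32 * (Int.fract u - 7/16)) +
  deriv (osc N) (32 * (Int.fract u - 9/16)))

theorem lin_hasDerivAt (a u : ℝ) : HasDerivAt (fun u : ℝ => 32 * (u - a)) 32 u := by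
  simpa using ((hasDerivAt_id u).sub_const a).const_mul 32

theorem PZ_hasDerivAt (N : ℕ) (θ u : ℝ) : HasDerivAt (PZ N θ) (PZ' N θ u) u := by
  refine Per_hasDerivAt (fz_left N) (fz_right N) (f' := fun θ u => θ *
    (deriv (osc N) (32 * (u - 7/16)) + deriv (osc N) (32 * (u - 9/16)))) ?_ θ u
  intro θ u
  have h : ∀ v, HasDerivAt (osc N) (deriv (osc N) v) v :=
    fun v => ((osc_smooth N).differentiable (by simp) v).hasDerivAt
  have h1 := (h _).comp u (lin_hasDerivAt (7/16) u)
  have h2 := (h _).comp u (lin_hasDerivAt (9/16) u)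
  refine ((h1.add h2).const_mul (θ / 32)).congr_deriv ?_
  ring

def PH' (r j N : ℕ) (a θ u : ℝ) : ℝ := 32 ^ (j + 1) * (hh r (j + 1) N θ (32 * (Int.fract u - a)) *
  wt N θ (32 * (Int.fract u - a)))

theorem PH_hasDerivAt {a : ℝ} (ha : a ∈ Icc (7/16:ℝ) (9/16)) {r j : ℕ} (hj : j < r) (N : ℕ)
    (θ u : ℝ) : HasDerivAt (PH r j N a θ) (PH' r j N a θ u) u := by
  refine Per_hasDerivAt (fh_left ha r j N) (fh_right ha r j N) (f' := fun θ u =>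
    32 ^ (j + 1) * (hh r (j + 1) N θ (32 * (u - a)) * wt N θ (32 * (u - a)))) ?_ θ u
  intro θ u
  have h1 := (hh_hasDerivAt r j N hj θ (32 * (u - a))).comp u (lin_hasDerivAt a u)
  refine (h1.const_mul (32 ^ j)).congr_deriv ?_
  ring

theorem PZ_gap {N : ℕ} {θ u : ℝ} {m : ℤ} (h : |u - m| ≤ 3/8) : PZ N θ u = 0 := by
  unfold PZ Per
  rcases fract_gap h with h | h
  · rw [fz_left _ _ _ h]; simp
  · rw [fz_right _ _ _ h]; simp
theorem PZ'_gap {N : ℕ} {θ u : ℝ} {m : ℤ} (h : |u - m| ≤ 3/8) : PZ' N θ u = 0 := by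
  unfold PZ'
  rcases fract_gap h with h | h
  · rw [dosc_zero (by rw [lt_abs]; right; linarith), dosc_zero (by rw [lt_abs]; right; linarith)]
    simp
  · rw [dosc_zero (by rw [lt_abs]; left; linarith), dosc_zero (by rw [lt_abs]; left; linarith)]
    simp
theorem PH_gap {a : ℝ} (ha : a ∈ Icc (7/16:ℝ) (9/16)) {r j N : ℕ} {θ u : ℝ} {m : ℤ}
    (h : |u - m| ≤ 3/8) : PH r j N a θ u = cH r j N θ * m := by
  rw [abs_le] at h
  unfold PH
  rw [Per_eq (fh_left ha r j N) (fh_right ha r j N) θ m u (by linarith) (by linarith),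
    fh_left ha _ _ _ _ _ (by linarith)]
  simp
theorem PZ_zero (N : ℕ) (u : ℝ) : PZ N 0 u = 0 := by simp [PZ, Per, fz]
theorem PZ'_zero (N : ℕ) (u : ℝ) : PZ' N 0 u = 0 := by simp [PZ']

theorem PZ_add_nat (N : ℕ) (θ u : ℝ) (m : ℕ) : PZ N θ (u + m) = PZ N θ u := by
  induction m with
  | zero => simp
  | succ m ih =>
    have := Per_add_one (f := fz N) (c := fun _ => 0) θ (u + m)
    push_cast
    rw [← add_assoc]
    unfold PZ at *
    rw [this, ih, add_zero]
theorem PH_add_nat (r j N : ℕ) (a θ u : ℝ) (m : ℕ) :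
    PH r j N a θ (u + m) = PH r j N a θ u + m * cH r j N θ := by
  induction m with
  | zero => simp
  | succ m ih =>
    have := Per_add_one (f := fh r j N a) (c := cH r j N) θ (u + m)
    push_cast
    rw [← add_assoc]
    unfold PH at *
    rw [this, ih]; ring

end

noncomputable section
open Set Filter Topology
open scoped ContDiff

theorem mem7 : (7/16:ℝ) ∈ Icc (7/16:ℝ) (9/16) := by norm_num
theorem mem9 : (9/16:ℝ) ∈ Icc (7/16:ℝ) (9/16) := by norm_num

def Zt (N : ℕ → ℕ) (k : ℕ) (θ l t : ℝ) : ℝ := 1 / 2 ^ k * PZ (N k) (θ * thb (l - k)) (2 ^ k * t)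
def Zt' (N : ℕ → ℕ) (k : ℕ) (θ l t : ℝ) : ℝ := PZ' (N k) (θ * thb (l - k)) (2 ^ k * t)
def Et (r : ℕ) (N : ℕ → ℕ) (j k : ℕ) (θ l t : ℝ) : ℝ := thb (l - k) * (2 ^ k) ^ j *
  (PH r j (N k) (7/16) (θ * thb (l - k)) (2 ^ k * t) -
    PH r j (N k) (9/16) (θ * thb (l - k)) (2 ^ k * t))
def bt (r : ℕ) (N : ℕ → ℕ) (j k : ℕ) (θ l t : ℝ) : ℝ := btb (l - k) * ((2 ^ k) ^ j / 2 ^ k) *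
    PH r j (N k) (9/16) (θ * thb (l - k)) (2 ^ k * t)

def zf (N : ℕ → ℕ) (θ l t : ℝ) : ℝ := t + LS (Zt N) θ l t
def zf' (N : ℕ → ℕ) (θ l t : ℝ) : ℝ := 1 + LS (Zt' N) θ l t
def Ef (r : ℕ) (N : ℕ → ℕ) (j : ℕ) (θ l t : ℝ) : ℝ := LS (Et r N j) θ l t
def bf (r : ℕ) (N : ℕ → ℕ) (j : ℕ) (θ l t : ℝ) : ℝ := LS (bt r N j) θ l t

section
variable (r : ℕ) (N : ℕ → ℕ)

theorem Zt_h0 (k : ℕ) (θ l t : ℝ) (h : 1 ≤ |l - (k:ℝ)|) : Zt N k θ l t = 0 := by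
  rw [Zt, thb_zero h, mul_zero, PZ_zero, mul_zero]
theorem Zt'_h0 (k : ℕ) (θ l t : ℝ) (h : 1 ≤ |l - (k:ℝ)|) : Zt' N k θ l t = 0 := by
  rw [Zt', thb_zero h, mul_zero, PZ'_zero]
theorem Et_h0 (j k : ℕ) (θ l t : ℝ) (h : 1 ≤ |l - (k:ℝ)|) : Et r N j k θ l t = 0 := by
  rw [Et, thb_zero h, zero_mul, zero_mul]
theorem bt_h0 (j k : ℕ) (θ l t : ℝ) (h : 1 ≤ |l - (k:ℝ)|) : bt r N j k θ l t = 0 := by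
  rw [bt, btb_zero (by linarith), zero_mul, zero_mul]

theorem thbk_smooth (k : ℕ) : ContDiff ℝ ∞ (fun q : ℝ × ℝ × ℝ => thb (q.2.1 - k)) :=
  thb_smooth.comp (by fun_prop)
theorem btbk_smooth (k : ℕ) : ContDiff ℝ ∞ (fun q : ℝ × ℝ × ℝ => btb (q.2.1 - k)) :=
  btb_smooth.comp (by fun_prop)
theorem arg_smooth (k : ℕ) : ContDiff ℝ ∞
    (fun q : ℝ × ℝ × ℝ => (q.1 * thb (q.2.1 - k), 2 ^ k * q.2.2)) := by
  have := thbk_smooth k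
  fun_prop

theorem zf_smooth : ContDiff ℝ ∞ (fun q : ℝ × ℝ × ℝ => zf N q.1 q.2.1 q.2.2) := by
  unfold zf
  refine ContDiff.add (by fun_prop) (LS_smooth (Zt_h0 N) fun k => ?_)
  exact contDiff_const.mul ((PZ_smooth (N k)).comp (arg_smooth k))
theorem Ef_smooth (j : ℕ) : ContDiff ℝ ∞ (fun q : ℝ × ℝ × ℝ => Ef r N j q.1 q.2.1 q.2.2) := by
  unfold Ef
  refine (LS_smooth (Et_h0 r N j) fun k => ?_)
  exact ((thbk_smooth k).mul contDiff_const).mul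
    (((PH_smooth mem7 r j (N k)).comp (arg_smooth k)).sub
      ((PH_smooth mem9 r j (N k)).comp (arg_smooth k)))
theorem bf_smooth (j : ℕ) : ContDiff ℝ ∞ (fun q : ℝ × ℝ × ℝ => bf r N j q.1 q.2.1 q.2.2) := by
  unfold bf
  refine (LS_smooth (bt_h0 r N j) fun k => ?_)
  exact ((btbk_smooth k).mul contDiff_const).mul
    ((PH_smooth mem9 r j (N k)).comp (arg_smooth k))

theorem two_add (k : ℕ) (t : ℝ) : (2:ℝ) ^ k * (t + 1) = 2 ^ k * t + ((2 ^ k : ℕ) : ℝ) := by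
  push_cast; ring

theorem zf_add_one (θ l t : ℝ) : zf N θ l (t + 1) = zf N θ l t + 1 := by
  have : LS (Zt N) θ l (t + 1) = LS (Zt N) θ l t := by
    refine Finset.sum_congr rfl fun k _ => ?_
    rw [Zt, Zt, two_add, PZ_add_nat]
  rw [zf, zf, this]; ring
theorem zf_zero (l t : ℝ) : zf N 0 l t = t := by
  have : LS (Zt N) 0 l t = 0 := by
    refine Finset.sum_eq_zero fun k _ => ?_
    rw [Zt, zero_mul, PZ_zero, mul_zero]
  rw [zf, this, add_zero]
theorem Ef_add_one (j : ℕ) (θ l t : ℝ) : Ef r N j θ l (t + 1) = Ef r N j θ l t := by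
  unfold Ef LS
  refine Finset.sum_congr rfl fun k _ => ?_
  rw [Et, Et, two_add, PH_add_nat, PH_add_nat]; ring
theorem bf_add_one {j : ℕ} (hj : 1 ≤ j) (θ l t : ℝ) : bf r N j θ l (t + 1) = bf r N j θ l t := by
  unfold bf LS
  refine Finset.sum_congr rfl fun k _ => ?_
  obtain ⟨j, rfl⟩ : ∃ i, j = i + 1 := ⟨j - 1, by omega⟩
  rw [bt, bt, two_add, PH_add_nat, cH_succ]; ring
theorem bf_zero_add_one {l : ℝ} (hl : 0 ≤ l) (t : ℝ) :
    bf r N 0 1 l (t + 1) = bf r N 0 1 l t + 1 := by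
  have : ∀ k : ℕ, bt r N 0 k 1 l (t + 1) = bt r N 0 k 1 l t + btb (l - k) := by
    intro k
    rw [bt, bt, two_add, PH_add_nat]
    by_cases h : btb (l - k) = 0
    · simp [h]
    · rw [btb_act h, mul_one, cH_zero_one]
      push_cast
      field_simp
  rw [bf, bf, LS, LS, Finset.sum_congr rfl (fun k _ => this k), Finset.sum_add_distrib,
    LS_sum_btb hl]

theorem pow_hasDerivAt (k : ℕ) (t : ℝ) : HasDerivAt (fun t : ℝ => 2 ^ k * t) (2 ^ k) t := by
  simpa using (hasDerivAt_id t).const_mul ((2:ℝ) ^ k)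

theorem zf_hasDerivAt (θ l t : ℝ) : HasDerivAt (zf N θ l) (zf' N θ l t) t := by
  have h : HasDerivAt (LS (Zt N) θ l) (LS (Zt' N) θ l t) t := by
    unfold LS
    refine HasDerivAt.fun_sum fun k _ => ?_
    have := ((PZ_hasDerivAt (N k) (θ * thb (l - k)) (2 ^ k * t)).comp t
      (pow_hasDerivAt k t)).const_mul (1 / 2 ^ k)
    refine this.congr_deriv ?_
    unfold Zt'; field_simp
  exact (hasDerivAt_id t).add h

/-- in an active slab of level `k`, only level `k` contributes to `z'` -/
theorem LS_single {F : ℕ → ℝ → ℝ → ℝ → ℝ} {θ l t : ℝ} {k : ℕ} (hk : thb (l - k) ≠ 0)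
    (hF : ∀ k' : ℕ, k' ≠ k → F k' θ l t = 0) : LS F θ l t = F k θ l t := by
  refine Finset.sum_eq_single_of_mem k ?_ (fun k' _ h => hF k' h)
  have := abs_lt.1 (thb_act hk)
  rw [Finset.mem_range]
  have h2 := Nat.lt_floor_add_one l
  have : (k:ℝ) < ⌊l⌋₊ + 2 := by linarith
  exact_mod_cast this

theorem zf'_slab {θ l t : ℝ} {k : ℕ} {m : ℤ} (hk : thb (l - k) ≠ 0)
    (h : |2 ^ k * t - m - 1/2| ≤ 1/8) : zf' N θ l t = 1 + Zt' N k θ l t := by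
  rw [zf', LS_single hk]
  intro k' hk'
  by_cases hz : thb (l - k') = 0
  · rw [Zt', hz, mul_zero, PZ'_zero]
  · obtain ⟨h1, h2⟩ := thb_near hk hz
    obtain ⟨m', hm'⟩ := sep k k' m hk'.symm h1 h2
    rw [Zt', PZ'_gap (hm' t h)]

theorem zf_slab {θ l t : ℝ} {k : ℕ} {m : ℤ} (hk : thb (l - k) ≠ 0)
    (h : |2 ^ k * t - m - 1/2| ≤ 1/8) : zf N θ l t = t + Zt N k θ l t := by
  rw [zf, LS_single hk]
  intro k' hk'
  by_cases hz : thb (l - k') = 0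
  · rw [Zt, hz, mul_zero, PZ_zero, mul_zero]
  · obtain ⟨h1, h2⟩ := thb_near hk hz
    obtain ⟨m', hm'⟩ := sep k k' m hk'.symm h1 h2
    rw [Zt, PZ_gap (hm' t h), mul_zero]

theorem PH_chain {a : ℝ} (ha : a = 7/16 ∨ a = 9/16) {j k : ℕ} {θ l t : ℝ}
    (hk : thb (l - k) ≠ 0) :
    PH' r j (N k) a (θ * thb (l - k)) (2 ^ k * t) =
      PH r (j + 1) (N k) a (θ * thb (l - k)) (2 ^ k * t) * zf' N θ l t := by
  set u := (2:ℝ) ^ k * t with hu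
  set v := 32 * (Int.fract u - a) with hv
  have e1 : PH r (j + 1) (N k) a (θ * thb (l - k)) u =
      32 ^ (j + 1) * hh r (j + 1) (N k) (θ * thb (l - k)) v := by
    unfold PH Per; rw [cH_succ]; simp [fh, hv]
  rw [e1, PH', ← hv]
  by_cases hz : hh r (j + 1) (N k) (θ * thb (l - k)) v = 0
  · rw [hz]; simp
  have hv1 : |v| ≤ 1 := by
    by_contra! h; exact hz (hh_out h)
  rw [abs_le] at hv1
  have hf : u = Int.fract u + ⌊u⌋ := (Int.fract_add_floor u).symm
  have hs : |(2:ℝ) ^ k * t - ⌊u⌋ - 1/2| ≤ 1/8 := by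
    rw [← hu, abs_le]
    rcases ha with ha | ha <;> subst ha <;> constructor <;> linarith
  rw [zf'_slab N hk hs, Zt', PZ', ← hu, wt]
  rcases ha with ha | ha
  · rw [dosc_zero (u := 32 * (Int.fract u - 9/16)) (by rw [lt_abs]; right; subst ha; linarith)]
    subst ha; rw [← hv]; ring
  · rw [dosc_zero (u := 32 * (Int.fract u - 7/16)) (by rw [lt_abs]; left; subst ha; linarith)]
    subst ha; rw [← hv]; ring

theorem Ef_hasDerivAt {j : ℕ} (hj : j < r) (θ l t : ℝ) :
    HasDerivAt (Ef r N j θ l) (Ef r N (j + 1) θ l t * zf' N θ l t) t := by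
  unfold Ef LS
  rw [Finset.sum_mul]
  refine HasDerivAt.fun_sum fun k _ => ?_
  have h1 := ((PH_hasDerivAt mem7 hj (N k) (θ * thb (l - k)) (2 ^ k * t)).comp t
      (pow_hasDerivAt k t))
  have h2 := ((PH_hasDerivAt mem9 hj (N k) (θ * thb (l - k)) (2 ^ k * t)).comp t
      (pow_hasDerivAt k t))
  refine ((h1.sub h2).const_mul (thb (l - k) * (2 ^ k) ^ j)).congr_deriv ?_
  by_cases hk : thb (l - k) = 0
  · simp [Et, hk]
  rw [PH_chain r N (Or.inl rfl) hk, PH_chain r N (Or.inr rfl) hk, Et]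
  ring

theorem bf_hasDerivAt {j : ℕ} (hj : j < r) (θ l t : ℝ) :
    HasDerivAt (bf r N j θ l) (bf r N (j + 1) θ l t * zf' N θ l t) t := by
  unfold bf LS
  rw [Finset.sum_mul]
  refine HasDerivAt.fun_sum fun k _ => ?_
  have h2 := ((PH_hasDerivAt mem9 hj (N k) (θ * thb (l - k)) (2 ^ k * t)).comp t
      (pow_hasDerivAt k t))
  refine (h2.const_mul (btb (l - k) * ((2 ^ k) ^ j / 2 ^ k))).congr_deriv ?_
  by_cases hk : btb (l - k) = 0
  · simp [bt, hk]
  rw [PH_chain r N (Or.inr rfl) (by rw [btb_act hk]; exact one_ne_zero), bt]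
  ring

/-- zones -/
def Zn (k : ℕ) (m : ℤ) (a t : ℝ) : Prop := |32 * (2 ^ k * t - m - a)| < 1

theorem Zn_slab {k : ℕ} {m : ℤ} {a t : ℝ} (ha : a = 7/16 ∨ a = 9/16) (h : Zn k m a t) :
    |(2:ℝ) ^ k * t - m - 1/2| < 1/8 := by
  unfold Zn at h
  rw [abs_lt] at h ⊢
  rcases ha with ha | ha <;> subst ha <;> constructor <;> linarith

theorem Zn_fract {k : ℕ} {m : ℤ} {a t : ℝ} (ha : a = 7/16 ∨ a = 9/16) (h : Zn k m a t) :
    ⌊(2:ℝ) ^ k * t⌋ = m ∧ Int.fract ((2:ℝ) ^ k * t) = 2 ^ k * t - m := by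
  have := abs_lt.1 (Zn_slab ha h)
  have e : ⌊(2:ℝ) ^ k * t⌋ = m := by rw [Int.floor_eq_iff]; constructor <;> linarith
  exact ⟨e, by rw [Int.fract, e]⟩

theorem Zn_unique {k k' : ℕ} {m m' : ℤ} {a a' t l : ℝ} (ha : a = 7/16 ∨ a = 9/16)
    (ha' : a' = 7/16 ∨ a' = 9/16) (hk : thb (l - k) ≠ 0) (hk' : thb (l - k') ≠ 0)
    (h : Zn k m a t) (h' : Zn k' m' a' t) : k = k' ∧ m = m' ∧ a = a' := by
  have e : k = k' := by
    by_contra hne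
    obtain ⟨h1, h2⟩ := thb_near hk hk'
    obtain ⟨m'', hm''⟩ := sep k k' m hne h1 h2
    have q1 := abs_le.1 (hm'' t (Zn_slab ha h).le)
    have q2 := abs_lt.1 (Zn_slab ha' h')
    have q3 : (m':ℝ) < m'' := by linarith
    have q4 : (m'':ℝ) < m' + 1 := by linarith
    have q3 : m' < m'' := by exact_mod_cast q3
    have q4 : m'' < m' + 1 := by exact_mod_cast q4
    omega
  subst e
  have hm : m = m' := by rw [← (Zn_fract ha h).1, ← (Zn_fract ha' h').1]
  subst hm
  refine ⟨rfl, rfl, ?_⟩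
  unfold Zn at h h'
  rw [abs_lt] at h h'
  rcases ha with ha | ha <;> rcases ha' with ha' | ha' <;> subst ha <;> subst ha' <;>
    first | rfl | (exfalso; linarith)

theorem zf_in {k : ℕ} {m : ℤ} {a t θ l : ℝ} (hθ : θ ∈ Icc (0:ℝ) 1) (ha : a = 7/16 ∨ a = 9/16)
    (hk : thb (l - k) ≠ 0) (h : Zn k m a t) : Zn k m a (zf N θ l t) := by
  rw [zf_slab N hk (Zn_slab ha h).le]
  have hf := (Zn_fract ha h).2
  set v := 32 * (2 ^ k * t - m - a) with hv
  have hP : PZ (N k) (θ * thb (l - k)) (2 ^ k * t) = θ * thb (l - k) / 32 * osc (N k) v := by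
    have hab := abs_lt.1 (show |v| < 1 from h)
    unfold PZ Per fz
    rw [hf]
    rcases ha with ha | ha
    · rw [osc_zero (u := 32 * (2 ^ k * t - m - 9/16)) (by rw [le_abs]; right; subst ha; linarith)]
      subst ha; simp [hv]
    · rw [osc_zero (u := 32 * (2 ^ k * t - m - 7/16)) (by rw [le_abs]; left; subst ha; linarith)]
      subst ha; simp [hv]
  have e : 32 * (2 ^ k * (t + Zt N k θ l t) - m - a) = v + θ * thb (l - k) * osc (N k) v := by
    rw [Zt, hP, hv]; field_simp; ring
  unfold Zn
  rw [e]
  have h1 : |θ * thb (l - k) * osc (N k) v| ≤ eta v := by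
    rw [abs_mul, abs_of_nonneg (mul_nonneg hθ.1 (thb_nonneg _))]
    calc _ ≤ 1 * eta v := mul_le_mul (mul_le_one₀ hθ.2 (thb_nonneg _) (thb_le_one _))
          (osc_le _ _) (abs_nonneg _) zero_le_one
      _ = _ := one_mul _
  have h2 := eta_lt (show |v| < 1 from h)
  linarith [abs_add_le v (θ * thb (l - k) * osc (N k) v)]

theorem zf_out {t θ l : ℝ}
    (h : ∀ (k : ℕ) (m : ℤ) (a : ℝ), (a = 7/16 ∨ a = 9/16) → thb (l - k) ≠ 0 → ¬ Zn k m a t) :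
    zf N θ l t = t := by
  have : LS (Zt N) θ l t = 0 := by
    refine Finset.sum_eq_zero fun k _ => ?_
    by_cases hk : thb (l - k) = 0
    · rw [Zt, hk, mul_zero, PZ_zero, mul_zero]
    · have h1 := h k ⌊(2:ℝ) ^ k * t⌋ (7/16) (Or.inl rfl) hk
      have h2 := h k ⌊(2:ℝ) ^ k * t⌋ (9/16) (Or.inr rfl) hk
      unfold Zn at h1 h2
      rw [Zt, PZ, Per, fz, Int.fract, osc_zero (le_of_not_gt h1), osc_zero (le_of_not_gt h2)]
      simp
  rw [zf, this, add_zero]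

theorem zf_same_zone {t t' θ l : ℝ} (hθ : θ ∈ Icc (0:ℝ) 1) (hne : t ≠ t')
    (hz : zf N θ l t = zf N θ l t') :
    ∃ (k : ℕ) (m : ℤ) (a : ℝ), (a = 7/16 ∨ a = 9/16) ∧ thb (l - k) ≠ 0 ∧
      Zn k m a t ∧ Zn k m a t' := by
  by_cases h : ∃ (k : ℕ) (m : ℤ) (a : ℝ), (a = 7/16 ∨ a = 9/16) ∧ thb (l - k) ≠ 0 ∧ Zn k m a t
  · obtain ⟨k, m, a, ha, hk, hz1⟩ := h
    have hy := zf_in N hθ ha hk hz1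
    by_cases h' : ∃ (k : ℕ) (m : ℤ) (a : ℝ), (a = 7/16 ∨ a = 9/16) ∧ thb (l - k) ≠ 0 ∧ Zn k m a t'
    · obtain ⟨k', m', a', ha', hk', hz2⟩ := h'
      have hy' := zf_in N hθ ha' hk' hz2
      rw [← hz] at hy'
      obtain ⟨rfl, rfl, rfl⟩ := Zn_unique ha ha' hk hk' hy hy'
      exact ⟨k, m, a, ha, hk, hz1, hz2⟩
    · push Not at h'
      rw [hz, zf_out N h'] at hy
      exact absurd hy (h' k m a ha hk)
  · push Not at h
    by_cases h' : ∃ (k : ℕ) (m : ℤ) (a : ℝ), (a = 7/16 ∨ a = 9/16) ∧ thb (l - k) ≠ 0 ∧ Zn k m a t'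
    · obtain ⟨k', m', a', ha', hk', hz2⟩ := h'
      have hy' := zf_in N hθ ha' hk' hz2
      rw [← hz, zf_out N h] at hy'
      exact absurd hy' (h k' m' a' ha' hk')
    · push Not at h'
      rw [zf_out N h, zf_out N h'] at hz
      exact absurd hz hne

theorem PH_in {k : ℕ} {m : ℤ} {a t θ : ℝ} (ha : a = 7/16 ∨ a = 9/16) (h : Zn k m a t) (a' : ℝ)
    (M : ℕ) : PH r 0 M a' θ (2 ^ k * t) = hh r 0 M θ (32 * (2 ^ k * t - m - a')) + cH r 0 M θ * m := by
  obtain ⟨h1, h2⟩ := Zn_fract ha h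
  unfold PH Per fh
  rw [h1, h2]; simp

theorem zone_diff {k : ℕ} {m : ℤ} {a t t' θ l : ℝ} (ha : a = 7/16 ∨ a = 9/16)
    (hk : thb (l - k) ≠ 0) (h : Zn k m a t) (h' : Zn k m a t') :
    Ef r N 0 θ l t - Ef r N 0 θ l t' = Et r N 0 k θ l t - Et r N 0 k θ l t' ∧
    bf r N 0 θ l t - bf r N 0 θ l t' = bt r N 0 k θ l t - bt r N 0 k θ l t' := by
  have hgap : ∀ k' : ℕ, k' ≠ k → thb (l - k') ≠ 0 → ∃ m' : ℤ,
      |(2:ℝ) ^ k' * t - m'| ≤ 3/8 ∧ |(2:ℝ) ^ k' * t' - m'| ≤ 3/8 := by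
    intro k' hne hk'
    obtain ⟨h1, h2⟩ := thb_near hk hk'
    obtain ⟨m', hm'⟩ := sep k k' m hne.symm h1 h2
    exact ⟨m', hm' t (Zn_slab ha h).le, hm' t' (Zn_slab ha h').le⟩
  constructor
  · have := LS_single (F := fun k θ l _ => Et r N 0 k θ l t - Et r N 0 k θ l t') (θ := θ) (t := 0) hk
      (by
        intro k' hne
        by_cases hk' : thb (l - k') = 0
        · simp [Et, hk']
        · obtain ⟨m', h1, h2⟩ := hgap k' hne hk'
          simp only [Et]
          rw [PH_gap mem7 h1, PH_gap mem9 h1, PH_gap mem7 h2, PH_gap mem9 h2]; ring)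
    rw [← this, Ef, Ef, LS, LS, LS, Finset.sum_sub_distrib]
  · have := LS_single (F := fun k θ l _ => bt r N 0 k θ l t - bt r N 0 k θ l t') (θ := θ) (t := 0) hk
      (by
        intro k' hne
        by_cases hk' : thb (l - k') = 0
        · have : btb (l - k') = 0 := by
            by_contra hb
            rw [btb_act hb] at hk'; exact one_ne_zero hk'
          simp [bt, this]
        · obtain ⟨m', h1, h2⟩ := hgap k' hne hk'
          simp only [bt]
          rw [PH_gap mem9 h1, PH_gap mem9 h2]; ring)
    rw [← this, bf, bf, LS, LS, LS, Finset.sum_sub_distrib]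

theorem act_bound {l : ℝ} (hl : 1 ≤ l) {k : ℕ} (hk : thb (l - k) ≠ 0) :
    (1:ℝ) / 2 ^ k ≤ 1 / l := by
  have h1 := abs_lt.1 (thb_act hk)
  have h2 : ((k + 1 : ℕ):ℝ) ≤ 2 ^ k := by exact_mod_cast Nat.lt_two_pow_self
  push_cast at h2
  exact one_div_le_one_div_of_le (by linarith) (by linarith)

theorem zf_inj {t t' θ l : ℝ} (hθ : θ ∈ Icc (0:ℝ) 1) (hl : 1 ≤ l) (hne : t ≠ t')
    (hz : zf N θ l t = zf N θ l t') : Ef r N 0 θ l t ≠ Ef r N 0 θ l t' ∧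
    |bf r N 0 θ l t - bf r N 0 θ l t'| ≤ 1 / l * |Ef r N 0 θ l t - Ef r N 0 θ l t'| := by
  obtain ⟨k, m, a, ha, hk, h, h'⟩ := zf_same_zone N hθ hne hz
  obtain ⟨hE, hb⟩ := zone_diff r N (θ := θ) ha hk h h'
  have hvv : hh r 0 (N k) (θ * thb (l - k)) (32 * (2 ^ k * t - m - a)) ≠
      hh r 0 (N k) (θ * thb (l - k)) (32 * (2 ^ k * t' - m - a)) := by
    intro he
    have hi := (hh_strict r (N k) (θ * thb (l - k))).injOn
      (by have := abs_lt.1 (show |32 * (2 ^ k * t - (m:ℝ) - _)| < 1 from h); exact ⟨this.1.le, this.2.le⟩)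
      (by have := abs_lt.1 (show |32 * (2 ^ k * t' - (m:ℝ) - _)| < 1 from h'); exact ⟨this.1.le, this.2.le⟩) he
    have h2 : (0:ℝ) < 2 ^ k := by positivity
    apply hne
    have : (2:ℝ) ^ k * t = 2 ^ k * t' := by linarith
    exact mul_left_cancel₀ h2.ne' this
  set D := hh r 0 (N k) (θ * thb (l - k)) (32 * (2 ^ k * t - m - a)) -
      hh r 0 (N k) (θ * thb (l - k)) (32 * (2 ^ k * t' - m - a)) with hD
  have hD0 : D ≠ 0 := sub_ne_zero.2 hvv
  have hpos : 0 < thb (l - k) := lt_of_le_of_ne (thb_nonneg _) hk.symm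
  have hab := abs_lt.1 (show |32 * (2 ^ k * t - (m:ℝ) - _)| < 1 from h)
  have hab' := abs_lt.1 (show |32 * (2 ^ k * t' - (m:ℝ) - _)| < 1 from h')
  rcases ha with rfl | rfl
  · have hE' : Ef r N 0 θ l t - Ef r N 0 θ l t' = thb (l - k) * D := by
      rw [hE, Et, Et, PH_in r (Or.inl rfl) h, PH_in r (Or.inl rfl) h, PH_in r (Or.inl rfl) h',
        PH_in r (Or.inl rfl) h', hh_left (v := 32 * (2 ^ k * t - m - 9/16)) (by linarith),
        hh_left (v := 32 * (2 ^ k * t' - m - 9/16)) (by linarith), hD]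
      ring
    have hb' : bf r N 0 θ l t - bf r N 0 θ l t' = 0 := by
      rw [hb, bt, bt, PH_in r (Or.inl rfl) h, 
        PH_in r (Or.inl rfl) h', hh_left (v := 32 * (2 ^ k * t - m - 9/16)) (by linarith),
        hh_left (v := 32 * (2 ^ k * t' - m - 9/16)) (by linarith)]
      ring
    refine ⟨sub_ne_zero.1 (by rw [hE']; exact mul_ne_zero hk hD0), ?_⟩
    rw [hb', abs_zero]; positivity
  · have hE' : Ef r N 0 θ l t - Ef r N 0 θ l t' = -(thb (l - k) * D) := by
      rw [hE, Et, Et, PH_in r (Or.inr rfl) h, PH_in r (Or.inr rfl) h, PH_in r (Or.inr rfl) h',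
        PH_in r (Or.inr rfl) h', hh_right (v := 32 * (2 ^ k * t - m - 7/16)) (by linarith),
        hh_right (v := 32 * (2 ^ k * t' - m - 7/16)) (by linarith), hD]
      ring
    have hb' : bf r N 0 θ l t - bf r N 0 θ l t' = btb (l - k) * (1 / 2 ^ k) * D := by
      rw [hb, bt, bt, PH_in r (Or.inr rfl) h, PH_in r (Or.inr rfl) h', hD]
      ring
    refine ⟨sub_ne_zero.1 (by rw [hE']; exact neg_ne_zero.2 (mul_ne_zero hk hD0)), ?_⟩
    rw [hb', hE', abs_neg, abs_mul, abs_mul, abs_mul, abs_of_nonneg (btb_nonneg _),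
      abs_of_pos hpos, abs_of_pos (show (0:ℝ) < 1 / 2 ^ k by positivity)]
    have h1 := act_bound hl hk
    have h2 := btb_le_thb (l - k)
    calc _ ≤ thb (l - k) * (1 / l) * |D| := by gcongr
      _ = _ := by ring

theorem zf'_dense (hr : 1 ≤ r) {θ l : ℝ} (hθ : θ ∈ Icc (0:ℝ) 1) (hl : 1 ≤ l) :
    Dense {t | zf' N θ l t ≠ 0} := by
  refine dense_of_exists_between fun a b hab => ?_
  by_contra! hz
  have hz' : ∀ t ∈ Ioo a b, zf' N θ l t = 0 := by
    intro t ht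
    by_contra h
    exact hz t h ht
  obtain ⟨t1, h1, h1'⟩ := exists_between hab
  obtain ⟨t2, h2, h2'⟩ := exists_between h1'
  have hsub : ∀ t ∈ Icc t1 t2, zf' N θ l t = 0 := fun t ht =>
    hz' t ⟨h1.trans_le ht.1, ht.2.trans_lt h2'⟩
  have e1 : zf N θ l t2 = zf N θ l t1 := by
    refine constant_of_has_deriv_right_zero (f := zf N θ l)
      (fun t _ => (zf_hasDerivAt N θ l t).continuousAt.continuousWithinAt) ?_ t2 ⟨h2.le, le_rfl⟩
    intro t ht
    have := zf_hasDerivAt N θ l t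
    rw [hsub t ⟨ht.1, ht.2.le⟩] at this
    exact this.hasDerivWithinAt
  have e2 : Ef r N 0 θ l t2 = Ef r N 0 θ l t1 := by
    refine constant_of_has_deriv_right_zero (f := Ef r N 0 θ l)
      (fun t _ => (Ef_hasDerivAt r N hr θ l t).continuousAt.continuousWithinAt) ?_ t2 ⟨h2.le, le_rfl⟩
    intro t ht
    have := Ef_hasDerivAt r N hr θ l t
    rw [hsub t ⟨ht.1, ht.2.le⟩, mul_zero] at this
    exact this.hasDerivWithinAt
  exact (zf_inj r N hθ hl h2.ne' e1).1 e2


theorem Zt_bound {θ l t : ℝ} (hθ : θ ∈ Icc (0:ℝ) 1) (hl : 1 ≤ l) (k : ℕ) :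
    |Zt N k θ l t| ≤ 1 / l := by
  have hl0 : 0 < 1 / l := by positivity
  by_cases hk : thb (l - k) = 0
  · rw [Zt, hk, mul_zero, PZ_zero, mul_zero, abs_zero]; exact hl0.le
  have h1 := act_bound hl hk
  have h2 : |PZ (N k) (θ * thb (l - k)) (2 ^ k * t)| ≤ 1 := by
    unfold PZ Per fz
    rw [zero_mul, add_zero, abs_mul]
    have ho : ∀ u, |osc (N k) u| ≤ 1 := fun u => (osc_le _ _).trans (eta_le_one _)
    have hθ0 : 0 ≤ θ * thb (l - k) := mul_nonneg hθ.1 (thb_nonneg _)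
    have hθ1 : θ * thb (l - k) ≤ 1 := mul_le_one₀ hθ.2 (thb_nonneg _) (thb_le_one _)
    have h3 : |θ * thb (l - k) / 32| ≤ 1 / 2 := by
      rw [abs_of_nonneg (by positivity)]; linarith
    have h4 := abs_add_le (osc (N k) (32 * (Int.fract ((2:ℝ) ^ k * t) - 7/16)))
      (osc (N k) (32 * (Int.fract ((2:ℝ) ^ k * t) - 9/16)))
    calc _ ≤ (1 / 2 : ℝ) * 2 := by
          refine mul_le_mul (c := |osc (N k) (32 * (Int.fract ((2:ℝ) ^ k * t) - 7/16)) + 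
            osc (N k) (32 * (Int.fract ((2:ℝ) ^ k * t) - 9/16))|) h3
            (h4.trans ?_) (abs_nonneg _) (by norm_num)
          linarith [ho (32 * (Int.fract ((2:ℝ) ^ k * t) - 7/16)),
            ho (32 * (Int.fract ((2:ℝ) ^ k * t) - 9/16))]
      _ = 1 := by norm_num
  rw [Zt, abs_mul, abs_of_pos (by positivity)]
  calc _ ≤ 1 / l * 1 := by gcongr
    _ = _ := mul_one _

theorem PH_abs {a θ u : ℝ} {j M : ℕ} : PH r (j + 1) M a θ u =
    32 ^ (j + 1) * hh r (j + 1) M θ (32 * (Int.fract u - a)) := by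
  unfold PH Per; rw [cH_succ]; simp [fh]

end

theorem lemmaZ (r : ℕ) (hr : 1 ≤ r) : ∃ C : ℝ, 0 < C ∧ ∃ (z z' : ℝ → ℝ → ℝ → ℝ)
    (E b : ℕ → ℝ → ℝ → ℝ → ℝ),
    ContDiff ℝ ∞ (fun q : ℝ × ℝ × ℝ => z q.1 q.2.1 q.2.2) ∧
    (∀ j, ContDiff ℝ ∞ (fun q : ℝ × ℝ × ℝ => E j q.1 q.2.1 q.2.2)) ∧
    (∀ j, ContDiff ℝ ∞ (fun q : ℝ × ℝ × ℝ => b j q.1 q.2.1 q.2.2)) ∧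
    (∀ θ l t, z θ l (t + 1) = z θ l t + 1) ∧ (∀ l t, z 0 l t = t) ∧
    (∀ j θ l t, E j θ l (t + 1) = E j θ l t) ∧
    (∀ j θ l t, 1 ≤ j → b j θ l (t + 1) = b j θ l t) ∧
    (∀ l t, 1 ≤ l → b 0 1 l (t + 1) = b 0 1 l t + 1) ∧
    (∀ θ l t, HasDerivAt (z θ l) (z' θ l t) t) ∧
    (∀ j θ l t, j < r → HasDerivAt (E j θ l) (E (j + 1) θ l t * z' θ l t) t) ∧
    (∀ j θ l t, j < r → HasDerivAt (b j θ l) (b (j + 1) θ l t * z' θ l t) t) ∧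
    (∀ θ l, θ ∈ Icc (0:ℝ) 1 → 1 ≤ l → Dense {t | z' θ l t ≠ 0}) ∧
    (∀ θ l t t', θ ∈ Icc (0:ℝ) 1 → 1 ≤ l → t ≠ t' → z θ l t = z θ l t' →
      E 0 θ l t ≠ E 0 θ l t' ∧ |b 0 θ l t - b 0 θ l t'| ≤ C / l * |E 0 θ l t - E 0 θ l t'|) ∧
    (∀ θ l t, θ ∈ Icc (0:ℝ) 1 → 1 ≤ l → |z θ l t - t| ≤ C / l ∧ |E 0 θ l t| ≤ C ∧
      (∀ j, 1 ≤ j → j ≤ r → |E j θ l t| ≤ C / l ∧ |b j θ l t| ≤ C / l)) ∧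
    (∀ l t, 1 ≤ l → |b 0 1 l t - t| ≤ C / l) := by
  obtain ⟨C, hC, N₀, hN₀, hb⟩ := hh_bound r
  set N : ℕ → ℕ := fun k => N₀ * 2 ^ (k * (r + 1)) with hN
  have hNN : ∀ k, N₀ ≤ N k := fun k => Nat.le_mul_of_pos_right _ (by positivity)
  set B := 4 * 32 ^ r * (C + 1) with hB
  have h32 : (1:ℝ) ≤ 32 ^ r := one_le_pow₀ (by norm_num)
  have hCB : 4 * (C + 1) ≤ B := by rw [hB]; nlinarith
  have hθt : ∀ {θ : ℝ} (x : ℝ), θ ∈ Icc (0:ℝ) 1 → θ * thb x ∈ Icc (0:ℝ) 1 := fun x hθ =>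
    ⟨mul_nonneg hθ.1 (thb_nonneg _), mul_le_one₀ hθ.2 (thb_nonneg _) (thb_le_one _)⟩
  -- bound of higher pieces
  have hP : ∀ (j k : ℕ) (θ u a : ℝ), 1 ≤ j → j ≤ r → θ ∈ Icc (0:ℝ) 1 →
      (2 ^ k) ^ j * |PH r j (N k) a θ u| ≤ 32 ^ r * C * (1 / 2 ^ k) := by
    intro j k θ u a hj hjr hθ
    obtain ⟨i, rfl⟩ : ∃ i, j = i + 1 := ⟨j - 1, by omega⟩
    have h1 := (hb (N k) (hNN k) θ hθ (32 * (Int.fract u - a))).2 (i + 1) hj hjr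
    rw [PH_abs, abs_mul, abs_of_pos (by positivity)]
    have h2 : ((2:ℝ) ^ k) ^ (i + 1) * 2 ^ k ≤ N k := by
      rw [hN]; push_cast
      have : (1:ℝ) ≤ N₀ := by exact_mod_cast hN₀
      have h3 : ((2:ℝ) ^ k) ^ (i + 1) ≤ (2 ^ k) ^ r := by
        gcongr; exact one_le_pow₀ (by norm_num)
      calc _ ≤ ((2:ℝ) ^ k) ^ r * 2 ^ k := by gcongr
        _ = 1 * 2 ^ (k * (r + 1)) := by rw [pow_mul, pow_succ, one_mul]
        _ ≤ _ := by gcongr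
    have h3 : (32:ℝ) ^ (i + 1) ≤ 32 ^ r := by gcongr; norm_num
    have hNp : (0:ℝ) < N k := lt_of_lt_of_le (by positivity) h2
    calc _ ≤ ((2:ℝ) ^ k) ^ (i + 1) * (32 ^ r * (C / N k)) := by gcongr
      _ = 32 ^ r * C * (((2:ℝ) ^ k) ^ (i + 1) / N k) := by ring
      _ ≤ _ := by
        refine mul_le_mul_of_nonneg_left ?_ (by positivity)
        rw [div_le_div_iff₀ hNp (by positivity)]
        simpa using h2
  refine ⟨B, by positivity, zf N, zf' N, Ef r N, bf r N, zf_smooth N, Ef_smooth r N, bf_smooth r N,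
    zf_add_one N, zf_zero N, Ef_add_one r N, fun j θ l t hj => bf_add_one r N hj θ l t,
    fun l t hl => bf_zero_add_one r N (by linarith) t, zf_hasDerivAt N,
    fun j θ l t hj => Ef_hasDerivAt r N hj θ l t, fun j θ l t hj => bf_hasDerivAt r N hj θ l t,
    fun θ l hθ hl => zf'_dense r N hr hθ hl, ?_, ?_, ?_⟩
  · intro θ l t t' hθ hl hne hz
    have := zf_inj r N hθ hl hne hz
    refine ⟨this.1, this.2.trans ?_⟩
    gcongr; linarith
  · intro θ l t hθ hl
    have hl0 : 0 < l := by linarith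
    have hl1 : 0 < 1 / l := by positivity
    refine ⟨?_, ?_, fun j hj hjr => ⟨?_, ?_⟩⟩
    · have := LS_bound (Zt_h0 N) (θ := θ) (t := t) hl0.le (Zt_bound N hθ hl)
      rw [zf, add_sub_cancel_left]
      refine this.trans ?_
      rw [mul_one_div]; gcongr; linarith
    · refine (LS_bound (Et_h0 r N 0) (D := 2 * C) hl0.le ?_).trans (by linarith)
      intro k
      have e1 := (hb (N k) (hNN k) _ (hθt (l - k) hθ)
        (32 * (Int.fract ((2:ℝ) ^ k * t) - 7/16))).1
      have e2 := (hb (N k) (hNN k) _ (hθt (l - k) hθ)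
        (32 * (Int.fract ((2:ℝ) ^ k * t) - 9/16))).1
      have : Et r N 0 k θ l t = thb (l - k) *
        (hh r 0 (N k) (θ * thb (l - k)) (32 * (Int.fract ((2:ℝ) ^ k * t) - 7/16)) -
        hh r 0 (N k) (θ * thb (l - k)) (32 * (Int.fract ((2:ℝ) ^ k * t) - 9/16))) := by
        unfold Et PH Per fh; ring
      rw [this, abs_mul, abs_of_nonneg (thb_nonneg _)]
      refine (mul_le_of_le_one_left (abs_nonneg _) (thb_le_one _)).trans ?_
      refine (abs_sub _ _).trans (by linarith)
    · refine (LS_bound (Et_h0 r N j) (D := 2 * (32 ^ r * C) * (1 / l)) hl0.le ?_).trans ?_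
      · intro k
        by_cases hk : thb (l - k) = 0
        · rw [Et, hk, zero_mul, zero_mul, abs_zero]; positivity
        have h1 := act_bound hl hk
        have e1 := hP j k _ (2 ^ k * t) (7/16) hj hjr (hθt (l - k) hθ)
        have e2 := hP j k _ (2 ^ k * t) (9/16) hj hjr (hθt (l - k) hθ)
        rw [Et, mul_assoc, abs_mul, abs_of_nonneg (thb_nonneg _)]
        refine (mul_le_of_le_one_left (abs_nonneg _) (thb_le_one _)).trans ?_
        rw [abs_mul, abs_of_pos (by positivity)]
        have e3 : 32 ^ r * C * (1 / 2 ^ k) ≤ 32 ^ r * C * (1 / l) := by gcongr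
        calc _ ≤ ((2:ℝ) ^ k) ^ j * (|PH r j (N k) (7/16) (θ * thb (l - k)) (2 ^ k * t)| +
              |PH r j (N k) (9/16) (θ * thb (l - k)) (2 ^ k * t)|) := by
              gcongr; exact abs_sub _ _
          _ ≤ _ := by linarith
      · rw [hB]
        have : 0 ≤ 4 * 32 ^ r * (1 / l) := by positivity
        calc _ = 4 * 32 ^ r * C * (1 / l) := by ring
          _ ≤ 4 * 32 ^ r * (C + 1) * (1 / l) := by linarith
          _ = _ := by ring
    · refine (LS_bound (bt_h0 r N j) (D := (32 ^ r * C) * (1 / l)) hl0.le ?_).trans ?_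
      · intro k
        by_cases hk : thb (l - k) = 0
        · have : btb (l - k) = 0 := le_antisymm ((btb_le_thb _).trans hk.le) (btb_nonneg _)
          rw [bt, this, zero_mul, zero_mul, abs_zero]; positivity
        have h1 := act_bound hl hk
        have e2 := hP j k _ (2 ^ k * t) (9/16) hj hjr (hθt (l - k) hθ)
        rw [bt, mul_assoc, abs_mul, abs_of_nonneg (btb_nonneg _)]
        refine (mul_le_of_le_one_left (abs_nonneg _) (btb_le_one _)).trans ?_
        rw [abs_mul, abs_of_pos (by positivity)]
        have e3 : 32 ^ r * C * (1 / 2 ^ k) ≤ 32 ^ r * C * (1 / l) := by gcongr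
        have e4 : ((2:ℝ) ^ k) ^ j / 2 ^ k ≤ (2 ^ k) ^ j :=
          div_le_self (by positivity) (one_le_pow₀ (by norm_num))
        calc _ ≤ ((2:ℝ) ^ k) ^ j * (|PH r j (N k) (9/16) (θ * thb (l - k)) (2 ^ k * t)|) := by
              gcongr
          _ ≤ _ := by linarith
      · rw [hB]
        have : 0 ≤ 32 ^ r * C * (1 / l) := by positivity
        have : 0 ≤ 32 ^ r * (1 / l) := by positivity
        calc _ = 2 * (32 ^ r * C * (1 / l)) := by ring
          _ ≤ 4 * (32 ^ r * C * (1 / l)) + 4 * (32 ^ r * (1 / l)) := by linarith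
          _ = _ := by ring
  · intro l t hl
    have hl0 : 0 < l := by linarith
    have e : bf r N 0 1 l t - t = LS (fun k θ l t => bt r N 0 k θ l t - btb (l - k) * t) 1 l t := by
      rw [bf, LS, LS, Finset.sum_sub_distrib, ← Finset.sum_mul, LS_sum_btb hl0.le, one_mul]
    rw [e]
    refine (LS_bound (D := (C + 1) * (1 / l)) ?_ hl0.le ?_).trans ?_
    · intro k θ l t h
      rw [bt_h0 r N 0 k θ l t h, btb_zero (by linarith)]; simp
    · intro k
      by_cases hk : btb (l - k) = 0
      · rw [bt, hk, zero_mul, zero_mul, zero_mul, sub_zero, abs_zero]; positivity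
      have ht := btb_act hk
      have h1 := act_bound hl (k := k) (by rw [ht]; exact one_ne_zero)
      have e2 := (hb (N k) (hNN k) 1 (by norm_num) (32 * (Int.fract ((2:ℝ) ^ k * t) - 9/16))).1
      have e3 : bt r N 0 k 1 l t - btb (l - k) * t = btb (l - k) * ((1 / 2 ^ k) *
          (hh r 0 (N k) 1 (32 * (Int.fract ((2:ℝ) ^ k * t) - 9/16)) - Int.fract ((2:ℝ) ^ k * t))) := by
        unfold bt PH Per fh
        rw [ht, mul_one, cH_zero_one]
        rw [show Int.fract ((2:ℝ) ^ k * t) = 2 ^ k * t - ⌊(2:ℝ) ^ k * t⌋ from rfl]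
        field_simp
        ring
      rw [e3, abs_mul, abs_of_nonneg (btb_nonneg _)]
      refine (mul_le_of_le_one_left (abs_nonneg _) (btb_le_one _)).trans ?_
      rw [abs_mul, abs_of_pos (by positivity), mul_comm]
      gcongr
      refine (abs_sub _ _).trans ?_
      rw [abs_of_nonneg (Int.fract_nonneg ((2:ℝ) ^ k * t))]
      linarith [Int.fract_lt_one ((2:ℝ) ^ k * t)]
    · have : 0 ≤ (C + 1) * (1 / l) := by positivity
      calc _ = (2 * (C + 1)) * (1 / l) := by ring
        _ ≤ B * (1 / l) := by gcongr; linarith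
        _ = _ := by ring
end

noncomputable section
open Set Filter Topology
open scoped ContDiff

theorem fderiv_iter_apply {E F : Type*} [NormedAddCommGroup E] [NormedSpace ℝ E]
    [NormedAddCommGroup F] [NormedSpace ℝ F] {f : E → F} (hf : ContDiff ℝ ∞ f) (i : ℕ) (x a : E)
    (w : Fin i → E) :
    iteratedFDeriv ℝ (i+1) f x (Fin.cons a w) = fderiv ℝ (fun y => iteratedFDeriv ℝ i f y w) x a := by
  rw [iteratedFDeriv_succ_apply_left]
  have hd : DifferentiableAt ℝ (iteratedFDeriv ℝ i f) x :=
    (hf.differentiable_iteratedFDeriv (m := i) (by exact_mod_cast WithTop.coe_lt_top i)) x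
  have := ((ContinuousMultilinearMap.apply ℝ (fun _ : Fin i => E) F w).hasFDerivAt.comp x
    hd.hasFDerivAt).fderiv
  simp only [Fin.cons_zero, Fin.tail_cons]
  have h2 : (fun y => iteratedFDeriv ℝ i f y w) =
    (ContinuousMultilinearMap.apply ℝ (fun _ : Fin i => E) F w) ∘ (iteratedFDeriv ℝ i f) := by
    funext y; rfl
  rw [h2, this]
  rfl

theorem iter_symm {E F : Type*} [NormedAddCommGroup E] [NormedSpace ℝ E]
    [NormedAddCommGroup F] [NormedSpace ℝ F] {f : E → F} (hf : ContDiff ℝ ∞ f) (i : ℕ) :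
    ∀ (x : E) (e : Equiv.Perm (Fin i)) (v : Fin i → E),
      iteratedFDeriv ℝ i f x (v ∘ e) = iteratedFDeriv ℝ i f x v := by
  induction i with
  | zero => intro x e v; congr 1; exact Subsingleton.elim _ _
  | succ i ih =>
    intro x e
    have hsw : ∀ (j : Fin i) (v : Fin (i+1) → E),
        iteratedFDeriv ℝ (i+1) f x (v ∘ (Equiv.swap j.castSucc j.succ)) =
          iteratedFDeriv ℝ (i+1) f x v := by
      intro j v
      cases i with
      | zero => exact j.elim0
      | succ k =>
        refine Fin.cases ?_ (fun j => ?_) j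
        · obtain ⟨a, v, rfl⟩ : ∃ a w, v = Fin.cons a w := ⟨v 0, Fin.tail v, (Fin.cons_self_tail v).symm⟩
          obtain ⟨b, w, rfl⟩ : ∃ a w, v = Fin.cons a w := ⟨v 0, Fin.tail v, (Fin.cons_self_tail v).symm⟩
          have : (Fin.cons a (Fin.cons b w : Fin (k+1) → E) : Fin (k+2) → E) ∘
              (Equiv.swap (Fin.castSucc (0 : Fin (k+1))) (Fin.succ 0)) =
              Fin.cons b (Fin.cons a w : Fin (k+1) → E) := by
            funext l
            refine Fin.cases ?_ (fun l => ?_) l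
            · simp
            · refine Fin.cases ?_ (fun l => ?_) l
              · simp
              · simp only [Function.comp]
                rw [Equiv.swap_apply_of_ne_of_ne]
                · simp
                · simp
                · exact fun h => Fin.succ_ne_zero _ (Fin.succ_injective _ h)
          rw [this]
          have key : ∀ a b : E, iteratedFDeriv ℝ (k+1+1) f x (Fin.cons a (Fin.cons b w : Fin (k+1) → E)) =
              fderiv ℝ (fderiv ℝ (fun y => iteratedFDeriv ℝ k f y w)) x a b := by
            intro a b
            rw [fderiv_iter_apply hf]
            have h1 : (fun y => iteratedFDeriv ℝ (k+1) f y (Fin.cons b w)) =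
              fun y => fderiv ℝ (fun y => iteratedFDeriv ℝ k f y w) y b := by
              funext y; exact fderiv_iter_apply hf _ _ _ _
            rw [h1]
            have hs : ContDiff ℝ ∞ (fun y => iteratedFDeriv ℝ k f y w) := by
              have := hf.iteratedFDeriv_right (m := ∞) (i := k) (le_of_eq rfl)
              exact (ContinuousMultilinearMap.apply ℝ (fun _ : Fin k => E) F w).contDiff.comp this
            have hd : DifferentiableAt ℝ (fderiv ℝ (fun y => iteratedFDeriv ℝ k f y w)) x :=
              ((hs.fderiv_right (m := ∞) (by simp)).differentiable (by simp)) x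
            exact congrArg (fun L => L a)
              ((ContinuousLinearMap.apply ℝ F b).hasFDerivAt.comp x hd.hasFDerivAt).fderiv
          rw [key, key]
          have hs : ContDiff ℝ ∞ (fun y => iteratedFDeriv ℝ k f y w) := by
            have := hf.iteratedFDeriv_right (m := ∞) (i := k) (le_of_eq rfl)
            exact (ContinuousMultilinearMap.apply ℝ (fun _ : Fin k => E) F w).contDiff.comp this
          exact (hs.contDiffAt.isSymmSndFDerivAt (by simp; exact WithTop.coe_le_coe.2 (le_top : (2:ℕ∞) ≤ ⊤))) b a
        · obtain ⟨a, v, rfl⟩ : ∃ a w, v = Fin.cons a w := ⟨v 0, Fin.tail v, (Fin.cons_self_tail v).symm⟩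
          have : (Fin.cons a v : Fin (k+2) → E) ∘
              (Equiv.swap (Fin.castSucc (Fin.succ j)) (Fin.succ (Fin.succ j))) =
              Fin.cons a (v ∘ (Equiv.swap j.castSucc j.succ)) := by
            funext l
            refine Fin.cases ?_ (fun l => ?_) l
            · simp only [Function.comp]
              rw [Equiv.swap_apply_of_ne_of_ne]
              · simp
              · simp [← Fin.succ_castSucc, (Fin.succ_ne_zero _).symm]
              · simp [(Fin.succ_ne_zero _).symm]
            · simp only [Function.comp, Fin.cons_succ, ← Fin.succ_castSucc]
              rw [← (Fin.succ_injective _).map_swap]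
              simp
          rw [this, fderiv_iter_apply hf, fderiv_iter_apply hf]
          simp only [ih]
    have hmem : e ∈ Submonoid.closure (Set.range fun i : Fin i ↦ Equiv.swap i.castSucc i.succ) := by
      rw [Equiv.Perm.mclosure_swap_castSucc_succ]; trivial
    induction hmem using Submonoid.closure_induction with
    | mem e he => obtain ⟨j, rfl⟩ := he; exact hsw j
    | one => intro v; rfl
    | mul a b _ _ ha hb =>
      intro v
      have : v ∘ (a * b : Equiv.Perm _) = (v ∘ a) ∘ b := rfl
      rw [this, hb, ha]

theorem taylor_jets {n ℓ : ℕ} (r : ℕ) (A : (i : ℕ) → SymMap n ℓ i)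
    (hA : ∀ i ≤ r, IsSymmMap (A i)) (i : ℕ) (hi : i ≤ r) :
    iteratedFDeriv ℝ i (fun h : Vec n => ∑ j ∈ Finset.range (r+1),
      ((j.factorial : ℝ)⁻¹) • A j (fun _ => h)) 0 = A i := by
  let p : FormalMultilinearSeries ℝ (Vec n) (Vec ℓ) := fun j => if j < r+1 then ((j.factorial : ℝ)⁻¹) • A j else 0
  have hp : HasFiniteFPowerSeriesOnBall (fun h : Vec n => ∑ j ∈ Finset.range (r+1),
      ((j.factorial : ℝ)⁻¹) • A j (fun _ => h)) p 0 (r+1) 1 := by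
    apply HasFiniteFPowerSeriesOnBall.mk' _ (by simp)
    · intro y hy
      simp only [zero_add]
      apply Finset.sum_congr rfl
      intro j hj
      simp only [p, if_pos (Finset.mem_range.1 hj)]
      rfl
    · intro m hm
      have : ¬ m < r + 1 := by omega
      simp only [p, if_neg this]
  ext1 v
  rw [hp.toHasFPowerSeriesOnBall.iteratedFDeriv_eq_sum_of_completeSpace]
  have : ∀ e : Equiv.Perm (Fin i), p i (fun k => v (e k)) = ((i.factorial : ℝ)⁻¹) • A i v := by
    intro e
    have h1 : i < r+1 := by omega
    simp only [p, h1, if_true]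
    rw [← hA i hi e v]; rfl
  rw [Finset.sum_congr rfl (fun e _ => this e), Finset.sum_const, Finset.card_univ, Fintype.card_perm,
    Fintype.card_fin, ← Nat.cast_smul_eq_nsmul ℝ, smul_smul, mul_inv_cancel₀ (by positivity), one_smul]

end

noncomputable section
open Set Filter Topology
open scoped ContDiff

structure SigmaOK (n ℓ r : ℕ) (σ : (i : ℕ) → ℝ × Vec n → SymMap n ℓ i) : Prop where
  cont : ∀ i ≤ r, Continuous (σ i)
  per : ∀ i ≤ r, ∀ (s : ℝ) (m : Fin n → ℤ) (p : Vec n), σ i (s, p + zcast m) = σ i (s, p)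
  sym : ∀ i ≤ r, ∀ (s : ℝ) (p : Vec n), IsSymmMap (σ i (s, p))

/-- `F` has `r`-jet at `x` close to the given one -/
def Good {n ℓ : ℕ} (r : ℕ) (σ : (i : ℕ) → ℝ × Vec n → SymMap n ℓ i) (ε : ℝ)
    (F : Vec n → Vec ℓ) (s : ℝ) (x : Vec n) : Prop :=
  ∀ i ≤ r, ‖iteratedFDeriv ℝ i F x - σ i (s, x)‖ < ε

section
variable {n ℓ r : ℕ} {σ : (i : ℕ) → ℝ × Vec n → SymMap n ℓ i} {ε : ℝ}

theorem Good.congr {F F' : Vec n → Vec ℓ} {s : ℝ} {x : Vec n} (h : Good r σ ε F s x)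
    (he : F' =ᶠ[𝓝 x] F) : Good r σ ε F' s x := by
  intro i hi
  rw [(he.iteratedFDeriv ℝ i).eq_of_nhds]
  exact h i hi

theorem Good.trans (hσ : SigmaOK n ℓ r σ) {F F' : Vec n → Vec ℓ} {s : ℝ} {x : Vec n}
    (m : Fin n → ℤ) (h : Good r σ ε F s x) (he : ∀ y, F' (y + zcast m) = F y) :
    Good r σ ε F' s (x + zcast m) := by
  intro i hi
  rw [hσ.per i hi, ← iteratedFDeriv_comp_add_right]
  have : (fun z => F' (z + zcast m)) = F := funext he
  rw [this]
  exact h i hi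

theorem good_open (hσ : SigmaOK n ℓ r σ) {E Y : Type*} [NormedAddCommGroup E] [NormedSpace ℝ E]
    [TopologicalSpace Y] {f : E × Vec n → Vec ℓ} (hf : ContDiff ℝ ∞ f) {e : Y → E} {s : Y → ℝ}
    {x : Y → Vec n} (he : Continuous e) (hs : Continuous s) (hx : Continuous x) :
    IsOpen {y | Good r σ ε (fun x' => f (e y, x')) (s y) (x y)} := by
  have : {y | Good r σ ε (fun x' => f (e y, x')) (s y) (x y)} =
      ⋂ i ∈ Set.Iic r, {y | ‖iteratedFDeriv ℝ i (fun x' => f (e y, x')) (x y) - σ i (s y, x y)‖ < ε} := by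
    ext y; simp [Good]
  rw [this]
  apply Set.Finite.isOpen_biInter (Set.finite_Iic r)
  intro i hi
  exact isOpen_lt (((cont_iter_comp hf i he hx).sub ((hσ.cont i hi).comp (hs.prodMk hx))).norm)
    continuous_const

/-- translate into the unit cube -/
theorem exists_cube (x : Vec n) : ∃ (y : Vec n) (m : Fin n → ℤ), y ∈ Icc (0 : Vec n) 1 ∧ x = y + zcast m := by
  refine ⟨fun j => Int.fract (x j), fun j => ⌊x j⌋, ⟨fun j => Int.fract_nonneg _,
    fun j => (Int.fract_lt_one _).le⟩, ?_⟩
  funext j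
  simp [zcast, Int.fract_add_floor]

def circ (n : ℕ) (x : Vec n) : Fin n × Bool → ℝ :=
  fun k => if k.2 then Real.cos (2 * Real.pi * x k.1) else Real.sin (2 * Real.pi * x k.1)

theorem circ_smooth : ContDiff ℝ ∞ (circ n) := by
  rw [contDiff_pi]
  rintro ⟨j, b⟩
  cases b
  · simp only [circ, Bool.false_eq_true, if_false]; fun_prop
  · simp only [circ, if_true]; fun_prop

theorem circ_per (x : Vec n) (m : Fin n → ℤ) : circ n (x + zcast m) = circ n x := by
  funext ⟨j, b⟩
  have h : 2 * Real.pi * (x j + (m j : ℝ)) = 2 * Real.pi * x j + m j * (2 * Real.pi) := by ring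
  cases b <;> simp [circ, zcast, h]

theorem circ_inj (x y : Vec n) (h : circ n x = circ n y) : ∃ m, x = y + zcast m := by
  have : ∀ j, ∃ k : ℤ, x j = y j + k := by
    intro j
    have hc := congrFun h (j, true)
    have hs := congrFun h (j, false)
    simp only [circ, if_true, Bool.false_eq_true, if_false] at hc hs
    obtain ⟨k, hk⟩ := Real.Angle.angle_eq_iff_two_pi_dvd_sub.1 (Real.Angle.cos_sin_inj hc hs)
    refine ⟨k, ?_⟩
    have h2 : (2 * Real.pi) ≠ 0 := by positivity
    have : 2 * Real.pi * (x j - y j - k) = 0 := by linarith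
    rcases mul_eq_zero.1 this with h | h
    · exact absurd h h2
    · linarith
  choose m hm using this
  exact ⟨m, funext hm⟩

def chi (h : Vec n) : Vec n := fun k => h k - stair (h k)

theorem chi_smooth : ContDiff ℝ ∞ (chi (n := n)) := by
  rw [contDiff_pi]
  intro k
  have : ContDiff ℝ ∞ (fun h : Vec n => h k) := contDiff_apply ℝ ℝ k
  exact this.sub (stair_smooth.comp this)

theorem stair_add_int (u : ℝ) (m : ℤ) : stair (u + m) = stair u + m := by
  have hp : Function.Periodic (fun u => stair u - u) 1 := by
    intro u; simp only [stair_add_one]; ring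
  have := hp.int_mul m u
  simp only [mul_one] at this
  linarith

theorem chi_per (h : Vec n) (m : Fin n → ℤ) : chi (h + zcast m) = chi h := by
  funext k
  simp [chi, zcast, stair_add_int]

theorem chi_near : ∀ᶠ h : Vec n in 𝓝 0, chi h = h := by
  have : ∀ᶠ h : Vec n in 𝓝 0, ‖h‖ < 3/8 := by
    have := (continuous_norm (E := Vec n)).tendsto 0
    simp only [norm_zero] at this
    exact this.eventually (gt_mem_nhds (by norm_num))
  filter_upwards [this] with h hh
  funext k
  have h1 := stair_int 0 (h k) (by
    have := norm_le_pi_norm h k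
    rw [Real.norm_eq_abs] at this
    simp; linarith)
  simp [chi, h1]

def QQ (r : ℕ) (σ : (i : ℕ) → ℝ × Vec n → SymMap n ℓ i) (a : ℝ × Vec n) (x : Vec n) : Vec ℓ :=
  ∑ j ∈ Finset.range (r+1), ((j.factorial : ℝ)⁻¹) • σ j a (fun _ => chi (x - a.2))

theorem QQ_smooth (a : ℝ × Vec n) : ContDiff ℝ ∞ (QQ r σ a) := by
  unfold QQ
  apply ContDiff.sum
  intro j _
  apply ContDiff.const_smul
  apply (σ j a).contDiff.comp
  rw [contDiff_pi]
  intro _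
  exact chi_smooth.comp (by fun_prop)

theorem QQ_per (a : ℝ × Vec n) (x : Vec n) (m : Fin n → ℤ) : QQ r σ a (x + zcast m) = QQ r σ a x := by
  unfold QQ
  rw [add_sub_right_comm, chi_per]

theorem QQ_good (hσ : SigmaOK n ℓ r σ) (hε : 0 < ε) (a : ℝ × Vec n) : Good r σ ε (QQ r σ a) a.1 a.2 := by
  intro i hi
  have h1 : iteratedFDeriv ℝ i (QQ r σ a) a.2 = σ i a := by
    have e1 : QQ r σ a = fun x => (fun h => ∑ j ∈ Finset.range (r+1), ((j.factorial : ℝ)⁻¹) • σ j a (fun _ => chi h)) (x - a.2) := by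
      funext x; rfl
    rw [e1, iteratedFDeriv_comp_sub (f := fun h => ∑ j ∈ Finset.range (r+1), ((j.factorial : ℝ)⁻¹) • σ j a (fun _ => chi h)), sub_self]
    have e2 : (fun h => ∑ j ∈ Finset.range (r+1), ((j.factorial : ℝ)⁻¹) • σ j a (fun _ => chi h)) =ᶠ[𝓝 0]
      (fun h => ∑ j ∈ Finset.range (r+1), ((j.factorial : ℝ)⁻¹) • σ j a (fun _ => h)) := by
      filter_upwards [chi_near] with h hh
      rw [hh]
    rw [(e2.iteratedFDeriv ℝ i).eq_of_nhds]
    exact taylor_jets r (fun j => σ j a) (fun i hi => hσ.sym i hi a.1 a.2) i hi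
  rw [h1]
  simpa using hε

theorem QQ_open (hσ : SigmaOK n ℓ r σ) (a : ℝ × Vec n) :
    IsOpen {b : ℝ × (Fin n × Bool → ℝ) | ∀ x ∈ Icc (0 : Vec n) 1, circ n x = b.2 → Good r σ ε (QQ r σ a) b.1 x} := by
  rw [isOpen_iff_eventually]
  intro b hb
  apply isCompact_Icc.eventually_forall_of_forall_eventually
    (P := fun (b : ℝ × (Fin n × Bool → ℝ)) x => circ n x = b.2 → Good r σ ε (QQ r σ a) b.1 x)
  intro x hx
  have h1 : IsOpen {z : (ℝ × (Fin n × Bool → ℝ)) × Vec n | circ n z.2 ≠ z.1.2} :=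
    isOpen_ne_fun (circ_smooth.continuous.comp continuous_snd) (by fun_prop)
  have h2 : IsOpen {z : (ℝ × (Fin n × Bool → ℝ)) × Vec n | Good r σ ε (QQ r σ a) z.1.1 z.2} := by
    have := good_open hσ (ε := ε) (E := ℝ) (Y := (ℝ × (Fin n × Bool → ℝ)) × Vec n) (f := fun q => QQ r σ a q.2)
      ((QQ_smooth a).comp contDiff_snd) (e := fun _ => 0) (s := fun z => z.1.1) (x := fun z => z.2) (by fun_prop) (by fun_prop) (by fun_prop)
    exact this
  have h3 := (h1.union h2).mem_nhds (x := (b, x)) (by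
    by_cases h : circ n x = b.2
    · exact Or.inr (hb x hx h)
    · exact Or.inl h)
  filter_upwards [h3] with z hz he
  rcases hz with hz | hz
  · exact absurd he hz
  · exact hz

theorem pu (hσ : SigmaOK n ℓ r σ) (hε : 0 < ε) :
    ∃ F : (ℝ × (Fin n × Bool → ℝ)) × Vec n → Vec ℓ, ContDiff ℝ ∞ F ∧
      (∀ b x m, F (b, x + zcast m) = F (b, x)) ∧
      ∀ s x, Good r σ ε (fun x' => F ((s, circ n x), x')) s x := by
  obtain ⟨f, hf⟩ := SmoothPartitionOfUnity.exists_isSubordinate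
    (modelWithCornersSelf ℝ (ℝ × (Fin n × Bool → ℝ))) (s := univ) isClosed_univ
    (fun a : ℝ × Vec n => {b : ℝ × (Fin n × Bool → ℝ) | ∀ x ∈ Icc (0 : Vec n) 1, circ n x = b.2 → Good r σ ε (QQ r σ a) b.1 x})
    (fun a => QQ_open hσ a)
    (by
      rintro ⟨s, β⟩ -
      rw [mem_iUnion]
      by_cases h : ∃ x0 : Vec n, circ n x0 = β
      · obtain ⟨x0, rfl⟩ := h
        refine ⟨(s, x0), fun x hx he => ?_⟩
        obtain ⟨m, rfl⟩ := circ_inj _ _ he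
        exact (QQ_good hσ hε (s, x0)).trans hσ m (fun y => QQ_per _ _ _)
      · exact ⟨(s, 0), fun x hx he => absurd ⟨x, he⟩ h⟩)
  have hfs : ∀ a, ContDiff ℝ ∞ (f a) := fun a => (f a).contMDiff.contDiff
  have hloc : ∀ b, ∃ S : Finset (ℝ × Vec n), ∀ x, 
      (fun x => ∑ᶠ a, f a b • QQ r σ a x) x = ∑ a ∈ S, f a b • QQ r σ a x := by
    intro b
    refine ⟨f.finsupport b, fun x => ?_⟩
    apply finsum_eq_sum_of_support_subset
    intro a ha
    rw [SmoothPartitionOfUnity.coe_finsupport]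
    intro h
    apply ha
    simp [h]
  refine ⟨fun q => ∑ᶠ a, f a q.1 • QQ r σ a q.2, ?_, ?_, ?_⟩
  · rw [← contMDiff_iff_contDiff]
    apply contMDiff_finsum
    · intro a
      rw [contMDiff_iff_contDiff]
      exact ((hfs a).comp contDiff_fst).smul ((QQ_smooth a).comp contDiff_snd)
    · have := f.locallyFinite.preimage_continuous (continuous_fst (X := ℝ × (Fin n × Bool → ℝ)) (Y := Vec n))
      refine this.subset (fun a q hq => ?_)
      intro h
      apply hq
      simp only [h, zero_smul]
  · intro b x m
    simp only [QQ_per]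
  · have hcube : ∀ s, ∀ x ∈ Icc (0 : Vec n) 1, Good r σ ε (fun x' => ∑ᶠ a, f a (s, circ n x) • QQ r σ a x') s x := by
      intro s x hx i hi
      have e1 : (fun x' => ∑ᶠ a, f a (s, circ n x) • QQ r σ a x') =
          fun x' => ∑ a ∈ f.finsupport (s, circ n x), f a (s, circ n x) • QQ r σ a x' := by
        funext x'
        apply finsum_eq_sum_of_support_subset
        intro a ha
        rw [SmoothPartitionOfUnity.coe_finsupport]
        intro h
        apply ha
        simp [h]
      have e2 : iteratedFDeriv ℝ i (fun x' => ∑ a ∈ f.finsupport (s, circ n x), f a (s, circ n x) • QQ r σ a x') x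
        = ∑ a ∈ f.finsupport (s, circ n x), f a (s, circ n x) • iteratedFDeriv ℝ i (QQ r σ a) x := by
        have hs : ∀ a, ContDiff ℝ i (fun x' => f a (s, circ n x) • QQ r σ a x') :=
          fun a => ((QQ_smooth a).of_le (by exact_mod_cast le_top)).const_smul _
        rw [iteratedFDeriv_fun_sum_apply (fun a _ => (hs a).contDiffAt)]
        apply Finset.sum_congr rfl
        intro a _
        exact iteratedFDeriv_const_smul_apply' (((QQ_smooth a).of_le (by exact_mod_cast le_top)).contDiffAt)
      rw [e1, e2]
      have := (convex_ball (σ i (s, x)) ε).sum_mem (t := f.finsupport (s, circ n x))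
        (w := fun a => f a (s, circ n x)) (z := fun a => iteratedFDeriv ℝ i (QQ r σ a) x)
        (fun a _ => f.nonneg _ _) (f.sum_finsupport _ (mem_univ _)) (fun a ha => by
          rw [mem_ball_iff_norm]
          have h1 : (s, circ n x) ∈ tsupport (f a) := by
            apply subset_tsupport
            rw [SmoothPartitionOfUnity.mem_finsupport] at ha
            exact ha
          exact hf a h1 x hx rfl i hi)
      rwa [mem_ball_iff_norm] at this
    intro s x
    obtain ⟨y, m, hy, rfl⟩ := exists_cube x
    rw [circ_per]
    refine (hcube s y hy).trans hσ m (fun z => ?_)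
    simp only [QQ_per]

end
end

noncomputable section
open Set Filter Topology
open scoped ContDiff

structure Fam {n ℓ : ℕ} (r : ℕ) (σ : (i : ℕ) → ℝ × Vec n → SymMap n ℓ i) (ε : ℝ) (o : Fin n)
    (k : ℕ) (τ : Fin k → Vec n → ℝ) (F : (ℝ × (Fin k → ℝ) × ℝ) × Vec n → Vec ℓ)
    (W : ℝ × Vec n → ℝ) : Prop where
  smF : ContDiff ℝ ∞ F
  smW : ContDiff ℝ ∞ W
  perW : ∀ s x m, W (s, x + zcast m) = W (s, x)
  indW : ∀ s (x y : Vec n), (∀ j, j ≠ o → x j = y j) → W (s, x) = W (s, y)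
  perF : ∀ s β c x (m : Fin n → ℤ), F ((s, β, c + (m o : ℝ)), x + zcast m) = F ((s, β, c), x)
  good : ∀ s (x : Vec n), Good r σ ε (fun x' => F ((s, fun k => τ k x, x o - W (s, x)), x')) s x

theorem near_int_of_cos {v : ℝ} (h : -(1/2) ≤ Real.cos (2 * Real.pi * v)) : ∃ m : ℤ, |v - m| ≤ 1/3 := by
  refine ⟨round v, ?_⟩
  by_contra hc
  push Not at hc
  have h1 : |v - round v| ≤ 1/2 := abs_sub_round v
  have h2 : Real.cos (2 * Real.pi * v) = Real.cos (2 * Real.pi * |v - round v|) := by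
    have : 2 * Real.pi * |v - round v| = |2 * Real.pi * v - (round v : ℤ) * (2 * Real.pi)| := by
      rw [← abs_of_pos (show 0 < 2 * Real.pi by positivity), ← abs_mul,
        abs_of_pos (show 0 < 2 * Real.pi by positivity)]
      congr 1; ring
    rw [this, Real.cos_abs, Real.cos_sub_int_mul_two_pi]
  have hpi := Real.pi_pos
  have h3 : Real.cos (2 * Real.pi * |v - round v|) < Real.cos (Real.pi - Real.pi / 3) := by
    apply Real.cos_lt_cos_of_nonneg_of_le_pi
    · linarith
    · nlinarith
    · nlinarith
  rw [Real.cos_pi_sub, Real.cos_pi_div_three] at h3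
  linarith

def SS (y : ℝ) : ℝ := Real.smoothTransition (y + 1/2)
theorem SS_smooth : ContDiff ℝ ∞ SS := Real.smoothTransition.contDiff.comp (by fun_prop)
theorem SS_one {y : ℝ} (h : 1/2 ≤ y) : SS y = 1 := Real.smoothTransition.one_of_one_le (by linarith)
theorem SS_zero {y : ℝ} (h : y ≤ -(1/2)) : SS y = 0 := Real.smoothTransition.zero_of_nonpos (by linarith)

/-- the core local form of the staircase interpolation -/
theorem core (N : ℝ) (hN : 0 < N) {Z : Type*} [TopologicalSpace Z] (Y t : Z → ℝ) (hY : Continuous Y)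
    (ht : Continuous t) (x : Z) (hx : Y x = Real.cos (2 * Real.pi * (N * t x))) :
    ∃ t0 μ : ℝ, |t0 - t x| ≤ 1 / N ∧ |μ| ≤ 1 / N ∧ ∀ᶠ x' in 𝓝 x,
      1 / N * ((1 - SS (Y x')) * (stair (N * t x' - 1/2) + 1/2) + SS (Y x') * stair (N * t x')) =
        t0 + μ * SS (Y x') := by
  have hB : -(1/2) ≤ Y x → ∃ m : ℤ, |N * t x - m| ≤ 1/3 ∧ ∀ᶠ x' in 𝓝 x, stair (N * t x') = m := by
    intro h
    rw [hx] at h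
    obtain ⟨m, hm⟩ := near_int_of_cos h
    refine ⟨m, hm, ?_⟩
    have hc : Continuous (fun x' => |N * t x' - m|) := by fun_prop
    have := hc.continuousAt.eventually (gt_mem_nhds (show |N * t x - m| < 3/8 by linarith))
    filter_upwards [this] with x' hx'
    exact stair_int m _ hx'.le
  have hA : Y x ≤ 1/2 → ∃ m : ℤ, |N * t x - 1/2 - m| ≤ 1/3 ∧ ∀ᶠ x' in 𝓝 x, stair (N * t x' - 1/2) = m := by
    intro h
    rw [hx] at h
    obtain ⟨m, hm⟩ := near_int_of_cos (v := N * t x - 1/2) (by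
      have : 2 * Real.pi * (N * t x - 1/2) = 2 * Real.pi * (N * t x) - Real.pi := by ring
      rw [this, Real.cos_sub_pi]; linarith)
    refine ⟨m, hm, ?_⟩
    have hc : Continuous (fun x' => |N * t x' - 1/2 - m|) := by fun_prop
    have := hc.continuousAt.eventually (gt_mem_nhds (show |N * t x - 1/2 - m| < 3/8 by linarith))
    filter_upwards [this] with x' hx'
    exact stair_int m _ hx'.le
  have hdiv : ∀ c : ℝ, |c - N * t x| ≤ 1 → |c / N - t x| ≤ 1 / N := by
    intro c hc
    have : c / N - t x = (c - N * t x) / N := by field_simp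
    rw [this, abs_div, abs_of_pos hN]
    gcongr
  rcases lt_or_ge (1/2) (Y x) with h1 | h1
  · obtain ⟨m, hm, hs⟩ := hB (by linarith)
    refine ⟨m / N, 0, hdiv _ (by rw [abs_sub_comm]; linarith), by simp; positivity, ?_⟩
    filter_upwards [hs, hY.continuousAt.eventually (lt_mem_nhds h1)] with x' e1 e2
    rw [e1, SS_one e2.le]; ring
  rcases lt_or_ge (Y x) (-(1/2)) with h2 | h2
  · obtain ⟨m, hm, hs⟩ := hA (by linarith)
    refine ⟨(m + 1/2) / N, 0, hdiv _ ?_, by simp; positivity, ?_⟩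
    · rw [abs_le] at hm ⊢; constructor <;> linarith [hm.1, hm.2]
    filter_upwards [hs, hY.continuousAt.eventually (gt_mem_nhds h2)] with x' e1 e2
    rw [e1, SS_zero e2.le]; ring
  · obtain ⟨m, hm, hs⟩ := hA h1
    obtain ⟨m', hm', hs'⟩ := hB h2
    refine ⟨(m + 1/2) / N, (m' - (m + 1/2)) / N, hdiv _ ?_, ?_, ?_⟩
    · rw [abs_le] at hm ⊢; constructor <;> linarith [hm.1, hm.2]
    · rw [abs_div, abs_of_pos hN]
      gcongr
      rw [abs_le] at hm hm' ⊢
      constructor <;> linarith [hm.1, hm.2, hm'.1, hm'.2]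
    filter_upwards [hs, hs'] with x' e1 e2
    rw [e1, e2]; ring

theorem contDiff_cons {E : Type*} [NormedAddCommGroup E] [NormedSpace ℝ E] {k : ℕ} {a : E → ℝ} {b : E → Fin k → ℝ}
    (ha : ContDiff ℝ ∞ a) (hb : ContDiff ℝ ∞ b) :
    ContDiff ℝ ∞ (fun e => (Fin.cons (a e) (b e) : Fin (k+1) → ℝ)) := by
  rw [contDiff_pi]
  intro i
  refine Fin.cases ?_ (fun i => ?_) i
  · simpa using ha
  · simp only [Fin.cons_succ]
    exact (contDiff_pi.1 hb) i

theorem em_step {n ℓ r : ℕ} {σ : (i : ℕ) → ℝ × Vec n → SymMap n ℓ i} {ε : ℝ} {o : Fin n}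
    (hσ : SigmaOK n ℓ r σ) {k : ℕ} {τ : Fin (k+1) → Vec n → ℝ}
    (hτ : ∀ k, ContDiff ℝ ∞ (τ k)) (hτp : ∀ k x m, τ k (x + zcast m) = τ k x)
    (hτi : ∀ k (x y : Vec n), (∀ j, j ≠ o → x j = y j) → τ k x = τ k y)
    {F : (ℝ × (Fin (k+1) → ℝ) × ℝ) × Vec n → Vec ℓ} {W : ℝ × Vec n → ℝ} (H : Fam r σ ε o (k+1) τ F W)
    (η : ℝ → ℝ) (hη : Continuous η) (hη0 : ∀ s, 0 < η s) :
    ∃ F' W', Fam r σ ε o k (fun i => τ i.succ) F' W' ∧ ∀ s x, |W' (s, x) - W (s, x)| < η s := by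
  have hτc : Continuous (fun x : Vec n => fun k => τ k x) := continuous_pi (fun k => (hτ k).continuous)
  have hWc := H.smW.continuous
  -- slab thickness
  obtain ⟨a, ha, ha01, haO⟩ := tube (Y := Vec n) (P := ℝ) (C := Icc 0 1) isCompact_Icc
    (O := {q | Good r σ ε (fun x' => F ((q.1, fun k => τ k q.2.1, q.2.1 o - W (q.1, q.2.1) - q.2.2), x')) q.1 q.2.1}
      ∩ {q | |q.2.2| < η q.1})
    ((good_open hσ H.smF (e := fun q : ℝ × Vec n × ℝ => (q.1, fun k => τ k q.2.1, q.2.1 o - W (q.1, q.2.1) - q.2.2))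
      (s := fun q => q.1) (x := fun q => q.2.1) (by fun_prop) (by fun_prop) (by fun_prop)).inter
      (isOpen_lt (by fun_prop) (by fun_prop)))
    (by
      intro s y hy
      refine ⟨?_, by simpa using hη0 s⟩
      have := H.good s y
      simpa using this)
  have haη : ∀ s, a s < η s := by
    intro s
    have := (haO s 0 ⟨le_rfl, zero_le_one⟩ (a s) (by rw [Real.norm_eq_abs, abs_of_pos (ha01 s).1])).2
    simpa [abs_of_pos (ha01 s).1] using this
  -- the frozen family
  let f : (ℝ × ℝ × ℝ × (Fin k → ℝ) × ℝ) × Vec n → Vec ℓ := fun q =>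
    F ((q.1.1, Fin.cons (q.1.2.1 + q.1.2.2.1 * SS ((q.2 o - W (q.1.1, q.2) - q.1.2.2.2.2) / a q.1.1)) q.1.2.2.2.1,
      q.1.2.2.2.2), q.2)
  have ho : ContDiff ℝ ∞ (fun x : Vec n => x o) := contDiff_apply ℝ ℝ o
  have hf : ContDiff ℝ ∞ f := by
    apply H.smF.comp
    refine ContDiff.prodMk ?_ contDiff_snd
    refine ContDiff.prodMk (by fun_prop) (ContDiff.prodMk ?_ (by fun_prop))
    apply contDiff_cons
    · refine ContDiff.add (by fun_prop) (ContDiff.mul (by fun_prop) (SS_smooth.comp ?_))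
      refine ContDiff.div ?_ (ha.comp (by fun_prop)) (fun q => (ha01 _).1.ne')
      exact ((ho.comp contDiff_snd).sub (H.smW.comp (by fun_prop))).sub (by fun_prop)
    · fun_prop
  obtain ⟨ν, hν, hν01, hνO⟩ := tube (Y := Vec n × ℝ) (P := ℝ × ℝ) (C := Icc 0 1 ×ˢ Icc (-1) 1)
    (isCompact_Icc.prod isCompact_Icc)
    (O := {q | Good r σ ε (fun x' => f ((q.1, τ 0 q.2.1.1 + q.2.2.1, q.2.2.2, (fun k => τ k.succ q.2.1.1),
      q.2.1.1 o - W (q.1, q.2.1.1) - a q.1 * q.2.1.2), x')) q.1 q.2.1.1})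
    (good_open hσ hf (e := fun q : ℝ × (Vec n × ℝ) × (ℝ × ℝ) => (q.1, τ 0 q.2.1.1 + q.2.2.1, q.2.2.2, (fun k => τ k.succ q.2.1.1),
      q.2.1.1 o - W (q.1, q.2.1.1) - a q.1 * q.2.1.2))
      (s := fun q => q.1) (x := fun q => q.2.1.1) (by
        have := ha.continuous
        have h0 := (hτ 0).continuous
        have hc : Continuous (fun x : Vec n => fun k : Fin k => τ k.succ x) := continuous_pi (fun k => (hτ _).continuous)
        fun_prop) (by fun_prop) (by fun_prop))
    (by
      rintro s ⟨y, v⟩ ⟨hy, hv⟩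
      have := (haO s y hy (a s * v) (by
        rw [Real.norm_eq_abs, abs_mul, abs_of_pos (ha01 s).1]
        have : |v| ≤ 1 := abs_le.2 hv
        nlinarith [(ha01 s).1])).1
      simp only [mem_ofPred_eq, f, Prod.fst_zero, Prod.snd_zero, zero_mul, add_zero] at this ⊢
      have e : (Fin.cons (τ 0 y) (fun k : Fin k => τ k.succ y) : Fin (k+1) → ℝ) = fun k => τ k y := by
        funext i
        refine Fin.cases ?_ (fun i => ?_) i <;> simp
      rw [e]
      exact this)
  -- goodness for all x
  have hG : ∀ s x (v t0 μ : ℝ), |v| ≤ 1 → |t0 - τ 0 x| ≤ ν s → |μ| ≤ ν s →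
      Good r σ ε (fun x' => f ((s, t0, μ, (fun k => τ k.succ x), x o - W (s, x) - a s * v), x')) s x := by
    intro s x v t0 μ hv ht hm
    obtain ⟨y, m, hy, rfl⟩ := exists_cube x
    rw [hτp] at ht
    have h1 := hνO s (y, v) ⟨hy, abs_le.1 hv⟩ (t0 - τ 0 y, μ) (by
      rw [Prod.norm_def]; exact max_le ht hm)
    refine Good.trans hσ m h1 (fun z => ?_)
    simp only [f, hτp, H.perW]
    have e1 : (y + zcast m) o - W (s, y) - a s * v = (y o - W (s, y) - a s * v) + m o := by
      simp [zcast]; ring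
    rw [e1, H.perF]
    have e2 : (z + zcast m) o = z o + m o := by simp [zcast]
    have e3 : (z + zcast m) o - W (s, z) - (y o - W (s, y) - a s * v + m o) =
        z o - W (s, z) - (y o - W (s, y) - a s * v) := by rw [e2]; ring
    have e4 : τ 0 y + (t0 - τ 0 y) = t0 := by ring
    rw [e3, e4]
  let T : (ℝ × ℝ) × Vec n → ℝ := fun q =>
    1 / (1 / ν q.1.1) * ((1 - SS ((q.2 o - W (q.1.1, q.2) - q.1.2) / a q.1.1)) * (stair (1 / ν q.1.1 * τ 0 q.2 - 1/2) + 1/2)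
      + SS ((q.2 o - W (q.1.1, q.2) - q.1.2) / a q.1.1) * stair (1 / ν q.1.1 * τ 0 q.2))
  have hT : ContDiff ℝ ∞ T := by
    have e0 : ContDiff ℝ ∞ (fun q : (ℝ × ℝ) × Vec n => ν q.1.1) := hν.comp (by fun_prop)
    have e1 : ContDiff ℝ ∞ (fun q : (ℝ × ℝ) × Vec n => 1 / ν q.1.1) :=
      contDiff_const.div e0 (fun q => (hν01 _).1.ne')
    have e2 : ContDiff ℝ ∞ (fun q : (ℝ × ℝ) × Vec n => SS ((q.2 o - W (q.1.1, q.2) - q.1.2) / a q.1.1)) := by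
      refine SS_smooth.comp (ContDiff.div ?_ (ha.comp (by fun_prop)) (fun q => (ha01 _).1.ne'))
      exact ((ho.comp contDiff_snd).sub (H.smW.comp (by fun_prop))).sub (by fun_prop)
    have e3 : ContDiff ℝ ∞ (fun q : (ℝ × ℝ) × Vec n => 1 / ν q.1.1 * τ 0 q.2) := e1.mul ((hτ 0).comp contDiff_snd)
    refine ContDiff.mul (contDiff_const.div e1 (fun q => ?_)) ?_
    · have := (hν01 q.1.1).1; positivity
    · exact ((contDiff_const.sub e2).mul ((stair_smooth.comp (e3.sub contDiff_const)).add contDiff_const)).add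
        (e2.mul (stair_smooth.comp e3))
  refine ⟨fun q => F ((q.1.1, Fin.cons (T ((q.1.1, q.1.2.2), q.2)) q.1.2.1, q.1.2.2), q.2),
    fun q => W q + a q.1 * Real.cos (2 * Real.pi * (1 / ν q.1 * τ 0 q.2)), ⟨?_, ?_, ?_, ?_, ?_, ?_⟩, ?_⟩
  · apply H.smF.comp
    refine ContDiff.prodMk (ContDiff.prodMk (by fun_prop) (ContDiff.prodMk ?_ (by fun_prop))) contDiff_snd
    exact contDiff_cons (hT.comp (by fun_prop)) (by fun_prop)
  · refine H.smW.add (ContDiff.mul (ha.comp (by fun_prop)) (Real.contDiff_cos.comp (contDiff_const.mul ?_)))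
    exact (contDiff_const.div (hν.comp (by fun_prop)) (fun q => (hν01 _).1.ne')).mul ((hτ 0).comp contDiff_snd)
  · intro s x m
    simp only [H.perW, hτp]
  · intro s x y h
    simp only [H.indW s x y h, hτi 0 x y h]
  · intro s β c x m
    simp only [H.perF]
    congr 4
    have e2 : (x + zcast m) o = x o + m o := by simp [zcast]
    simp only [T, H.perW, hτp, e2]
    have : x o + (m o : ℝ) - W (s, x) - (c + m o) = x o - W (s, x) - c := by ring
    rw [this]
  · intro s x
    set c := x o - (W (s, x) + a s * Real.cos (2 * Real.pi * (1 / ν s * τ 0 x))) with hc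
    have hNpos : 0 < 1 / ν s := by have := (hν01 s).1; positivity
    have hapos := (ha01 s).1
    obtain ⟨t0, μ, h1, h2, h3⟩ := core (1 / ν s) hNpos (Z := Vec n)
      (fun x' => (x' o - W (s, x') - c) / a s) (τ 0) (by fun_prop) (hτ 0).continuous x (by
        simp only [hc]
        rw [div_eq_iff hapos.ne']; ring)
    rw [one_div_one_div] at h1 h2
    have h4 := hG s x (Real.cos (2 * Real.pi * (1 / ν s * τ 0 x))) t0 μ (Real.abs_cos_le_one _) h1 h2
    have hc' : x o - W (s, x) - a s * Real.cos (2 * Real.pi * (1 / ν s * τ 0 x)) = c := by rw [hc]; ring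
    rw [hc'] at h4
    refine h4.congr ?_
    filter_upwards [h3] with x' hx'
    simp only [f, T, hx']
  · intro s x
    have : W (s, x) + a s * Real.cos (2 * Real.pi * (1 / ν s * τ 0 x)) - W (s, x) =
      a s * Real.cos (2 * Real.pi * (1 / ν s * τ 0 x)) := by ring
    simp only [this]
    rw [abs_mul, abs_of_pos (ha01 s).1]
    have := Real.abs_cos_le_one (2 * Real.pi * (1 / ν s * τ 0 x))
    have := haη s
    nlinarith [(ha01 s).1]

theorem em_ind {n ℓ r : ℕ} {σ : (i : ℕ) → ℝ × Vec n → SymMap n ℓ i} {ε : ℝ} {o : Fin n}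
    (hσ : SigmaOK n ℓ r σ) (k : ℕ) : ∀ (τ : Fin k → Vec n → ℝ)
    (_ : ∀ k, ContDiff ℝ ∞ (τ k)) (_ : ∀ k x m, τ k (x + zcast m) = τ k x)
    (_ : ∀ k (x y : Vec n), (∀ j, j ≠ o → x j = y j) → τ k x = τ k y)
    (F : (ℝ × (Fin k → ℝ) × ℝ) × Vec n → Vec ℓ) (W : ℝ × Vec n → ℝ) (_ : Fam r σ ε o k τ F W)
    (η : ℝ → ℝ) (_ : Continuous η) (_ : ∀ s, 0 < η s),
    ∃ τ' F' W', Fam r σ ε o 0 τ' F' W' ∧ ∀ s x, |W' (s, x) - W (s, x)| < η s := by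
  induction k with
  | zero =>
    intro τ _ _ _ F W H η _ hη
    exact ⟨τ, F, W, H, fun s x => by simpa using hη s⟩
  | succ k ih =>
    intro τ h1 h2 h3 F W H η h4 h5
    obtain ⟨F1, W1, H1, hW1⟩ := em_step hσ h1 h2 h3 H (fun s => η s / 2) (by fun_prop) (fun s => by have := h5 s; positivity)
    obtain ⟨τ', F', W', H', hW'⟩ := ih _ (fun k => h1 _) (fun k => h2 _) (fun k => h3 _) F1 W1 H1 (fun s => η s / 2) (by fun_prop) (fun s => by have := h5 s; positivity)
    refine ⟨τ', F', W', H', fun s x => ?_⟩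
    have e1 := hW1 s x
    have e2 := hW' s x
    have : W' (s, x) - W (s, x) = (W' (s, x) - W1 (s, x)) + (W1 (s, x) - W (s, x)) := by ring
    rw [this]
    refine (abs_add_le _ _).trans_lt ?_
    linarith

/-- one-directional multi-section family -/
theorem multi {n ℓ r : ℕ} {σ : (i : ℕ) → ℝ × Vec n → SymMap n ℓ i} {ε : ℝ} (o : Fin n)
    (hσ : SigmaOK n ℓ r σ) (hε : 0 < ε) (η : ℝ → ℝ) (hη : Continuous η) (hη0 : ∀ s, 0 < η s) :
    ∃ (F : (ℝ × ℝ) × Vec n → Vec ℓ) (W : ℝ × Vec n → ℝ), ContDiff ℝ ∞ F ∧ ContDiff ℝ ∞ W ∧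
      (∀ s x m, W (s, x + zcast m) = W (s, x)) ∧
      (∀ s (x y : Vec n), (∀ j, j ≠ o → x j = y j) → W (s, x) = W (s, y)) ∧
      (∀ s c x (m : Fin n → ℤ), F ((s, c + (m o : ℝ)), x + zcast m) = F ((s, c), x)) ∧
      (∀ s (x : Vec n), Good r σ ε (fun x' => F ((s, x o - W (s, x)), x')) s x) ∧
      (∀ s x, |W (s, x)| < η s) := by
  obtain ⟨F0, hF0, hp0, hg0⟩ := pu hσ hε
  obtain ⟨K, ⟨e⟩⟩ : ∃ K, Nonempty ((Fin n × Bool) ≃ Fin K) := ⟨_, ⟨Fintype.equivFin _⟩⟩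
  let τ : Fin K → Vec n → ℝ := fun i x => if (e.symm i).1 = o then 0 else circ n x (e.symm i)
  have hoc : ∀ (c : ℝ) (m : ℤ) (i : Fin n × Bool), circ n (fun _ => c + m) i = circ n (fun _ => c) i := by
    intro c m i
    have : (fun _ : Fin n => c + (m : ℝ)) = (fun _ => c) + zcast (fun _ => m) := by funext j; simp [zcast]
    rw [this, circ_per]
  let B : (Fin K → ℝ) × ℝ → (Fin n × Bool) → ℝ := fun q i => if i.1 = o then circ n (fun _ => q.2) i else q.1 (e i)
  have hB : ContDiff ℝ ∞ B := by
    rw [contDiff_pi]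
    intro i
    by_cases h : i.1 = o
    · simp only [B, h, if_true]
      have h1 : ContDiff ℝ ∞ (fun x : Vec n => circ n x i) := contDiff_pi.1 (circ_smooth (n := n)) i
      have h2 : ContDiff ℝ ∞ (fun q : (Fin K → ℝ) × ℝ => (fun _ : Fin n => q.2)) :=
        contDiff_pi.2 (fun _ => contDiff_snd)
      have h3 := ContDiff.comp (𝕜 := ℝ) (E := (Fin K → ℝ) × ℝ) (F := Vec n) (G := ℝ) (g := fun x : Vec n => circ n x i) h1 h2
      exact h3
    · simp only [B, h, if_false]
      exact (contDiff_apply ℝ ℝ (e i)).comp contDiff_fst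
  have hfam : Fam r σ ε o (K) τ (fun q => F0 ((q.1.1, B (q.1.2.1, q.1.2.2)), q.2)) (fun _ => 0) := by
    refine ⟨?_, contDiff_const, fun _ _ _ => rfl, fun _ _ _ _ => rfl, ?_, ?_⟩
    · exact hF0.comp (by fun_prop)
    · intro s β c x m
      simp only [hp0]
      have : B (β, c + (m o : ℝ)) = B (β, c) := by
        funext i
        simp only [B, hoc]
      rw [this]
    · intro s x
      have : B (fun k => τ k x, x o - 0) = circ n x := by
        funext i
        by_cases h : i.1 = o
        · simp only [B, h, if_true, sub_zero]
          simp only [circ, h]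
        · simp only [B, h, if_false, τ, Equiv.symm_apply_apply]
      simp only [this]
      exact hg0 s x
  obtain ⟨τ', F', W', H', hW'⟩ := em_ind hσ _ τ
    (fun i => by
      by_cases h : (e.symm i).1 = o
      · simp only [τ, h, if_true]; exact contDiff_const
      · simp only [τ, h, if_false]; exact contDiff_pi.1 (circ_smooth (n := n)) _)
    (fun i x m => by simp only [τ, circ_per])
    (fun i x y h => by
      by_cases h' : (e.symm i).1 = o
      · simp only [τ, h', if_true]
      · simp only [τ, h', if_false, circ, h _ h'])
    _ _ hfam η hη hη0
  refine ⟨fun q => F' ((q.1.1, Fin.elim0, q.1.2), q.2), W', ?_, H'.smW, H'.perW, H'.indW, ?_, ?_, ?_⟩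
  · exact H'.smF.comp (by fun_prop)
  · intro s c x m; exact H'.perF s _ c x m
  · intro s x
    have := H'.good s x
    have e : (fun k => τ' k x) = Fin.elim0 := Subsingleton.elim _ _
    rw [e] at this
    exact this
  · intro s x; simpa using hW' s x

end

noncomputable section
open Set Filter Topology
open scoped ContDiff

theorem smooth_iter_apply {E V F : Type*} [NormedAddCommGroup E] [NormedSpace ℝ E]
    [NormedAddCommGroup V] [NormedSpace ℝ V]
    [NormedAddCommGroup F] [NormedSpace ℝ F] {f : E × V → F} (hf : ContDiff ℝ ∞ f) (i : ℕ) (w : Fin i → V) :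
    ContDiff ℝ ∞ (fun q : E × V => iteratedFDeriv ℝ i (fun x' => f (q.1, x')) q.2 w) :=
  (ContinuousMultilinearMap.apply ℝ (fun _ : Fin i => V) F w).contDiff.comp (smooth_iter hf i)

theorem fderiv_slice {E V F : Type*} [NormedAddCommGroup E] [NormedSpace ℝ E]
    [NormedAddCommGroup V] [NormedSpace ℝ V]
    [NormedAddCommGroup F] [NormedSpace ℝ F] {φ : E × V → F} {t : E} {x : V} (hφ : DifferentiableAt ℝ φ (t, x))
    (a : V) : fderiv ℝ (fun x' => φ (t, x')) x a = fderiv ℝ φ (t, x) (0, a) := by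
  have h := hφ.hasFDerivAt.comp x (hasFDerivAt_prodMk_right t x)
  have h' : fderiv ℝ (fun x' => φ (t, x')) x = _ := h.fderiv
  rw [h']; simp

theorem deriv_slice {V F : Type*} [NormedAddCommGroup V] [NormedSpace ℝ V]
    [NormedAddCommGroup F] [NormedSpace ℝ F] {φ : ℝ × V → F} {t : ℝ} {x : V} (hφ : DifferentiableAt ℝ φ (t, x)) :
    HasDerivAt (fun t' => φ (t', x)) (fderiv ℝ φ (t, x) (1, 0)) t := by
  have h : HasFDerivAt (fun t' => φ (t', x)) _ t := hφ.hasFDerivAt.comp t (hasFDerivAt_prodMk_left t x)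
  have := h.hasDerivAt
  simpa using this

theorem iter_comm {V F : Type*} [NormedAddCommGroup V] [NormedSpace ℝ V]
    [NormedAddCommGroup F] [NormedSpace ℝ F] {f : ℝ × V → F} (hf : ContDiff ℝ ∞ f) (i : ℕ) :
    ∀ (t : ℝ) (x : V) (w : Fin i → V),
    fderiv ℝ (fun q : ℝ × V => iteratedFDeriv ℝ i (fun x' => f (q.1, x')) q.2 w) (t, x) (1, 0) =
      iteratedFDeriv ℝ i (fun x' => fderiv ℝ f (t, x') (1, 0)) x w := by
  have hf' : ContDiff ℝ ∞ (fun q : ℝ × V => fderiv ℝ f q (1, 0)) :=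
    (ContinuousLinearMap.apply ℝ F ((1 : ℝ), (0 : V))).contDiff.comp (hf.fderiv_right (m := ∞) (by simp))
  induction i with
  | zero =>
    intro t x w
    simp
  | succ i ih =>
    intro t x w
    obtain ⟨a, w, rfl⟩ : ∃ a w', w = Fin.cons a w' := ⟨w 0, Fin.tail w, (Fin.cons_self_tail w).symm⟩
    set φ : ℝ × V → F := fun q => iteratedFDeriv ℝ i (fun x' => f (q.1, x')) q.2 w with hφdef
    have hφ : ContDiff ℝ ∞ φ := smooth_iter_apply hf i w
    have hφd : Differentiable ℝ φ := hφ.differentiable (by simp)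
    have hslice : ∀ t, ContDiff ℝ ∞ (fun x' => f (t, x')) := fun t => hf.comp (by fun_prop)
    have e1 : (fun q : ℝ × V => iteratedFDeriv ℝ (i+1) (fun x' => f (q.1, x')) q.2 (Fin.cons a w)) =
        fun q => fderiv ℝ φ q (0, a) := by
      funext q
      rw [fderiv_iter_apply (hslice _), ← fderiv_slice (hφd _)]
    have e2 : iteratedFDeriv ℝ (i+1) (fun x' => fderiv ℝ f (t, x') (1, 0)) x (Fin.cons a w) =
        fderiv ℝ (fun x' => fderiv ℝ φ (t, x') (1, 0)) x a := by
      have hc : ContDiff ℝ ∞ (fun x' : V => fderiv ℝ f (t, x') (1, 0)) :=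
        hf'.comp (by fun_prop : ContDiff ℝ ∞ (fun x' : V => (t, x')))
      rw [fderiv_iter_apply hc]
      congr 2
      funext y
      exact (ih t y w).symm
    rw [e1, e2]
    have hd : Differentiable ℝ (fderiv ℝ φ) := (hφ.fderiv_right (m := ∞) (by simp)).differentiable (by simp)
    have k : ∀ b : ℝ × V, HasFDerivAt (fun q => fderiv ℝ φ q b)
        ((ContinuousLinearMap.apply ℝ F b).comp (fderiv ℝ (fderiv ℝ φ) (t, x))) (t, x) := fun b =>
      (ContinuousLinearMap.apply ℝ F b).hasFDerivAt.comp (t, x) (hd (t, x)).hasFDerivAt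
    have k2 := fderiv_slice (φ := fun q => fderiv ℝ φ q ((1 : ℝ), (0 : V))) (k (1, 0)).differentiableAt a
    rw [k2, (k _).fderiv, (k _).fderiv]
    simp only [ContinuousLinearMap.comp_apply, ContinuousLinearMap.apply_apply]
    exact (hφ.contDiffAt.isSymmSndFDerivAt (by simp; exact WithTop.coe_le_coe.2 (le_top : (2:ℕ∞) ≤ ⊤))) _ _

theorem vanish {V : Type} [NormedAddCommGroup V] [NormedSpace ℝ V] {ψ : V → ℝ} (hψ : ContDiff ℝ ∞ ψ)
    (x : V) (hx : ψ x = 0) (i : ℕ) : ∀ (F : Type) [NormedAddCommGroup F] [NormedSpace ℝ F] (k : V → F)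
    (_ : ContDiff ℝ ∞ k) (r : ℕ) (_ : i < r), iteratedFDeriv ℝ i (fun y => ψ y ^ r • k y) x = 0 := by
  induction i with
  | zero =>
    intro F _ _ k hk r hr
    ext w
    simp [hx, hr.ne']
  | succ i ih =>
    intro F _ _ k hk r hr
    obtain ⟨r, rfl⟩ : ∃ r', r = r' + 1 := ⟨r - 1, by omega⟩
    have hψd : Differentiable ℝ ψ := hψ.differentiable (by simp)
    have hkd : Differentiable ℝ k := hk.differentiable (by simp)
    have e : fderiv ℝ (fun y => ψ y ^ (r+1) • k y) =
        fun y => ψ y ^ r • (ψ y • fderiv ℝ k y + ((r + 1 : ℝ) • fderiv ℝ ψ y).smulRight (k y)) := by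
      funext y
      have h1 : HasFDerivAt (fun y => ψ y ^ (r+1)) _ y := (hψd y).hasFDerivAt.pow (r+1)
      have h1' : HasFDerivAt (fun y => ψ y ^ (r+1) • k y) _ y := h1.smul (hkd y).hasFDerivAt
      rw [h1'.fderiv]
      ext v
      simp [smul_smul, pow_succ]
      congr 1; ring
    ext w
    rw [iteratedFDeriv_succ_apply_right, e]
    rw [ih (V →L[ℝ] F) _ ?_ r (by omega)]
    · simp
    · refine ContDiff.add (hψ.smul (hk.fderiv_right (m := ∞) (by simp))) ?_
      have h2 : ContDiff ℝ ∞ (fderiv ℝ ψ) := hψ.fderiv_right (m := ∞) (by simp)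
      exact ContDiff.smulRight (h2.const_smul (r+1:ℝ)) hk

theorem taylor_deriv {P : Type*} [NormedAddCommGroup P] [NormedSpace ℝ P] (r : ℕ) {z z' : ℝ → ℝ} {q q' : ℕ → ℝ → P}
    {om t : ℝ} (hz : HasDerivAt z (z' t) t) (hq : ∀ j ≤ r, HasDerivAt (q j) (q' j t) t)
    (hq' : ∀ j < r, q' j t = z' t • q (j+1) t) :
    HasDerivAt (fun t => ∑ j ∈ Finset.range (r+1), ((om - z t)^j / (j.factorial : ℝ)) • q j t)
      (((om - z t)^r / (r.factorial : ℝ)) • q' r t) t := by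
  induction r with
  | zero => simpa using hq 0 le_rfl
  | succ N ih =>
    have h1 := ih (fun j hj => hq j (by omega)) (fun j hj => hq' j (by omega))
    have h2 : HasDerivAt (fun t => ((om - z t)^(N+1) / ((N+1).factorial : ℝ)) • q (N+1) t) _ t :=
      (((hz.const_sub om).pow (N+1)).div_const _).smul (hq (N+1) le_rfl)
    simp only [Finset.sum_range_succ _ (N+1)]
    refine (h1.add h2).congr_deriv ?_
    rw [hq' N (by omega)]
    have h3 : ((N+1).factorial : ℝ) = (N+1) * N.factorial := by rw [Nat.factorial_succ]; push_cast; ring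
    have h4 : (N.factorial : ℝ) ≠ 0 := by positivity
    have h5 : (N + 1 : ℝ) ≠ 0 := by positivity
    rw [add_comm, add_assoc, smul_smul, ← add_smul]
    have : ((↑(N + 1) * (om - z t) ^ (N + 1 - 1) * -z' t / ↑(N + 1).factorial) + (om - z t) ^ N / ↑N.factorial * z' t) = 0 := by
      rw [h3]
      push_cast
      field_simp
      ring
    rw [this, zero_smul, add_zero]
    rfl

theorem integ {n ℓ r : ℕ} {o : Fin n} {f : ℝ × Vec n → Vec ℓ} (hf : ContDiff ℝ ∞ f) {X : Vec n → Vec n}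
    (hX : ContDiff ℝ ∞ X)
    (hvan : ∀ i < r, ∀ p : Vec n, iteratedFDeriv ℝ i (fun x' => fderiv ℝ f (p o, x') (1, 0)) (X p) = 0)
    (i : ℕ) (hi : i < r) (p v : Vec n) (w : Fin i → Vec n) :
    (fderiv ℝ (fun q : Vec n => iteratedFDeriv ℝ i (fun x' => f (q o, x')) (X q)) p v) w =
      iteratedFDeriv ℝ (i+1) (fun x' => f (p o, x')) (X p) (Fin.cons (fderiv ℝ X p v) w) := by
  have ho : ContDiff ℝ ∞ (fun x : Vec n => x o) := contDiff_apply ℝ ℝ o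
  have hs : ContDiff ℝ ∞ (fun q : Vec n => iteratedFDeriv ℝ i (fun x' => f (q o, x')) (X q)) :=
    smooth_iter_comp hf i ho hX
  have hsd := (hs.differentiable (by simp)) p
  have e1 : (fderiv ℝ (fun q : Vec n => iteratedFDeriv ℝ i (fun x' => f (q o, x')) (X q)) p v) w =
      fderiv ℝ (fun q : Vec n => iteratedFDeriv ℝ i (fun x' => f (q o, x')) (X q) w) p v := by
    have h : HasFDerivAt (fun q : Vec n => iteratedFDeriv ℝ i (fun x' => f (q o, x')) (X q) w) _ p :=
      (ContinuousMultilinearMap.apply ℝ (fun _ : Fin i => Vec n) (Vec ℓ) w).hasFDerivAt.comp p hsd.hasFDerivAt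
    rw [h.fderiv]; rfl
  rw [e1]
  set φ : ℝ × Vec n → Vec ℓ := fun q => iteratedFDeriv ℝ i (fun x' => f (q.1, x')) q.2 w with hφdef
  have hφ : Differentiable ℝ φ := (smooth_iter_apply hf i w).differentiable (by simp)
  have hXd := (hX.differentiable (by simp)) p
  have h1 : HasFDerivAt (fun q : Vec n => (q o, X q)) ((ContinuousLinearMap.proj o).prod (fderiv ℝ X p)) p :=
    HasFDerivAt.prodMk (hasFDerivAt_apply o p) hXd.hasFDerivAt
  have h2 : HasFDerivAt (fun q : Vec n => φ (q o, X q)) 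
      ((fderiv ℝ φ (p o, X p)).comp ((ContinuousLinearMap.proj o).prod (fderiv ℝ X p))) p :=
    HasFDerivAt.comp (g := φ) (f := fun q : Vec n => (q o, X q)) p (hφ (p o, X p)).hasFDerivAt h1
  have h3 : (fun q : Vec n => iteratedFDeriv ℝ i (fun x' => f (q o, x')) (X q) w) = fun q : Vec n => φ (q o, X q) := rfl
  rw [h3, h2.fderiv]
  have h4 : ((ContinuousLinearMap.proj o : Vec n →L[ℝ] ℝ).prod (fderiv ℝ X p)) v =
      (v o) • ((1 : ℝ), (0 : Vec n)) + (0, fderiv ℝ X p v) := by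
    ext <;> simp
  have hsl : ContDiff ℝ ∞ (fun x' : Vec n => f (p o, x')) := hf.comp (by fun_prop)
  rw [ContinuousLinearMap.comp_apply, h4, map_add, map_smul, hφdef, iter_comm hf, hvan i hi p, ← hφdef,
    ← fderiv_slice (hφ _), fderiv_iter_apply hsl]
  simp only [zero_apply, smul_zero, zero_add]
  rfl

end

noncomputable section
open Set Filter Topology
open scoped ContDiff

theorem base {n ℓ r : ℕ} {σ : (i : ℕ) → ℝ × Vec n → SymMap n ℓ i} {ε : ℝ} (o : Fin n)
    (hσ : SigmaOK n ℓ r σ) (hε : 0 < ε) (g : Vec n → Vec ℓ) (hg : ContDiff ℝ ∞ g)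
    (hgper : ∀ (m : Fin n → ℤ) (p : Vec n), g (p + zcast m) = g p)
    (hhol : ∀ s ≤ (0 : ℝ), ∀ (p : Vec n), ∀ i ≤ r, σ i (s, p) = iteratedFDeriv ℝ i g p)
    (η : ℝ → ℝ) (hη : Continuous η) (hη0 : ∀ s, 0 < η s) :
    ∃ (θ : ℝ → ℝ) (H : (ℝ × ℝ) × Vec n → Vec ℓ) (W : ℝ × Vec n → ℝ),
      ContDiff ℝ ∞ θ ∧ (∀ s, θ s ∈ Icc 0 1) ∧ (∀ s ≤ 0, θ s = 0) ∧ (∀ s > 0, 0 < θ s) ∧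
      ContDiff ℝ ∞ H ∧ ContDiff ℝ ∞ W ∧
      (∀ s x m, W (s, x + zcast m) = W (s, x)) ∧
      (∀ s x y, (∀ j, j ≠ o → x j = y j) → W (s, x) = W (s, y)) ∧
      (∀ s ≤ 0, ∀ x, W (s, x) = 0) ∧ (∀ s ≤ 0, ∀ c x, H ((s, c), x) = g x) ∧
      (∀ s c x m, H ((s, c + (m o : ℝ)), x + zcast m) = H ((s, c), x)) ∧
      (∀ s, θ s = 1 ∨ ∀ c x, H ((s, c), x) = g x) ∧
      (∀ s x, Good r σ ε (fun x' => H ((s, x o - W (s, x)), x')) s x) ∧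
      (∀ s x, |W (s, x)| < η s) := by
  obtain ⟨F, W, hF, hW, hWper, hWo, hFper, hFgood, hWη⟩ := multi o hσ hε η hη hη0
  -- the jets of g are good for small s
  have hsmall : ∃ s₂ > 0, ∀ s ≤ s₂, ∀ x, Good r σ ε g s x := by
    have hopen : IsOpen {y : ℝ × Vec n | Good r σ ε g y.1 y.2} := by
      have := good_open (r := r) (σ := σ) (ε := ε) hσ (E := ℝ) (Y := ℝ × Vec n)
        (f := fun q => g q.2) (hg.comp contDiff_snd) (e := fun y => y.1) (s := fun y => y.1)
        (x := fun y => y.2) continuous_fst continuous_fst continuous_snd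
      exact this
    have h0 : ∀ s ≤ (0:ℝ), ∀ x, Good r σ ε g s x := by
      intro s hs x i hi
      rw [hhol s hs x i hi]; simpa using hε
    have hK : IsCompact (Icc (0 : Vec n) 1) := isCompact_Icc
    have hev : ∀ᶠ s in 𝓝 (0:ℝ), ∀ x ∈ Icc (0 : Vec n) 1, (s, x) ∈ {y : ℝ × Vec n | Good r σ ε g y.1 y.2} := by
      apply hK.eventually_forall_of_forall_eventually
      intro x hx
      have := hopen.mem_nhds (show (0, x) ∈ {y : ℝ × Vec n | Good r σ ε g y.1 y.2} from h0 0 le_rfl x)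
      exact this
    obtain ⟨d, hd, h⟩ := Metric.eventually_nhds_iff.1 hev
    refine ⟨d/2, by positivity, fun s hs x => ?_⟩
    rcases le_total s 0 with hs0 | hs0
    · exact h0 s hs0 x
    · obtain ⟨y, m, hy, rfl⟩ := exists_cube x
      refine Good.trans hσ m (h (y := s) ?_ y hy) (fun y => hgper m y)
      rw [Real.dist_eq, sub_zero, abs_of_nonneg hs0]; linarith
  obtain ⟨s₂, hs₂, hgood⟩ := hsmall
  set θ : ℝ → ℝ := fun s => Real.smoothTransition (2 / s₂ * s) with hθ
  set ρ : ℝ → ℝ := fun s => Real.smoothTransition (2 / s₂ * s - 1) with hρ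
  have hθs : ContDiff ℝ ∞ θ := Real.smoothTransition.contDiff.comp (contDiff_const.mul contDiff_id)
  have hρs : ContDiff ℝ ∞ ρ := Real.smoothTransition.contDiff.comp ((contDiff_const.mul contDiff_id).sub contDiff_const)
  have hk : 0 < 2 / s₂ := by positivity
  have hθρ : ∀ s, θ s = 1 ∨ ρ s = 0 := by
    intro s
    rcases le_total 1 (2 / s₂ * s) with h | h
    · left; exact Real.smoothTransition.one_of_one_le h
    · right; exact Real.smoothTransition.zero_of_nonpos (by linarith)
  have hθ0 : ∀ s ≤ 0, θ s = 0 := fun s hs =>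
    Real.smoothTransition.zero_of_nonpos (mul_nonpos_of_nonneg_of_nonpos hk.le hs)
  have hρ0 : ∀ s ≤ 0, ρ s = 0 := fun s hs =>
    Real.smoothTransition.zero_of_nonpos (by nlinarith [mul_nonpos_of_nonneg_of_nonpos hk.le hs])
  have hρ1 : ∀ s, s₂ ≤ s → ρ s = 1 := fun s hs => by
    apply Real.smoothTransition.one_of_one_le
    have : 2 / s₂ * s₂ ≤ 2 / s₂ * s := by gcongr
    rw [div_mul_cancel₀ _ hs₂.ne'] at this; linarith
  have hθI : ∀ s, θ s ∈ Icc 0 1 := fun s => ⟨Real.smoothTransition.nonneg _, Real.smoothTransition.le_one _⟩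
  have hρI : ∀ s, ρ s ∈ Icc 0 1 := fun s => ⟨Real.smoothTransition.nonneg _, Real.smoothTransition.le_one _⟩
  refine ⟨θ, fun a => (1 - ρ a.1.1) • g a.2 + ρ a.1.1 • F a, fun a => θ a.1 * W a, hθs, hθI, hθ0,
    fun s hs => Real.smoothTransition.pos_of_pos (by positivity), ?_, ?_, ?_, ?_, ?_, ?_, ?_, ?_, ?_, ?_⟩
  · have h1 : ContDiff ℝ ∞ (fun a : (ℝ × ℝ) × Vec n => ρ a.1.1) := hρs.comp (contDiff_fst.comp contDiff_fst)
    exact ((contDiff_const.sub h1).smul (hg.comp contDiff_snd)).add (h1.smul hF)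
  · exact (hθs.comp contDiff_fst).mul hW
  · intro s x m; simp only [hWper]
  · intro s x y h; simp only [hWo s x y h]
  · intro s hs x; simp only [hθ0 s hs, zero_mul]
  · intro s hs c x; simp [hρ0 s hs]
  · intro s c x m; simp only [hgper, hFper]
  · intro s
    rcases hθρ s with h | h
    · exact Or.inl h
    · right; intro c x; simp [h]
  · intro s x
    rcases hθρ s with h | h
    · simp only [h, one_mul]
      rcases le_total s₂ s with h2 | h2
      · simp only [hρ1 s h2, sub_self, zero_smul, zero_add, one_smul]
        exact hFgood s x
      · intro i hi
        have hFs : ContDiff ℝ ∞ (fun x' => F ((s, x o - W (s,x)), x')) :=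
          ContDiff.comp (g := F) hF (contDiff_const.prodMk contDiff_id)
        have h1 := hgood s h2 x i hi
        have h2 := hFgood s x i hi
        have hle : ((i:ℕ) : WithTop ℕ∞) ≤ ∞ := by exact_mod_cast le_top
        have e : iteratedFDeriv ℝ i (fun x' => (1 - ρ s) • g x' + ρ s • F ((s, x o - W (s,x)), x')) x
            = (1 - ρ s) • iteratedFDeriv ℝ i g x + ρ s • iteratedFDeriv ℝ i (fun x' => F ((s, x o - W (s,x)), x')) x := by
          refine (iteratedFDeriv_add_apply (f := fun x' => (1 - ρ s) • g x')
            (g := fun x' => ρ s • F ((s, x o - W (s,x)), x'))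
            ((hg.const_smul (1 - ρ s)).of_le hle).contDiffAt
            ((hFs.const_smul (ρ s)).of_le hle).contDiffAt).trans ?_
          rw [iteratedFDeriv_const_smul_apply' (hg.of_le hle).contDiffAt,
            iteratedFDeriv_const_smul_apply' (hFs.of_le hle).contDiffAt]
        rw [e]
        have hconv := convex_ball (σ i (s,x)) ε
        have := hconv (mem_ball_iff_norm.2 h1) (mem_ball_iff_norm.2 h2) (a := 1 - ρ s) (b := ρ s)
          (by linarith [(hρI s).2]) (hρI s).1 (by ring)
        exact mem_ball_iff_norm.1 this
    · simp only [h, sub_zero, one_smul, zero_smul, add_zero]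
      apply hgood
      by_contra h3
      push Not at h3
      rw [hρ1 s h3.le] at h; norm_num at h
  · intro s x
    rw [abs_mul, abs_of_nonneg (hθI s).1]
    calc _ ≤ 1 * |W (s,x)| := by gcongr; exact (hθI s).2
      _ < _ := by rw [one_mul]; exact hWη s x
end

noncomputable section
open Set Filter Topology
open scoped ContDiff

section
variable {n ℓ : ℕ} (r : ℕ) (o : Fin n) (W : ℝ × Vec n → ℝ) (zz : ℝ × ℝ → ℝ)
  (bb EE : ℕ → ℝ × ℝ → ℝ) (H : (ℝ × ℝ) × Vec n → Vec ℓ) (κ : ℝ → ℝ)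

/-- Taylor-type polynomial in the slanted coordinate -/
def Qf (b : ℕ → ℝ × ℝ → ℝ) (a : ℝ × ℝ) (x : Vec n) : ℝ :=
  ∑ j ∈ Finset.range (r+1), ((x o - W (a.1, x) - zz a)^j / (j.factorial : ℝ)) • b j a

def ff (q : (ℝ × ℝ) × Vec n) : Vec ℓ :=
  H ((q.1.1, Qf r o W zz bb q.1 q.2), q.2) + (κ q.1.1 * Qf r o W zz EE q.1 q.2) • (1 : Vec ℓ)

def XX (q : ℝ × Vec n) : Vec n := Function.update q.2 o (zz (q.1, q.2 o) + W q)

def ZZ (i : ℕ) (q : ℝ × Vec n) : SymMap n ℓ i :=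
  iteratedFDeriv ℝ i (fun x' => ff r o W zz bb EE H κ ((q.1, q.2 o), x')) (XX o W zz q)

variable {r o W zz bb EE H κ}

theorem Qf_smooth (hW : ContDiff ℝ ∞ W) (hz : ContDiff ℝ ∞ zz) {b : ℕ → ℝ × ℝ → ℝ}
    (hb : ∀ j, ContDiff ℝ ∞ (b j)) :
    ContDiff ℝ ∞ (fun q : (ℝ × ℝ) × Vec n => Qf r o W zz b q.1 q.2) := by
  unfold Qf
  apply ContDiff.sum
  intro j _
  have h1 : ContDiff ℝ ∞ (fun q : (ℝ × ℝ) × Vec n => q.2 o) := (contDiff_apply ℝ ℝ o).comp contDiff_snd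
  have h2 : ContDiff ℝ ∞ (fun q : (ℝ × ℝ) × Vec n => W (q.1.1, q.2)) :=
    ContDiff.comp (g := W) hW ((contDiff_fst.comp contDiff_fst).prodMk contDiff_snd)
  exact ((((h1.sub h2).sub (hz.comp contDiff_fst)).pow j).div_const _).smul ((hb j).comp contDiff_fst)

theorem ff_smooth (hW : ContDiff ℝ ∞ W) (hz : ContDiff ℝ ∞ zz) 
    (hb : ∀ j, ContDiff ℝ ∞ (bb j)) (hE : ∀ j, ContDiff ℝ ∞ (EE j)) (hH : ContDiff ℝ ∞ H)
    (hκ : ContDiff ℝ ∞ κ) : ContDiff ℝ ∞ (ff r o W zz bb EE H κ) := by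
  unfold ff
  have h1 := Qf_smooth (r := r) (o := o) hW hz hb
  have h2 := Qf_smooth (r := r) (o := o) hW hz hE
  have h3 : ContDiff ℝ ∞ (fun q : (ℝ × ℝ) × Vec n => q.1.1) := contDiff_fst.comp contDiff_fst
  refine ContDiff.add ?_ (((hκ.comp h3).mul h2).smul contDiff_const)
  exact ContDiff.comp (g := H) hH ((h3.prodMk h1).prodMk contDiff_snd)

theorem XX_smooth (hW : ContDiff ℝ ∞ W) (hz : ContDiff ℝ ∞ zz) : ContDiff ℝ ∞ (XX o W zz) := by
  rw [contDiff_pi]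
  intro j
  have h1 : ∀ j, ContDiff ℝ ∞ (fun q : ℝ × Vec n => q.2 j) := fun j => (contDiff_apply ℝ ℝ j).comp contDiff_snd
  unfold XX
  by_cases h : j = o
  · subst h
    simp only [Function.update_self]
    exact ContDiff.add (ContDiff.comp (g := zz) hz (contDiff_fst.prodMk (h1 j))) hW
  · simp only [Function.update_of_ne h]
    exact h1 j

theorem ZZ_smooth (hW : ContDiff ℝ ∞ W) (hz : ContDiff ℝ ∞ zz) 
    (hb : ∀ j, ContDiff ℝ ∞ (bb j)) (hE : ∀ j, ContDiff ℝ ∞ (EE j)) (hH : ContDiff ℝ ∞ H)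
    (hκ : ContDiff ℝ ∞ κ) (i : ℕ) : ContDiff ℝ ∞ (ZZ r o W zz bb EE H κ i) := by
  unfold ZZ
  have h1 : ContDiff ℝ ∞ (fun q : ℝ × Vec n => q.2 o) := (contDiff_apply ℝ ℝ o).comp contDiff_snd
  exact smooth_iter_comp (ff_smooth hW hz hb hE hH hκ) i (contDiff_fst.prodMk h1) (XX_smooth hW hz)

theorem ZZ_symm (hW : ContDiff ℝ ∞ W) (hz : ContDiff ℝ ∞ zz) 
    (hb : ∀ j, ContDiff ℝ ∞ (bb j)) (hE : ∀ j, ContDiff ℝ ∞ (EE j)) (hH : ContDiff ℝ ∞ H)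
    (hκ : ContDiff ℝ ∞ κ) (i : ℕ) (q) : IsSymmMap (ZZ r o W zz bb EE H κ i q) := by
  intro e v
  exact iter_symm (ContDiff.comp (g := ff r o W zz bb EE H κ) (ff_smooth hW hz hb hE hH hκ)
    (contDiff_const.prodMk contDiff_id)) i _ e v

theorem om_XX (hWo : ∀ s x y, (∀ j, j ≠ o → x j = y j) → W (s, x) = W (s, y)) (s : ℝ) (p : Vec n) :
    XX o W zz (s, p) o - W (s, XX o W zz (s, p)) = zz (s, p o) := by
  rw [hWo s (XX o W zz (s, p)) p (fun j hj => by simp [XX, hj])]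
  simp [XX]

theorem Qf_XX (hWo : ∀ s x y, (∀ j, j ≠ o → x j = y j) → W (s, x) = W (s, y))
    (b : ℕ → ℝ × ℝ → ℝ) (s : ℝ) (p : Vec n) :
    Qf r o W zz b (s, p o) (XX o W zz (s, p)) = b 0 (s, p o) := by
  unfold Qf
  rw [Finset.sum_range_succ']
  simp [om_XX hWo]

theorem Qf_hasDerivAt {b : ℕ → ℝ × ℝ → ℝ} {z' : ℝ → ℝ → ℝ} (hb : ∀ j, ContDiff ℝ ∞ (b j))
    (hz' : ∀ s t, HasDerivAt (fun t => zz (s, t)) (z' s t) t)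
    (hb' : ∀ j < r, ∀ s t, HasDerivAt (fun t => b j (s, t)) (b (j+1) (s, t) * z' s t) t) (s t : ℝ) (x : Vec n) :
    HasDerivAt (fun t => Qf r o W zz b (s, t) x)
      (((x o - W (s, x) - zz (s,t))^r / (r.factorial : ℝ)) • deriv (fun t => b r (s,t)) t) t := by
  have hd : ∀ j, HasDerivAt (fun t => b j (s,t)) (deriv (fun t => b j (s,t)) t) t := by
    intro j
    apply DifferentiableAt.hasDerivAt
    exact ((ContDiff.comp (g := b j) (hb j) (contDiff_const.prodMk contDiff_id)).differentiable (by simp)).differentiableAt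
  exact taylor_deriv r (z := fun t => zz (s,t)) (z' := z' s) (q := fun j t => b j (s,t))
    (q' := fun j t => deriv (fun t => b j (s,t)) t) (om := x o - W (s,x)) (t := t) (hz' s t)
    (fun j _ => hd j) (fun j hj => by
      rw [(hb' j hj s t).deriv, smul_eq_mul, mul_comm])

set_option maxHeartbeats 1000000 in
theorem ZZ_integ (hW : ContDiff ℝ ∞ W) (hz : ContDiff ℝ ∞ zz) 
    (hb : ∀ j, ContDiff ℝ ∞ (bb j)) (hE : ∀ j, ContDiff ℝ ∞ (EE j)) (hH : ContDiff ℝ ∞ H)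
    (hκ : ContDiff ℝ ∞ κ) {z' : ℝ → ℝ → ℝ}
    (hWo : ∀ s x y, (∀ j, j ≠ o → x j = y j) → W (s, x) = W (s, y))
    (hz' : ∀ s t, HasDerivAt (fun t => zz (s, t)) (z' s t) t)
    (hb' : ∀ j < r, ∀ s t, HasDerivAt (fun t => bb j (s, t)) (bb (j+1) (s, t) * z' s t) t)
    (hE' : ∀ j < r, ∀ s t, HasDerivAt (fun t => EE j (s, t)) (EE (j+1) (s, t) * z' s t) t)
    (s : ℝ) (i : ℕ) (hi : i < r) (p v : Vec n) (w : Fin i → Vec n) :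
    (fderiv ℝ (fun q => ZZ r o W zz bb EE H κ i (s, q)) p v) w
      = ZZ r o W zz bb EE H κ (i+1) (s, p) (Fin.cons (fderiv ℝ (fun q => XX o W zz (s, q)) p v) w) := by
  have hff := ff_smooth (r := r) (o := o) hW hz hb hE hH hκ
  set f : ℝ × Vec n → Vec ℓ := fun a => ff r o W zz bb EE H κ ((s, a.1), a.2) with hf
  have hfs : ContDiff ℝ ∞ f := ContDiff.comp (g := ff r o W zz bb EE H κ) hff
    ((contDiff_const.prodMk contDiff_fst).prodMk contDiff_snd)
  have hXs : ContDiff ℝ ∞ (fun q => XX o W zz (s, q)) :=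
    ContDiff.comp (g := XX o W zz) (XX_smooth hW hz) (contDiff_const.prodMk contDiff_id)
  refine integ (o := o) (f := f) hfs (X := fun q => XX o W zz (s, q)) hXs ?_ i hi p v w
  clear i hi p v w
  intro i hi p
  set t := p o with ht
  set ψ : Vec n → ℝ := fun x => x o - W (s, x) - zz (s, t) with hψ
  set β := deriv (fun t => bb r (s,t)) t / (r.factorial : ℝ)
  set γ := deriv (fun t => EE r (s,t)) t / (r.factorial : ℝ)
  set k : Vec n → Vec ℓ := fun x => fderiv ℝ H ((s, Qf r o W zz bb (s,t) x), x) ((0, β), 0) + (κ s * γ) • (1 : Vec ℓ) with hk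
  have hψs : ContDiff ℝ ∞ ψ := ((contDiff_apply ℝ ℝ o).sub
    (ContDiff.comp (g := W) hW (contDiff_const.prodMk contDiff_id))).sub contDiff_const
  have hQs : ContDiff ℝ ∞ (fun x => Qf r o W zz bb (s,t) x) :=
    ContDiff.comp (g := fun q : (ℝ × ℝ) × Vec n => Qf r o W zz bb q.1 q.2) (Qf_smooth (r := r) (o := o) hW hz hb)
      (contDiff_const.prodMk contDiff_id)
  have hks : ContDiff ℝ ∞ k := by
    refine ContDiff.add ?_ contDiff_const
    have h1 : ContDiff ℝ ∞ (fderiv ℝ H) := hH.fderiv_right (m := ∞) (by simp)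
    refine ContDiff.clm_apply ?_ contDiff_const
    exact ContDiff.comp (g := fderiv ℝ H) h1 ((contDiff_const.prodMk hQs).prodMk contDiff_id)
  have key : (fun x' => fderiv ℝ f (t, x') (1, 0)) = fun x' => ψ x' ^ r • k x' := by
    funext x
    have h1 := deriv_slice (φ := f) (t := t) (x := x) (hfs.differentiable (by simp)).differentiableAt
    have hQ := Qf_hasDerivAt (r := r) (o := o) (W := W) (zz := zz) hb hz' hb' s t x
    have hQ2 := Qf_hasDerivAt (r := r) (o := o) (W := W) (zz := zz) hE hz' hE' s t x
    have h2 : HasDerivAt (fun t' => ((s, Qf r o W zz bb (s, t') x), x)) (((0:ℝ), (ψ x)^r * β), (0 : Vec n)) t := by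
      refine HasDerivAt.prodMk ((hasDerivAt_const t s).prodMk (hQ.congr_deriv ?_)) (hasDerivAt_const t x)
      simp only [smul_eq_mul, hψ, β]; ring
    have h3 : HasFDerivAt H (fderiv ℝ H ((s, Qf r o W zz bb (s,t) x), x)) ((s, Qf r o W zz bb (s,t) x), x) :=
      (hH.differentiable (by simp)).differentiableAt.hasFDerivAt
    have h4 := h3.comp_hasDerivAt t h2
    have h5 := h4.add ((hQ2.const_mul (κ s)).smul_const (1 : Vec ℓ))
    have h6 := h1.unique h5
    rw [h6]
    simp only [hk, smul_add]
    congr 1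
    · rw [← map_smul]
      simp
    · rw [smul_smul]
      congr 1
      simp only [smul_eq_mul, hψ, γ]; ring
  rw [key]
  refine vanish hψs _ ?_ i _ k hks r hi
  simp only [hψ, ht]
  rw [om_XX hWo, sub_self]

theorem XX_bij (hW : ContDiff ℝ ∞ W) (hz : ContDiff ℝ ∞ zz) {z' : ℝ → ℝ → ℝ}
    (hWo : ∀ s x y, (∀ j, j ≠ o → x j = y j) → W (s, x) = W (s, y))
    (hz' : ∀ s t, HasDerivAt (fun t => zz (s, t)) (z' s t) t) (s : ℝ) (p : Vec n) (h : z' s (p o) ≠ 0) :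
    Function.Bijective ⇑(fderiv ℝ (fun q => XX o W zz (s, q)) p) := by
  have hXs : ContDiff ℝ ∞ (fun q => XX o W zz (s, q)) :=
    ContDiff.comp (g := XX o W zz) (XX_smooth hW hz) (contDiff_const.prodMk contDiff_id)
  have hX := (hXs.differentiable (by simp)).differentiableAt (x := p) |>.hasFDerivAt
  set L := fderiv ℝ (fun q => XX o W zz (s, q)) p with hL
  have hinj : Function.Injective (L : Vec n →ₗ[ℝ] Vec n) := by
    rw [← LinearMap.ker_eq_bot, LinearMap.ker_eq_bot']
    intro v hv
    replace hv : L v = 0 := hv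
    have hj : ∀ j, j ≠ o → v j = 0 := by
      intro j hj
      have h1 := (hasFDerivAt_pi'.1 hX j)
      have h2 : HasFDerivAt (fun q : Vec n => XX o W zz (s, q) j) (ContinuousLinearMap.proj (R := ℝ) (φ := fun _ : Fin n => ℝ) j) p := by
        have : (fun q : Vec n => XX o W zz (s, q) j) = fun q => q j := by
          funext q; simp [XX, hj]
        rw [this]
        exact hasFDerivAt_apply j p
      have h3 := h1.unique h2
      have h4 := DFunLike.congr_fun h3 v
      simp [hv] at h4
      exact h4.symm
    have hve : v = v o • Pi.single o 1 := by
      funext j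
      by_cases h : j = o
      · subst h; simp
      · simp [hj j h, h]
    have hline : HasDerivAt (fun t : ℝ => XX o W zz (s, p + t • v) o) (z' s (p o) * v o) 0 := by
      have e : (fun t : ℝ => XX o W zz (s, p + t • v) o) = fun t => zz (s, p o + t * v o) + W (s, p) := by
        funext t
        simp only [XX, Function.update_self, Pi.add_apply, Pi.smul_apply, smul_eq_mul]
        rw [hWo s (p + t • v) p (fun j h => by simp [hj j h])]
      rw [e]
      apply HasDerivAt.add_const
      have h1 : HasDerivAt (fun t : ℝ => p o + t * v o) (v o) 0 := by
        simpa using ((hasDerivAt_id (0:ℝ)).mul_const (v o)).const_add (p o)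
      have h2 : HasDerivAt (fun t => zz (s,t)) (z' s (p o)) (p o + 0 * v o) := by simpa using hz' s (p o)
      exact h2.comp (0:ℝ) h1
    have hline2 : HasDerivAt (fun t : ℝ => XX o W zz (s, p + t • v) o) (L v o) 0 := by
      have h1 : HasDerivAt (fun t : ℝ => p + t • v) v 0 := by
        simpa using ((hasDerivAt_id (0:ℝ)).smul_const v).const_add p
      have h2 : HasFDerivAt (fun q => XX o W zz (s, q)) L (p + (0:ℝ) • v) := by simpa using hX
      exact hasDerivAt_pi.1 (h2.comp_hasDerivAt (0:ℝ) h1) o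
    have h5 := hline2.unique hline
    rw [hv] at h5
    have h6 : v o = 0 := by
      rcases mul_eq_zero.1 h5.symm with h7 | h7
      · exact absurd h7 h
      · exact h7
    rw [hve, h6, zero_smul]
  exact ⟨hinj, LinearMap.injective_iff_surjective.1 hinj⟩

theorem XX_dense (hW : ContDiff ℝ ∞ W) (hz : ContDiff ℝ ∞ zz) {z' : ℝ → ℝ → ℝ}
    (hWo : ∀ s x y, (∀ j, j ≠ o → x j = y j) → W (s, x) = W (s, y))
    (hz' : ∀ s t, HasDerivAt (fun t => zz (s, t)) (z' s t) t) (s : ℝ) 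
    (hd : Dense {t | z' s t ≠ 0}) :
    Dense {p : Vec n | Function.Bijective ⇑(fderiv ℝ (fun q => XX o W zz (s, q)) p)} := by
  have h1 : Dense ((fun p : Vec n => p o) ⁻¹' {t | z' s t ≠ 0}) :=
    hd.preimage (isOpenMap_eval o)
  exact h1.mono (fun p hp => XX_bij hW hz hWo hz' s p hp)
end
end

noncomputable section
open Set Filter Topology
open scoped ContDiff

section
variable {n ℓ r : ℕ} {σ : (i : ℕ) → ℝ × Vec n → SymMap n ℓ i} {ε : ℝ}

theorem Good.add_const {F : Vec n → Vec ℓ} {s : ℝ} {x : Vec n} (h : Good r σ ε F s x)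
    (hF : ContDiff ℝ ∞ F) {δ : ℝ} (v : Vec ℓ) (hv : ‖v‖ ≤ δ) : Good r σ (ε + δ) (fun x => F x + v) s x := by
  intro i hi
  have hle : ((i:ℕ) : WithTop ℕ∞) ≤ ∞ := by exact_mod_cast le_top
  have e : iteratedFDeriv ℝ i (fun x => F x + v) x = iteratedFDeriv ℝ i F x + iteratedFDeriv ℝ i (fun _ => v) x :=
    iteratedFDeriv_add_apply (f := F) (g := fun _ => v) (hF.of_le hle).contDiffAt contDiff_const.contDiffAt
  have h2 : ‖iteratedFDeriv ℝ i (fun _ : Vec n => v) x‖ ≤ δ := by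
    rcases Nat.eq_zero_or_pos i with h0 | h0
    · subst h0; rw [norm_iteratedFDeriv_zero]; exact hv
    · rw [iteratedFDeriv_const_of_ne h0.ne']
      simpa using (norm_nonneg v).trans hv
  rw [e]
  calc _ = ‖(iteratedFDeriv ℝ i F x - σ i (s,x)) + iteratedFDeriv ℝ i (fun _ : Vec n => v) x‖ := by congr 1; abel
    _ ≤ ‖iteratedFDeriv ℝ i F x - σ i (s,x)‖ + ‖iteratedFDeriv ℝ i (fun _ : Vec n => v) x‖ := norm_add_le _ _
    _ < ε + δ := add_lt_add_of_lt_of_le (h i hi) h2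

abbrev PP (r : ℕ) := (Fin (r+1) → ℝ) × (Fin (r+1) → ℝ)

def psum (r : ℕ) (u : ℝ) (m : Fin (r+1) → ℝ) : ℝ := ∑ j : Fin (r+1), (u ^ (j:ℕ) / ((j:ℕ).factorial : ℝ)) * m j

theorem psum_smooth {A : Type*} [NormedAddCommGroup A] [NormedSpace ℝ A] {u : A → ℝ} {m : A → Fin (r+1) → ℝ}
    (hu : ContDiff ℝ ∞ u) (hm : ContDiff ℝ ∞ m) : ContDiff ℝ ∞ (fun a => psum r (u a) (m a)) := by
  unfold psum
  apply ContDiff.sum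
  intro j _
  exact ((hu.pow _).div_const _).mul (contDiff_pi.1 hm j)

/-- perturbed family; parameters `(s, z, m)` -/
def Phi (o : Fin n) (W : ℝ × Vec n → ℝ) (H : (ℝ × ℝ) × Vec n → Vec ℓ) (κ : ℝ → ℝ)
    (q : (ℝ × ℝ × PP r) × Vec n) : Vec ℓ :=
  H ((q.1.1, q.1.2.1 + psum r (q.2 o - W (q.1.1, q.2) - q.1.2.1) q.1.2.2.1), q.2) +
    (κ q.1.1 * psum r (q.2 o - W (q.1.1, q.2) - q.1.2.1) q.1.2.2.2) • (1 : Vec ℓ)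

variable {o : Fin n} {W : ℝ × Vec n → ℝ} {H : (ℝ × ℝ) × Vec n → Vec ℓ} {κ : ℝ → ℝ}

theorem Phi_smooth (hW : ContDiff ℝ ∞ W) (hH : ContDiff ℝ ∞ H) (hκ : ContDiff ℝ ∞ κ) :
    ContDiff ℝ ∞ (Phi (r := r) o W H κ) := by
  unfold Phi
  have h3 : ContDiff ℝ ∞ (fun q : (ℝ × ℝ × PP r) × Vec n => q.1.1) := contDiff_fst.comp contDiff_fst
  have h0 : ContDiff ℝ ∞ (fun q : (ℝ × ℝ × PP r) × Vec n => q.1.2) := contDiff_snd.comp contDiff_fst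
  have h4 : ContDiff ℝ ∞ (fun q : (ℝ × ℝ × PP r) × Vec n => q.1.2.1) := contDiff_fst.comp h0
  have h5 : ContDiff ℝ ∞ (fun q : (ℝ × ℝ × PP r) × Vec n => q.1.2.2) := contDiff_snd.comp h0
  have h1 : ContDiff ℝ ∞ (fun q : (ℝ × ℝ × PP r) × Vec n => q.2 o) := (contDiff_apply ℝ ℝ o).comp contDiff_snd
  have h2 : ContDiff ℝ ∞ (fun q : (ℝ × ℝ × PP r) × Vec n => W (q.1.1, q.2)) :=
    ContDiff.comp (g := W) hW (h3.prodMk contDiff_snd)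
  have h6 := (h1.sub h2).sub h4
  have h7 := psum_smooth (r := r) h6 (contDiff_fst.comp h5)
  have h8 := psum_smooth (r := r) h6 (contDiff_snd.comp h5)
  refine ContDiff.add ?_ (((hκ.comp h3).mul h8).smul contDiff_const)
  exact ContDiff.comp (g := H) hH ((h3.prodMk (h4.add h7)).prodMk contDiff_snd)

theorem jets (hσ : SigmaOK n ℓ r σ) (hW : ContDiff ℝ ∞ W) (hH : ContDiff ℝ ∞ H) (hκ : ContDiff ℝ ∞ κ)
    (hWper : ∀ s x m, W (s, x + zcast m) = W (s, x))
    (hHper : ∀ s c x m, H ((s, c + (m o : ℝ)), x + zcast m) = H ((s, c), x))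
    (hgood : ∀ s x, Good r σ ε (fun x' => H ((s, x o - W (s, x)), x')) s x) :
    ∃ ν : ℝ → ℝ, ContDiff ℝ ∞ ν ∧ (∀ s, 0 < ν s ∧ ν s ≤ 1) ∧
      ∀ s x (m : PP r), ‖m‖ ≤ ν s → Good r σ ε (fun x' => Phi o W H κ ((s, x o - W (s, x), m), x')) s x := by
  have hK : IsCompact (Icc (0 : Vec n) 1) := isCompact_Icc
  have hx : Continuous (fun y : ℝ × Vec n × PP r => y.2.1) := continuous_fst.comp continuous_snd
  have hO := good_open (r := r) (σ := σ) (ε := ε) hσ (Phi_smooth (r := r) (o := o) hW hH hκ)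
    (e := fun y : ℝ × Vec n × PP r => (y.1, y.2.1 o - W (y.1, y.2.1), y.2.2)) (s := fun y => y.1)
    (x := fun y => y.2.1)
    (continuous_fst.prodMk ((((continuous_apply o).comp hx).sub
      (hW.continuous.comp (continuous_fst.prodMk hx))).prodMk (continuous_snd.comp continuous_snd)))
    continuous_fst hx
  obtain ⟨ν, h1, h2, h3⟩ := tube hK hO (by
    intro s x _
    have := hgood s x
    simpa [Phi, psum] using this)
  refine ⟨ν, h1, h2, fun s x m hm => ?_⟩
  obtain ⟨y, k, hy, rfl⟩ := exists_cube x
  refine Good.trans hσ k (h3 s y hy m hm) (fun x' => ?_)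
  have e1 : (y + zcast k) o = y o + (k o : ℝ) := rfl
  have e2 : (x' + zcast k) o = x' o + (k o : ℝ) := rfl
  simp only [Phi, hWper, e1, e2]
  rw [show x' o + (k o : ℝ) - W (s,x') - (y o + (k o : ℝ) - W (s,y)) = x' o - W (s,x') - (y o - W (s,y)) by ring]
  rw [← hHper s _ x' k]
  congr 4
  ring

theorem lip (hW : ContDiff ℝ ∞ W) (hH : ContDiff ℝ ∞ H) 
    (hWper : ∀ s x m, W (s, x + zcast m) = W (s, x))
    (hHper : ∀ s c x m, H ((s, c + (m o : ℝ)), x + zcast m) = H ((s, c), x)) {k : ℝ} (hk : 0 < k) :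
    ∃ ν : ℝ → ℝ, ContDiff ℝ ∞ ν ∧ (∀ s, 0 < ν s ∧ ν s ≤ 1) ∧
      ∀ s x c c', |c - (x o - W (s, x))| ≤ 3 → |c' - (x o - W (s, x))| ≤ 3 →
        ν s * ‖H ((s, c), x) - H ((s, c'), x)‖ ≤ k * |c - c'| := by
  have hK : IsCompact (Icc (0 : Vec n) 1 ×ˢ Icc (-3:ℝ) 3) := isCompact_Icc.prod isCompact_Icc
  set D : ℝ × (Vec n × ℝ) × ℝ → Vec ℓ := fun y =>
    y.2.2 • fderiv ℝ H ((y.1, y.2.1.1 o - W (y.1, y.2.1.1) + y.2.1.2), y.2.1.1) ((0, 1), 0) with hD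
  have hx0 : Continuous (fun y : ℝ × (Vec n × ℝ) × ℝ => y.2.1) := continuous_fst.comp continuous_snd
  have hx : Continuous (fun y : ℝ × (Vec n × ℝ) × ℝ => y.2.1.1) := continuous_fst.comp hx0
  have hu : Continuous (fun y : ℝ × (Vec n × ℝ) × ℝ => y.2.1.2) := continuous_snd.comp hx0
  have hDc : Continuous D := by
    refine (continuous_snd.comp continuous_snd).smul ?_
    have h1 : Continuous (fderiv ℝ H) := hH.continuous_fderiv (by simp)
    have h2 : Continuous (fun y : ℝ × (Vec n × ℝ) × ℝ => y.2.1.1 o - W (y.1, y.2.1.1) + y.2.1.2) :=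
      (((continuous_apply o).comp hx).sub (hW.continuous.comp (continuous_fst.prodMk hx))).add hu
    exact (h1.comp ((continuous_fst.prodMk h2).prodMk hx)).clm_apply continuous_const
  obtain ⟨ν, h1, h2, h3⟩ := tube hK (O := {y | ‖D y‖ < k}) (isOpen_lt hDc.norm continuous_const) (by
    intro s y _
    simp [hD, hk])
  refine ⟨ν, h1, h2, ?_⟩
  intro s x c c' hc hc'
  obtain ⟨y, m, hy, rfl⟩ := exists_cube x
  have e1 : (y + zcast m) o = y o + (m o : ℝ) := rfl
  rw [hWper, e1] at hc hc'
  obtain ⟨d, rfl⟩ : ∃ d, c = d + (m o : ℝ) := ⟨c - m o, by ring⟩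
  obtain ⟨d', rfl⟩ : ∃ d, c' = d + (m o : ℝ) := ⟨c' - m o, by ring⟩
  rw [hHper, hHper]
  set z := y o - W (s, y) with hz
  have hder : ∀ u ∈ Icc (z-3) (z+3), HasDerivWithinAt (fun u => H ((s,u),y)) (fderiv ℝ H ((s,u),y) ((0,1),0)) (Icc (z-3) (z+3)) u := by
    intro u _
    have a1 : HasFDerivAt H (fderiv ℝ H ((s,u),y)) ((s,u),y) := (hH.differentiable (by simp)).differentiableAt.hasFDerivAt
    have a2 : HasDerivAt (fun u : ℝ => ((s,u),y)) (((0:ℝ),(1:ℝ)),(0:Vec n)) u :=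
      ((hasDerivAt_const u s).prodMk (hasDerivAt_id u)).prodMk (hasDerivAt_const u y)
    exact (a1.comp_hasDerivAt u a2).hasDerivWithinAt
  have hν := (h2 s).1
  have hbound : ∀ u ∈ Icc (z-3) (z+3), ‖fderiv ℝ H ((s,u),y) ((0,1),0)‖ ≤ k / ν s := by
    intro u hu
    have := h3 s (y, u - z) ⟨hy, by constructor <;> linarith [hu.1, hu.2]⟩ (ν s) (by simp [abs_of_pos hν])
    simp only [hD, mem_ofPred_eq, norm_smul] at this
    rw [show y o - W (s,y) + (u - z) = u by rw [hz]; ring, Real.norm_eq_abs, abs_of_pos hν] at this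
    rw [le_div_iff₀ hν, mul_comm]
    exact this.le
  have hmem : ∀ d : ℝ, |d + (m o : ℝ) - (y o + (m o : ℝ) - W (s,y))| ≤ 3 → d ∈ Icc (z-3) (z+3) := by
    intro d h
    rw [show d + (m o : ℝ) - (y o + (m o : ℝ) - W (s,y)) = d - z by rw [hz]; ring, abs_le] at h
    constructor <;> linarith [h.1, h.2]
  have := (convex_Icc (z-3) (z+3)).norm_image_sub_le_of_norm_hasDerivWithin_le hder hbound (hmem d' hc') (hmem d hc)
  rw [Real.norm_eq_abs] at this
  calc _ ≤ ν s * (k / ν s * |d - d'|) := by gcongr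
    _ = k * |d + (m o : ℝ) - (d' + m o)| := by
      rw [show d + (m o : ℝ) - (d' + m o) = d - d' by ring]; field_simp
end
end

noncomputable section
open Set Filter Topology
open scoped ContDiff

theorem add_int_of_add_one {h : ℝ → ℝ} {c : ℝ} (hh : ∀ t, h (t + 1) = h t + c) (t : ℝ) (m : ℤ) :
    h (t + m) = h t + m * c := by
  have hp : Function.Periodic (fun u => h u - u * c) 1 := by
    intro u; simp only [hh]; ring
  have := hp.int_mul m t
  simp only [mul_one] at this
  linarith

section
variable {n ℓ r : ℕ} {σ : (i : ℕ) → ℝ × Vec n → SymMap n ℓ i} {ε : ℝ}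
variable {o : Fin n} {W : ℝ × Vec n → ℝ} {zz : ℝ × ℝ → ℝ}
  {bb EE : ℕ → ℝ × ℝ → ℝ} {H : (ℝ × ℝ) × Vec n → Vec ℓ} {κ θ : ℝ → ℝ} {g : Vec n → Vec ℓ}

theorem Qf_eq (b : ℕ → ℝ × ℝ → ℝ) (a : ℝ × ℝ) (x : Vec n) (c : ℝ) :
    Qf r o W zz b a x = (b 0 a - c) +
      psum r (x o - W (a.1, x) - zz a) (Fin.cons c (fun j : Fin r => b (j+1) a)) := by
  unfold Qf psum
  rw [Finset.sum_range_succ', Fin.sum_univ_succ, Finset.sum_range]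
  simp
  ring

theorem XX_per (hWper : ∀ s x m, W (s, x + zcast m) = W (s, x))
    (hz1 : ∀ s t, zz (s, t + 1) = zz (s, t) + 1) (s : ℝ) (m : Fin n → ℤ) (p : Vec n) :
    XX o W zz (s, p + zcast m) = XX o W zz (s, p) + zcast m := by
  funext j
  by_cases h : j = o
  · subst h
    have := add_int_of_add_one (h := fun t => zz (s,t)) (c := 1) (hz1 s) (p j) (m j)
    simp only [XX, Function.update_self, Pi.add_apply, hWper]
    simp only [zcast, mul_one] at this ⊢
    rw [this]; ring
  · simp [XX, h]

theorem ff_per (hWper : ∀ s x m, W (s, x + zcast m) = W (s, x))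
    (hz1 : ∀ s t, zz (s, t + 1) = zz (s, t) + 1)
    (hE1 : ∀ j s t, EE j (s, t+1) = EE j (s, t))
    (hb1 : ∀ j s t, 1 ≤ j → bb j (s, t+1) = bb j (s, t))
    (hb0 : ∀ s t, θ s = 1 → bb 0 (s, t+1) = bb 0 (s, t) + 1)
    (hHper : ∀ s c x m, H ((s, c + (m o : ℝ)), x + zcast m) = H ((s, c), x))
    (hgper : ∀ (m : Fin n → ℤ) (p : Vec n), g (p + zcast m) = g p)
    (halt : ∀ s, θ s = 1 ∨ ∀ c x, H ((s, c), x) = g x) (s t : ℝ) (m : Fin n → ℤ) (x : Vec n) :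
    ff r o W zz bb EE H κ ((s, t + (m o : ℝ)), x + zcast m) = ff r o W zz bb EE H κ ((s, t), x) := by
  have hz : zz (s, t + (m o : ℝ)) = zz (s, t) + m o := by
    have := add_int_of_add_one (h := fun t => zz (s,t)) (c := 1) (hz1 s) t (m o)
    simpa using this
  have hE : ∀ j, EE j (s, t + (m o : ℝ)) = EE j (s, t) := by
    intro j
    have := add_int_of_add_one (h := fun t => EE j (s,t)) (c := 0) (fun t => by simp [hE1]) t (m o)
    simpa using this
  have hb : ∀ j : ℕ, bb (j+1) (s, t + (m o : ℝ)) = bb (j+1) (s, t) := by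
    intro j
    have := add_int_of_add_one (h := fun t => bb (j+1) (s,t)) (c := 0) (fun t => by simp [hb1]) t (m o)
    simpa using this
  have hu : (x + zcast m) o - W (s, x + zcast m) - zz (s, t + (m o : ℝ)) = x o - W (s, x) - zz (s, t) := by
    rw [hWper, hz]; simp [zcast]; ring
  have hQE : Qf r o W zz EE (s, t + (m o : ℝ)) (x + zcast m) = Qf r o W zz EE (s, t) x := by
    unfold Qf
    simp only [hu, hE]
  simp only [ff, hQE]
  congr 1
  rcases halt s with h | h
  · have h0 : bb 0 (s, t + (m o : ℝ)) = bb 0 (s, t) + m o := by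
      have := add_int_of_add_one (h := fun t => bb 0 (s,t)) (c := 1) (fun t => hb0 s t h) t (m o)
      simpa using this
    have hQ : Qf r o W zz bb (s, t + (m o : ℝ)) (x + zcast m) = Qf r o W zz bb (s, t) x + m o := by
      rw [Qf_eq _ _ _ 0, Qf_eq _ _ _ 0]
      simp only [hu, hb, h0]; ring
    rw [hQ, hHper]
  · rw [h, h, hgper]

theorem ZZ_per (hWper : ∀ s x m, W (s, x + zcast m) = W (s, x))
    (hz1 : ∀ s t, zz (s, t + 1) = zz (s, t) + 1)
    (hE1 : ∀ j s t, EE j (s, t+1) = EE j (s, t))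
    (hb1 : ∀ j s t, 1 ≤ j → bb j (s, t+1) = bb j (s, t))
    (hb0 : ∀ s t, θ s = 1 → bb 0 (s, t+1) = bb 0 (s, t) + 1)
    (hHper : ∀ s c x m, H ((s, c + (m o : ℝ)), x + zcast m) = H ((s, c), x))
    (hgper : ∀ (m : Fin n → ℤ) (p : Vec n), g (p + zcast m) = g p)
    (halt : ∀ s, θ s = 1 ∨ ∀ c x, H ((s, c), x) = g x) (i : ℕ) (s : ℝ) (m : Fin n → ℤ) (p : Vec n) :
    ZZ r o W zz bb EE H κ i (s, p + zcast m) = ZZ r o W zz bb EE H κ i (s, p) := by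
  unfold ZZ
  rw [XX_per hWper hz1, ← iteratedFDeriv_comp_add_right]
  have : (fun y => ff r o W zz bb EE H κ ((s, (p + zcast m) o), y + zcast m)) =
      fun y => ff r o W zz bb EE H κ ((s, p o), y) := by
    funext y
    exact ff_per hWper hz1 hE1 hb1 hb0 hHper hgper halt s (p o) m y
  exact congrArg (fun f => iteratedFDeriv ℝ i f (XX o W zz (s, p))) this

theorem inj0 {k : ℝ} {D ν : ℝ → ℝ} (hk : 0 < k) (hκ : ∀ s, κ s = k * θ s) (k0 : Fin ℓ)
    (hWo : ∀ s x y, (∀ j, j ≠ o → x j = y j) → W (s, x) = W (s, y))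
    (hz0 : ∀ s t, s ≤ 0 → zz (s, t) = t) (hθ : ∀ s > 0, 0 < θ s)
    (halt : ∀ s, θ s = 1 ∨ ∀ c x, H ((s, c), x) = g x)
    (hzD : ∀ s t, |zz (s, t) - t| ≤ D s) (hbD : ∀ s t, θ s = 1 → |bb 0 (s, t) - t| ≤ D s)
    (hν : ∀ s, 0 < ν s ∧ ν s ≤ 1) (hD : ∀ s, D s ≤ ν s / 2)
    (hlip : ∀ s x c c', |c - (x o - W (s, x))| ≤ 3 → |c' - (x o - W (s, x))| ≤ 3 →
        ν s * ‖H ((s, c), x) - H ((s, c'), x)‖ ≤ k * |c - c'|)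
    (hinj : ∀ s t t', t ≠ t' → zz (s, t) = zz (s, t') → EE 0 (s, t) ≠ EE 0 (s, t') ∧
      |bb 0 (s, t) - bb 0 (s, t')| ≤ D s * |EE 0 (s, t) - EE 0 (s, t')|)
    (s : ℝ) (p q : Vec n) (hX : XX o W zz (s, p) = XX o W zz (s, q))
    (hZ : ZZ r o W zz bb EE H κ 0 (s, p) = ZZ r o W zz bb EE H κ 0 (s, q)) : p = q := by
  have hj : ∀ j, j ≠ o → p j = q j := by
    intro j hj
    have := congrFun hX j
    simpa [XX, hj] using this
  have hzz : zz (s, p o) = zz (s, q o) := by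
    have := congrFun hX o
    simp only [XX, Function.update_self, hWo s p q hj] at this
    linarith
  by_contra hne
  have ho : p o ≠ q o := by
    intro h
    apply hne
    funext j
    by_cases h' : j = o
    · rw [h', h]
    · exact hj j h'
  obtain ⟨hE, hb⟩ := hinj s _ _ ho hzz
  have hs : 0 < s := by
    by_contra h
    rw [hz0 s _ (not_lt.1 h), hz0 s _ (not_lt.1 h)] at hzz
    exact ho hzz
  have h0 := DFunLike.congr_fun hZ (fun i => i.elim0)
  simp only [ZZ, iteratedFDeriv_zero_apply, ff] at h0
  rw [Qf_XX hWo, Qf_XX hWo, Qf_XX hWo, Qf_XX hWo, ← hX] at h0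
  set x := XX o W zz (s, p) with hx
  have hom : x o - W (s, x) = zz (s, p o) := om_XX hWo s p
  set ΔE := EE 0 (s, p o) - EE 0 (s, q o) with hΔ
  have hΔ0 : 0 < |ΔE| := abs_pos.2 (sub_ne_zero.2 hE)
  have h1 : (H ((s, bb 0 (s, p o)), x) - H ((s, bb 0 (s, q o)), x)) k0 = - (κ s * ΔE) := by
    have := congrFun h0 k0
    simp only [Pi.add_apply, Pi.smul_apply, Pi.one_apply, smul_eq_mul, mul_one] at this
    simp only [Pi.sub_apply, hΔ]
    linarith
  rcases halt s with h | h
  · have hD1 : D s ≤ 1 := by linarith [hD s, (hν s).2]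
    have a1 := hlip s x (bb 0 (s, p o)) (bb 0 (s, q o))
      (by
        rw [hom, abs_le]
        have a := abs_le.1 (hbD s (p o) h); have b := abs_le.1 (hzD s (p o))
        constructor <;> linarith [a.1, a.2, b.1, b.2])
      (by
        rw [hom, hzz, abs_le]
        have a := abs_le.1 (hbD s (q o) h); have b := abs_le.1 (hzD s (q o))
        constructor <;> linarith [a.1, a.2, b.1, b.2])
    have a2 := norm_le_pi_norm (H ((s, bb 0 (s, p o)), x) - H ((s, bb 0 (s, q o)), x)) k0
    rw [h1, norm_neg, Real.norm_eq_abs, hκ, h, mul_one, abs_mul, abs_of_pos hk] at a2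
    have a3 : ν s * (k * |ΔE|) ≤ k * (ν s / 2 * |ΔE|) :=
      calc _ ≤ ν s * ‖H ((s, bb 0 (s, p o)), x) - H ((s, bb 0 (s, q o)), x)‖ := by
            have := (hν s).1
            gcongr
        _ ≤ _ := a1
        _ ≤ k * (D s * |ΔE|) := by gcongr
        _ ≤ _ := by gcongr; exact hD s
    have a4 : 0 < ν s * (k * |ΔE|) := mul_pos (hν s).1 (mul_pos hk hΔ0)
    nlinarith
  · rw [h, h, sub_self, hκ] at h1
    have : k * θ s * ΔE ≠ 0 := mul_ne_zero (mul_pos hk (hθ s hs)).ne' (abs_pos.1 hΔ0)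
    simp at h1
    rcases h1 with (h1 | h1) | h1
    · exact hk.ne' h1
    · exact (hθ s hs).ne' h1
    · exact abs_pos.1 hΔ0 h1

theorem approx (hσ : SigmaOK n ℓ r σ) {k C δ : ℝ} {D ν : ℝ → ℝ} (hk : 0 < k) (hC : 0 < C) (hkC : k * C ≤ δ) (hκ : ∀ s, κ s = k * θ s)
    (hθI : ∀ s, θ s ∈ Icc 0 1) (hθs : ContDiff ℝ ∞ κ) (hWs : ContDiff ℝ ∞ W) (hHs : ContDiff ℝ ∞ H)
    (hWo : ∀ s x y, (∀ j, j ≠ o → x j = y j) → W (s, x) = W (s, y))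
    (halt : ∀ s, θ s = 1 ∨ ∀ c x, H ((s, c), x) = g x)
    (hzD : ∀ s t, |zz (s, t) - t| ≤ D s) (hbD : ∀ s t, θ s = 1 → |bb 0 (s, t) - t| ≤ D s)
    (hE0 : ∀ s t, |EE 0 (s, t)| ≤ C)
    (hj : ∀ s t j, 1 ≤ j → j ≤ r → |EE j (s, t)| ≤ D s ∧ |bb j (s, t)| ≤ D s)
    (hν : ∀ s, 0 < ν s ∧ ν s ≤ 1) (hD : ∀ s, D s ≤ ν s / 2)
    (hjets : ∀ s x (m : PP r), ‖m‖ ≤ ν s → Good r σ ε (fun x' => Phi o W H κ ((s, x o - W (s, x), m), x')) s x)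
    (s : ℝ) (p : Vec n) :
    Good r σ (ε + δ) (fun x' => ff r o W zz bb EE H κ ((s, p o), x')) s (XX o W zz (s, p)) := by
  classical
  set c : ℝ := if θ s = 1 then bb 0 (s, p o) - zz (s, p o) else 0 with hc
  set m : PP r := (Fin.cons c (fun j : Fin r => bb (j+1) (s, p o)), Fin.cons 0 (fun j : Fin r => EE (j+1) (s, p o))) with hm
  have hνs := (hν s).1
  have hm1 : ‖m‖ ≤ ν s := by
    rw [Prod.norm_def]
    apply max_le
    · rw [pi_norm_le_iff_of_nonneg hνs.le]
      intro j
      refine Fin.cases ?_ (fun j => ?_) j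
      · simp only [hm, Fin.cons_zero, Real.norm_eq_abs, hc]
        split_ifs with h
        · have a := abs_le.1 (hbD s (p o) h); have b := abs_le.1 (hzD s (p o)); have d := hD s
          rw [abs_le]; constructor <;> linarith [a.1, a.2, b.1, b.2]
        · simpa using hνs.le
      · simp only [hm, Fin.cons_succ, Real.norm_eq_abs]
        have := (hj s (p o) (j+1) (by omega) (by omega)).2
        linarith [hD s]
    · rw [pi_norm_le_iff_of_nonneg hνs.le]
      intro j
      refine Fin.cases ?_ (fun j => ?_) j
      · simpa [hm] using hνs.le
      · simp only [hm, Fin.cons_succ, Real.norm_eq_abs]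
        have := (hj s (p o) (j+1) (by omega) (by omega)).1
        linarith [hD s]
  have h1 := hjets s (XX o W zz (s, p)) m hm1
  have hPs : ContDiff ℝ ∞ (fun x' => Phi o W H κ ((s, XX o W zz (s,p) o - W (s, XX o W zz (s,p)), m), x')) :=
    ContDiff.comp (g := Phi o W H κ) (Phi_smooth hWs hHs hθs) (contDiff_const.prodMk contDiff_id)
  have h2 := h1.add_const hPs (δ := δ) ((κ s * EE 0 (s, p o)) • (1 : Vec ℓ)) (by
    rw [pi_norm_le_iff_of_nonneg (le_trans (by positivity) hkC)]
    intro j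
    simp only [Pi.smul_apply, Pi.one_apply, smul_eq_mul, mul_one, Real.norm_eq_abs]
    rw [hκ, abs_mul, abs_mul, abs_of_pos hk, abs_of_nonneg (hθI s).1]
    calc _ ≤ k * 1 * C := by
          gcongr
          · exact (hθI s).2
          · exact hE0 s _
      _ ≤ _ := by rw [mul_one]; exact hkC)
  rw [om_XX hWo] at h2
  refine h2.congr (Eventually.of_forall fun x' => ?_)
  simp only [ff, Phi, hm]
  rw [Qf_eq EE _ _ 0]
  have hH : H ((s, Qf r o W zz bb (s, p o) x'), x') = H ((s, zz (s, p o) + psum r (x' o - W (s, x') - zz (s, p o))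
      (Fin.cons c (fun j : Fin r => bb (j+1) (s, p o)))), x') := by
    rcases halt s with h | h
    · rw [Qf_eq bb _ _ c]
      congr 3
      simp only [hc, h, if_true]; ring
    · rw [h, h]
  rw [hH, sub_zero, mul_add, add_smul]
  abel
end
end

noncomputable section
open Set Filter Topology
open scoped ContDiff

theorem move {n ℓ r : ℕ} {σ : (i : ℕ) → ℝ × Vec n → SymMap n ℓ i} {ε ε₁ : ℝ} (o : Fin n)
    (hσ : SigmaOK n ℓ r σ) (hε : 0 < ε) (hε₁ : 0 < ε₁) :
    ∃ ν : ℝ → ℝ, ContDiff ℝ ∞ ν ∧ (∀ s, 0 < ν s ∧ ν s ≤ 1) ∧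
      ∀ s x, ∀ m : ℝ, |m| ≤ ν s → |m| < ε ∧ ∀ i ≤ r, ‖σ i (s, x + m • Pi.single o 1) - σ i (s, x)‖ < ε₁ := by
  have hK : IsCompact (Icc (0 : Vec n) 1) := isCompact_Icc
  have hx : Continuous (fun y : ℝ × Vec n × ℝ => y.2.1) := continuous_fst.comp continuous_snd
  have hm : Continuous (fun y : ℝ × Vec n × ℝ => y.2.2) := continuous_snd.comp continuous_snd
  have hO : IsOpen ({y : ℝ × Vec n × ℝ | |y.2.2| < ε} ∩ ⋂ i ∈ Set.Iic r,
      {y : ℝ × Vec n × ℝ | ‖σ i (y.1, y.2.1 + y.2.2 • Pi.single o 1) - σ i (y.1, y.2.1)‖ < ε₁}) := by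
    apply IsOpen.inter (isOpen_lt hm.abs continuous_const)
    apply Set.Finite.isOpen_biInter (Set.finite_Iic r)
    intro i hi
    exact isOpen_lt ((((hσ.cont i hi).comp (continuous_fst.prodMk (hx.add (hm.smul continuous_const)))).sub
      ((hσ.cont i hi).comp (continuous_fst.prodMk hx))).norm) continuous_const
  obtain ⟨ν, h1, h2, h3⟩ := tube hK hO (by
    intro s y _
    simp [hε, hε₁])
  refine ⟨ν, h1, h2, fun s x m hm => ?_⟩
  obtain ⟨y, k, hy, rfl⟩ := exists_cube x
  have := h3 s y hy m hm
  simp only [mem_inter_iff, mem_ofPred_eq, mem_iInter, mem_Iic] at this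
  refine ⟨this.1, fun i hi => ?_⟩
  rw [add_right_comm, hσ.per i hi, hσ.per i hi]
  exact this.2 i hi

theorem XX_eq {n : ℕ} {o : Fin n} {W : ℝ × Vec n → ℝ} {zz : ℝ × ℝ → ℝ} (s : ℝ) (p : Vec n) :
    XX o W zz (s, p) = p + (zz (s, p o) - p o + W (s, p)) • Pi.single o 1 := by
  funext j
  by_cases h : j = o
  · subst h; simp [XX]; ring
  · simp [XX, h]

/-- Parametric holonomic approximation by multi-sections, relative in the parameter
(del Pino–Toussaint, Theorem 8.5), over the `n`-torus with real parameter `s`. -/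
theorem parametric_holonomic_approximation_rel_parameter
    (n ℓ r : ℕ) (hn : 1 ≤ n) (hℓ : 1 ≤ ℓ) (hr : 1 ≤ r)
    (ε : ℝ) (hε : 0 < ε)
    (σ : (i : ℕ) → ℝ × Vec n → SymMap n ℓ i)
    (hσcont : ∀ i ≤ r, Continuous (σ i))
    (hσper : ∀ i ≤ r, ∀ (s : ℝ) (m : Fin n → ℤ) (p : Vec n),
      σ i (s, p + zcast m) = σ i (s, p))
    (hσsym : ∀ i ≤ r, ∀ (s : ℝ) (p : Vec n), IsSymmMap (σ i (s, p)))
    -- the family is holonomic for `s ≤ 0`, equal to the jet of a smooth periodic `g`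
    (g : Vec n → Vec ℓ) (hg : ContDiff ℝ (⊤ : ℕ∞) g)
    (hgper : ∀ (m : Fin n → ℤ) (p : Vec n), g (p + zcast m) = g p)
    (hhol : ∀ s ≤ (0 : ℝ), ∀ (p : Vec n), ∀ i ≤ r, σ i (s, p) = iteratedFDeriv ℝ i g p) :
    ∃ (X : ℝ × Vec n → Vec n) (ζ : (i : ℕ) → ℝ × Vec n → SymMap n ℓ i),
      -- jointly smooth
      ContDiff ℝ (⊤ : ℕ∞) X ∧ (∀ i ≤ r, ContDiff ℝ (⊤ : ℕ∞) (ζ i)) ∧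
      -- (a) relative condition: nothing happens for `s ≤ 0`
      (∀ s ≤ (0 : ℝ), ∀ p : Vec n,
        X (s, p) = p ∧ ∀ i ≤ r, ζ i (s, p) = iteratedFDeriv ℝ i g p) ∧
      -- (b) for every `s`, a ℤⁿ-equivariant integral r-jet tuple (valued in `Sym^i`)
      (∀ i ≤ r, ∀ (s : ℝ) (p : Vec n), IsSymmMap (ζ i (s, p))) ∧
      (∀ (s : ℝ) (m : Fin n → ℤ) (p : Vec n), X (s, p + zcast m) = X (s, p) + zcast m) ∧
      (∀ i ≤ r, ∀ (s : ℝ) (m : Fin n → ℤ) (p : Vec n), ζ i (s, p + zcast m) = ζ i (s, p)) ∧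
      (∀ (s : ℝ), ∀ i < r, ∀ (p v : Vec n) (w : Fin i → Vec n),
        (fderiv ℝ (fun q => ζ i (s, q)) p v) w
          = ζ (i + 1) (s, p) (Fin.cons (fderiv ℝ (fun q => X (s, q)) p v) w)) ∧
      -- (c) dense graphicality locus for each `s`
      (∀ s : ℝ, Dense {p : Vec n | Function.Bijective ⇑(fderiv ℝ (fun q => X (s, q)) p)}) ∧
      -- (d) the fronts are injective modulo ℤⁿ
      (∀ (s : ℝ) (p q : Vec n) (m : Fin n → ℤ),
        X (s, p) = X (s, q) + zcast m → ζ 0 (s, p) = ζ 0 (s, q) → p = q + zcast m) ∧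
      -- (e) approximation
      (∀ (s : ℝ) (p : Vec n), ‖X (s, p) - p‖ < ε) ∧
      (∀ i ≤ r, ∀ (s : ℝ) (p : Vec n), ‖ζ i (s, p) - σ i (s, p)‖ < ε) := by
  have hσ : SigmaOK n ℓ r σ := ⟨hσcont, hσper, hσsym⟩
  set o : Fin n := ⟨0, hn⟩
  obtain ⟨C, hC, z, z', E, b, c1, c2, c3, c4, c5, c6, c7, c8, c9, c10, c11, c12, c13, c14, c15⟩ := lemmaZ r hr
  set ε₁ := ε / 4 with hε₁def
  have hε₁ : 0 < ε₁ := by positivity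
  obtain ⟨η, hηs, hη, hmove⟩ := move (ε₁ := ε₁) o hσ hε hε₁
  obtain ⟨θ, H, W, hθs, hθI, hθ0, hθpos, hHs, hWs, hWper, hWo, hW0, hH0, hHper, halt, hgood, hWη⟩ :=
    base (ε := ε₁) o hσ hε₁ g hg hgper hhol (fun s => η s / 2) (hηs.continuous.div_const 2)
      (fun s => half_pos (hη s).1)
  set k := ε₁ / (C + 1) with hkdef
  have hk : 0 < k := by positivity
  have hkC : k * C ≤ ε₁ := by
    rw [hkdef, div_mul_eq_mul_div, div_le_iff₀ (by positivity)]; nlinarith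
  set κ : ℝ → ℝ := fun s => k * θ s with hκ
  have hκs : ContDiff ℝ ∞ κ := contDiff_const.mul hθs
  obtain ⟨ν₁, hν₁s, hν₁, hjets⟩ := jets (r := r) (κ := κ) hσ hWs hHs hκs hWper hHper hgood
  obtain ⟨ν₂, hν₂s, hν₂, hlip⟩ := lip hWs hHs hWper hHper hk
  set N : ℝ → ℝ := fun s => ν₁ s * ν₂ s * η s with hN
  have hNpos : ∀ s, 0 < N s := fun s => mul_pos (mul_pos (hν₁ s).1 (hν₂ s).1) (hη s).1
  have hN12 : ∀ s, ν₁ s * ν₂ s ≤ 1 := fun s => mul_le_one₀ (hν₁ s).2 (hν₂ s).1.le (hν₂ s).2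
  have hNη : ∀ s, N s ≤ η s := fun s => mul_le_of_le_one_left (hη s).1.le (hN12 s)
  have hNle12 : ∀ s, N s ≤ ν₁ s * ν₂ s := fun s =>
    mul_le_of_le_one_right (mul_pos (hν₁ s).1 (hν₂ s).1).le (hη s).2
  have hN1 : ∀ s, N s ≤ ν₁ s := fun s => (hNle12 s).trans (mul_le_of_le_one_right (hν₁ s).1.le (hν₂ s).2)
  have hN2 : ∀ s, N s ≤ ν₂ s := fun s => (hNle12 s).trans (mul_le_of_le_one_left (hν₂ s).1.le (hν₁ s).2)
  have hNs : ContDiff ℝ ∞ N := (hν₁s.mul hν₂s).mul hηs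
  set lam : ℝ → ℝ := fun s => (2 * C + 2) / N s with hlam
  have hlams : ContDiff ℝ ∞ lam := contDiff_const.div hNs (fun s => (hNpos s).ne')
  have hlam1 : ∀ s, 1 ≤ lam s := by
    intro s
    rw [hlam, le_div_iff₀ (hNpos s)]
    linarith [(hNη s).trans (hη s).2]
  set D : ℝ → ℝ := fun s => C / lam s with hD
  have hDN : ∀ s, D s ≤ N s / 2 := by
    intro s
    have h0 := hNpos s
    simp only [hD, hlam]
    rw [div_div_eq_mul_div, div_le_div_iff₀ (by positivity) (by norm_num)]
    nlinarith
  set zz : ℝ × ℝ → ℝ := fun a => z (θ a.1) (lam a.1) a.2 with hzz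
  set bb : ℕ → ℝ × ℝ → ℝ := fun j a => b j (θ a.1) (lam a.1) a.2 with hbb
  set EE : ℕ → ℝ × ℝ → ℝ := fun j a => E j (θ a.1) (lam a.1) a.2 with hEE
  have hpar : ContDiff ℝ ∞ (fun a : ℝ × ℝ => (θ a.1, lam a.1, a.2)) :=
    (hθs.comp contDiff_fst).prodMk ((hlams.comp contDiff_fst).prodMk contDiff_snd)
  have hzs : ContDiff ℝ ∞ zz := c1.comp hpar
  have hbs : ∀ j, ContDiff ℝ ∞ (bb j) := fun j => (c3 j).comp hpar
  have hEs : ∀ j, ContDiff ℝ ∞ (EE j) := fun j => (c2 j).comp hpar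
  have hz1 : ∀ s t, zz (s, t + 1) = zz (s, t) + 1 := fun s t => c4 _ _ _
  have hz0 : ∀ s t, s ≤ 0 → zz (s, t) = t := fun s t hs => by
    simp only [hzz, hθ0 s hs, c5]
  have hE1 : ∀ j s t, EE j (s, t+1) = EE j (s, t) := fun j s t => c6 _ _ _ _
  have hb1 : ∀ j s t, 1 ≤ j → bb j (s, t+1) = bb j (s, t) := fun j s t h => c7 _ _ _ _ h
  have hb0 : ∀ s t, θ s = 1 → bb 0 (s, t+1) = bb 0 (s, t) + 1 := fun s t h => by
    simp only [hbb, h]; exact c8 _ _ (hlam1 s)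
  have hz' : ∀ s t, HasDerivAt (fun t => zz (s, t)) (z' (θ s) (lam s) t) t := fun s t => c9 (θ s) (lam s) t
  have hb' : ∀ j < r, ∀ s t, HasDerivAt (fun t => bb j (s, t)) (bb (j+1) (s, t) * z' (θ s) (lam s) t) t :=
    fun j hj s t => c11 j (θ s) (lam s) t hj
  have hE' : ∀ j < r, ∀ s t, HasDerivAt (fun t => EE j (s, t)) (EE (j+1) (s, t) * z' (θ s) (lam s) t) t :=
    fun j hj s t => c10 j (θ s) (lam s) t hj
  have hzD : ∀ s t, |zz (s, t) - t| ≤ D s := fun s t => (c14 _ _ t (hθI s) (hlam1 s)).1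
  have hbD : ∀ s t, θ s = 1 → |bb 0 (s, t) - t| ≤ D s := fun s t h => by
    simp only [hbb, h]; exact c15 _ _ (hlam1 s)
  have hXp : ∀ s p, ∃ m : ℝ, |m| ≤ η s ∧ XX o W zz (s, p) = p + m • Pi.single o 1 := by
    intro s p
    refine ⟨zz (s, p o) - p o + W (s, p), ?_, ?_⟩
    · have h1 := hzD s (p o)
      have h2 := (hWη s p).le
      have h3 := hDN s
      have h4 := hNη s
      have h5 := abs_add_le (zz (s, p o) - p o) (W (s, p))
      linarith
    · exact XX_eq s p
  refine ⟨XX o W zz, ZZ r o W zz bb EE H κ, XX_smooth hWs hzs,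
    fun i _ => ZZ_smooth hWs hzs hbs hEs hHs hκs i, ?_,
    fun i _ s p => ZZ_symm hWs hzs hbs hEs hHs hκs i (s, p),
    XX_per hWper hz1,
    fun i _ => ZZ_per hWper hz1 hE1 hb1 hb0 hHper hgper halt i,
    fun s i hi p v w => ZZ_integ hWs hzs hbs hEs hHs hκs (z' := fun s => z' (θ s) (lam s)) hWo hz' hb' hE' s i hi p v w,
    fun s => XX_dense hWs hzs (z' := fun s => z' (θ s) (lam s)) hWo hz' s (c12 _ _ (hθI s) (hlam1 s)),
    ?_, ?_, ?_⟩
  · intro s hs p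
    have hX : XX o W zz (s, p) = p := by
      simp only [XX, hz0 s _ hs, hW0 s hs, add_zero, Function.update_eq_self]
    refine ⟨hX, fun i _ => ?_⟩
    have hf : (fun x' => ff r o W zz bb EE H κ ((s, p o), x')) = g := by
      funext x'
      simp [ff, hH0 s hs, hκ, hθ0 s hs]
    show iteratedFDeriv ℝ i (fun x' => ff r o W zz bb EE H κ ((s, p o), x')) (XX o W zz (s, p)) = _
    rw [hX, hf]
  · intro s p q m h1 h2
    refine inj0 (r := r) (k := k) (D := D) (ν := ν₂) (κ := κ) (θ := θ) (H := H) (EE := EE) (bb := bb) (zz := zz) hk (fun s => rfl) ⟨0, hℓ⟩ hWo hz0 hθpos halt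
      hzD hbD hν₂ (fun s => by linarith [hDN s, hN2 s]) hlip
      (fun s t t' h h' => c13 _ _ _ _ (hθI s) (hlam1 s) h h') s p (q + zcast m) ?_ ?_
    · rw [h1, XX_per hWper hz1]
    · rw [h2, ZZ_per hWper hz1 hE1 hb1 hb0 hHper hgper halt]
  · intro s p
    obtain ⟨m, hm, hX⟩ := hXp s p
    rw [hX, add_sub_cancel_left, norm_smul, Real.norm_eq_abs]
    have : ‖(Pi.single o 1 : Vec n)‖ ≤ 1 := by
      rw [pi_norm_le_iff_of_nonneg zero_le_one]
      intro j
      by_cases h : j = o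
      · rw [h, Pi.single_eq_same]; simp
      · rw [Pi.single_eq_of_ne h]; simp
    calc |m| * _ ≤ |m| * 1 := by gcongr
      _ < ε := by rw [mul_one]; exact (hmove s p m hm).1
  · intro i hi s p
    have h1 := approx (r := r) (ε := ε₁) (k := k) (C := C) (δ := ε₁) (D := D) (ν := ν₁) (κ := κ) (θ := θ)
      (zz := zz) (bb := bb) (EE := EE) hσ hk hC hkC (fun s => rfl) hθI hκs hWs hHs hWo halt hzD hbD
      (fun s t => (c14 _ _ t (hθI s) (hlam1 s)).2.1)
      (fun s t j h h' => (c14 _ _ t (hθI s) (hlam1 s)).2.2 j h h') hν₁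
      (fun s => by linarith [hDN s, hN1 s]) hjets s p i hi
    obtain ⟨m, hm, hX⟩ := hXp s p
    have h2 := (hmove s p m hm).2 i hi
    rw [← hX] at h2
    calc ‖ZZ r o W zz bb EE H κ i (s, p) - σ i (s, p)‖
        ≤ ‖ZZ r o W zz bb EE H κ i (s, p) - σ i (s, XX o W zz (s, p))‖ +
          ‖σ i (s, XX o W zz (s, p)) - σ i (s, p)‖ := norm_sub_le_norm_sub_add_norm_sub _ _ _
      _ < (ε₁ + ε₁) + ε₁ := add_lt_add h1 h2
      _ < ε := by linarith
end
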